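/- Assume 0 < γ ≤ 2 and (H3), and let f be a conservative mild solution of the Boltzmann–Fermi–Dirac equation with initial datum f₀. Suppose f₀(v) ≤ e^{−a₀|v|² + c₀} for almost every v ∈ ℝ³, where a₀ > 0 and c₀ ∈ ℝ. Then there exist a ∈ (0, a₀) and c ∈ ℝ such that f(t,v) ≤ e^{−a|v|² + c} for almost every v ∈ ℝ³ and every t ≥ 0. -/

import Mathlib

noncomputable section

open MeasureTheory Real Set
open scoped RealInnerProductSpace

/-- `ℝ³` as a Euclidean space. -/
abbrev R3 : Type := EuclideanSpace ℝ (Fin 3)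

/-- The unit sphere `𝕊²` in `ℝ³`. -/
abbrev S2 : Type := Metric.sphere (0 : R3) 1

/-- The surface measure on the unit sphere in `ℝ³` (total mass `4π`). -/
def sphMeasure : Measure S2 := Measure.toSphere (volume : Measure R3)

/-- Post-collision velocity `v' = (v+v_*)/2 + (|v-v_*|/2)σ`. -/
def vOut (v w : R3) (σ : S2) : R3 := (2⁻¹ : ℝ) • (v + w) + (‖v - w‖ / 2) • (σ : R3)

/-- Post-collision velocity `v'_* = (v+v_*)/2 - (|v-v_*|/2)σ`. -/
def vOutStar (v w : R3) (σ : S2) : R3 := (2⁻¹ : ℝ) • (v + w) - (‖v - w‖ / 2) • (σ : R3)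

/-- `cos θ = ((v - v_*)/|v - v_*|) · σ`. -/
def cosAngle (v w : R3) (σ : S2) : ℝ := ⟪‖v - w‖⁻¹ • (v - w), (σ : R3)⟫

/-- The collision kernel `B(v - v_*, σ) = |v - v_*|^γ b(cos θ)`. -/
def Bker (γ : ℝ) (b : ℝ → ℝ) (v w : R3) (σ : S2) : ℝ := ‖v - w‖ ^ γ * b (cosAngle v w σ)

/-- Grad's angular cutoff assumption (H1), with the standing assumptions on `b`:
`b` is measurable, nonnegative, symmetric (`b(cos(π-θ)) = b(cos θ)`), and
`0 < C_b = 2π∫₀^π b(cos θ) sin θ dθ < ∞`. -/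
structure GradCutoff (b : ℝ → ℝ) : Prop where
  measurable : Measurable b
  nonneg : ∀ x : ℝ, 0 ≤ b x
  symm : ∀ θ : ℝ, b (Real.cos (π - θ)) = b (Real.cos θ)
  integrable : IntervalIntegrable (fun θ : ℝ => b (Real.cos θ) * Real.sin θ) volume 0 π
  pos : 0 < ∫ θ in (0:ℝ)..π, b (Real.cos θ) * Real.sin θ

/-- `C_b = 2π ∫₀^π b(cos θ) sin θ dθ`. -/
def Cb (b : ℝ → ℝ) : ℝ := 2 * π * ∫ θ in (0:ℝ)..π, b (Real.cos θ) * Real.sin θ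

/-- `C_{b,2} = 2π ∫₀^π b(cos θ) sin³ θ dθ`. -/
def Cb2 (b : ℝ → ℝ) : ℝ := 2 * π * ∫ θ in (0:ℝ)..π, b (Real.cos θ) * Real.sin θ ^ 3

/-- `φ(ε) = ∫_{𝕊²} b(cos θ)(1_{0<θ<ε} + 1_{π-ε<θ<π}) dσ`,
written via the polar-angle parametrization of the sphere. -/
def phiAng (b : ℝ → ℝ) (ε : ℝ) : ℝ :=
  2 * π * ((∫ θ in (0:ℝ)..ε, b (Real.cos θ) * Real.sin θ)
    + ∫ θ in (π - ε)..π, b (Real.cos θ) * Real.sin θ)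

/-- Weighted `L¹` norm `‖f‖_{1,s} = ∫ |f(v)| (1+|v|²)^{s/2} dv`. -/
def wnorm (s : ℝ) (f : R3 → ℝ) : ℝ := ∫ v : R3, |f v| * (1 + ‖v‖ ^ 2) ^ (s / 2)

/-- Membership in the weighted space `L¹_s`. -/
def MemL1s (s : ℝ) (f : R3 → ℝ) : Prop :=
  Integrable (fun v : R3 => |f v| * (1 + ‖v‖ ^ 2) ^ (s / 2))

/-- The Boltzmann–Fermi–Dirac collision operator `Q_FD(f,f)`. -/
def QFD (γ : ℝ) (b : ℝ → ℝ) (f : R3 → ℝ) (v : R3) : ℝ :=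
  ∫ w : R3, ∫ σ : S2, Bker γ b v w σ *
      (f (vOut v w σ) * f (vOutStar v w σ) * (1 - f v) * (1 - f w)
        - f v * f w * (1 - f (vOut v w σ)) * (1 - f (vOutStar v w σ))) ∂sphMeasure

/-- `Q₁(f₁,f₂,f₃)(v) = ∫∫ B f₁(v') f₂(v'_*) f₃(v_*) dσ dv_*`. -/
def Q1 (γ : ℝ) (b : ℝ → ℝ) (f₁ f₂ f₃ : R3 → ℝ) (v : R3) : ℝ :=
  ∫ w : R3, ∫ σ : S2, Bker γ b v w σ *
      (f₁ (vOut v w σ) * f₂ (vOutStar v w σ) * f₃ w) ∂sphMeasure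

/-- `L_FD(f, 1-f, 1-f)(v) = ∫∫ B f(v_*)(1-f(v'))(1-f(v'_*)) dσ dv_*`. -/
def LFD (γ : ℝ) (b : ℝ → ℝ) (f : R3 → ℝ) (v : R3) : ℝ :=
  ∫ w : R3, ∫ σ : S2, Bker γ b v w σ *
      (f w * (1 - f (vOut v w σ)) * (1 - f (vOutStar v w σ))) ∂sphMeasure

/-- The Fermi–Dirac entropy `S(f)` (with `0·ln 0 = 0`, as `Real.log 0 = 0`). -/
def entropy (f : R3 → ℝ) : ℝ :=
  -∫ v : R3, (f v * Real.log (f v) + (1 - f v) * Real.log (1 - f v))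

/-- A conservative mild solution of the Boltzmann–Fermi–Dirac equation with
initial datum `f₀`. -/
structure IsFDSolution (γ : ℝ) (b : ℝ → ℝ) (f₀ : R3 → ℝ) (f : ℝ → R3 → ℝ) : Prop where
  measurable : ∀ t : ℝ, Measurable (f t)
  nonneg : ∀ t : ℝ, 0 ≤ t → ∀ v : R3, 0 ≤ f t v
  le_one : ∀ t : ℝ, 0 ≤ t → ∀ v : R3, f t v ≤ 1
  memL12 : ∀ t : ℝ, 0 ≤ t → MemL1s 2 (f t)
  contL12 : ∀ t : ℝ, 0 ≤ t → ∀ ε : ℝ, 0 < ε → ∃ δ > 0, ∀ s : ℝ, 0 ≤ s →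
      |s - t| < δ → wnorm 2 (fun v => f s v - f t v) < ε
  mild : ∃ Z : Set R3, volume Z = 0 ∧ ∀ t : ℝ, 0 ≤ t → ∀ v : R3, v ∉ Z →
      f t v = f₀ v + ∫ τ in (0:ℝ)..t, QFD γ b (f τ) v
  mass : ∀ t : ℝ, 0 ≤ t → ∫ v : R3, f t v = ∫ v : R3, f₀ v
  momentum : ∀ t : ℝ, 0 ≤ t → ∫ v : R3, f t v • v = ∫ v : R3, f₀ v • v
  energy : ∀ t : ℝ, 0 ≤ t → ∫ v : R3, f t v * ‖v‖ ^ 2 = ∫ v : R3, f₀ v * ‖v‖ ^ 2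


set_option linter.unusedVariables false

section Proof
open scoped ENNReal

instance instFiniteSph : IsFiniteMeasure sphMeasure := by
  unfold sphMeasure; infer_instance

/-- A reference unit vector. -/
def e0 : S2 := ⟨EuclideanSpace.single 0 1, by simp⟩

/-- Normalization of a vector. -/
def nrm (x : R3) : S2 :=
  if h : x ≠ 0 then ⟨‖x‖⁻¹ • x, by
    have : ‖x‖ ≠ 0 := norm_ne_zero_iff.mpr h
    simp [norm_smul, this]⟩ else e0

lemma nrm_coe {x : R3} (h : x ≠ 0) : (nrm x : R3) = ‖x‖⁻¹ • x := by
  simp [nrm, h]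

lemma norm_S2 (σ : S2) : ‖(σ : R3)‖ = 1 := by simpa using σ.2

lemma smul_S2_ne {r : ℝ} (hr : 0 < r) (σ : S2) : r • (σ : R3) ≠ 0 := by
  have hσ := norm_S2 σ
  intro h
  have := congrArg norm h
  rw [norm_smul, hσ] at this
  simp at this; exact hr.ne' this

lemma nrm_smul {r : ℝ} (hr : 0 < r) (σ : S2) : nrm (r • (σ : R3)) = σ := by
  have hσ := norm_S2 σ
  ext1
  rw [nrm_coe (smul_S2_ne hr σ), norm_smul, hσ, smul_smul, Real.norm_of_nonneg hr.le]
  field_simp; simp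

lemma nrm_coe_S2 (σ : S2) : nrm (σ : R3) = σ := by
  simpa using nrm_smul one_pos σ

lemma measurable_nrm : Measurable nrm := by
  have h : Measurable (fun x : R3 => (nrm x : R3)) := by
    have : (fun x : R3 => (nrm x : R3)) = fun x => if x ≠ 0 then ‖x‖⁻¹ • x else (e0 : R3) := by
      ext1 x
      by_cases h : x = 0
      · simp [nrm, h]
      · simp [nrm, h]
    rw [this]
    apply Measurable.ite
    · exact (measurableSet_singleton (0:R3)).compl
    · fun_prop
    · fun_prop
  exact h.subtype_mk (h := fun x => (nrm x).2)

lemma polar_lintegral (F : R3 → ℝ≥0∞) (hF : Measurable F) :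
    ∫⁻ x, F x = ∫⁻ σ, (∫⁻ r in Ioi (0:ℝ), ENNReal.ofReal (r ^ 2) * F (r • (σ : R3))) ∂sphMeasure := by
  have hd : Module.finrank ℝ R3 - 1 = 2 := by simp
  have mp := (volume : Measure R3).measurePreserving_homeomorphUnitSphereProd
  rw [hd] at mp
  have h1 : ∫⁻ x, F x = ∫⁻ x : ({0}ᶜ : Set R3), F x ∂(Measure.comap (↑) (volume : Measure R3)) := by
    rw [lintegral_subtype_comap (measurableSet_singleton _).compl, restrict_compl_singleton]
  rw [h1]
  have h2 : ∀ x : ({0}ᶜ : Set R3), F x =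
      (fun p : S2 × Ioi (0:ℝ) => F (p.2.1 • (p.1 : R3))) (homeomorphUnitSphereProd R3 x) := by
    intro x
    simp only
    congr 1
    have hx : ‖(x : R3)‖ ≠ 0 := norm_ne_zero_iff.mpr x.2
    simp [smul_smul, hx]
  simp_rw [h2]
  have hm : Measurable (fun p : S2 × Ioi (0:ℝ) => F (p.2.1 • (p.1 : R3))) := by
    apply hF.comp
    fun_prop
  rw [mp.lintegral_comp hm, lintegral_prod _ hm.aemeasurable]
  apply lintegral_congr
  intro σ
  simp only [Measure.volumeIoiPow]
  rw [lintegral_withDensity_eq_lintegral_mul _ (by fun_prop) (by fun_prop)]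
  rw [← lintegral_subtype_comap measurableSet_Ioi]
  rfl

/-- The action of a linear isometry on the sphere. -/
def isoS (g : R3 ≃ₗᵢ[ℝ] R3) (σ : S2) : S2 := ⟨g σ, by simp⟩

lemma measurable_isoS (g : R3 ≃ₗᵢ[ℝ] R3) : Measurable (isoS g) := by
  unfold isoS
  exact (g.continuous.measurable.comp measurable_subtype_coe).subtype_mk

lemma lint_r2_pos : (∫⁻ r in Ioi (0:ℝ), ENNReal.ofReal (r ^ 2) * (if r < 1 then 1 else 0)) ≠ 0 ∧
    (∫⁻ r in Ioi (0:ℝ), ENNReal.ofReal (r ^ 2) * (if r < 1 then 1 else 0)) ≠ ⊤ := by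
  constructor
  · rw [Ne, lintegral_eq_zero_iff (by
      apply Measurable.mul (by fun_prop)
      exact Measurable.ite measurableSet_Iio measurable_const measurable_const)]
    intro h
    rw [Filter.EventuallyEq, ae_restrict_iff' measurableSet_Ioi] at h
    have : volume (Ioo (0:ℝ) 1) = 0 := by
      refine measure_mono_null ?_ h
      intro r hr hh
      have := hh hr.1
      simp [hr.2] at this
      exact absurd this hr.1.ne'
    simp at this
  · apply ne_of_lt
    calc _ ≤ ∫⁻ r in Ioi (0:ℝ), (Ioo (0:ℝ) 1).indicator (fun _ => 1) r := by
          apply setLIntegral_mono' measurableSet_Ioi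
          intro r hr
          by_cases h : r < 1
          · have : r ^ 2 ≤ 1 := by have := mem_Ioi.1 hr; nlinarith
            simp [h, indicator, mem_Ioi.1 hr, this]
          · simp [h]
      _ ≤ ∫⁻ r, (Ioo (0:ℝ) 1).indicator (fun _ => 1) r := setLIntegral_le_lintegral _ _
      _ < ⊤ := by
          rw [lintegral_indicator measurableSet_Ioo]; simp

lemma radial_key (K : S2 → ℝ≥0∞) (hK : Measurable K) :
      ∫⁻ x : R3, K (nrm x) * (if ‖x‖ < 1 then 1 else 0) =
      (∫⁻ σ, K σ ∂sphMeasure) *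
        (∫⁻ r in Ioi (0:ℝ), ENNReal.ofReal (r ^ 2) * (if r < 1 then 1 else 0)) := by
    rw [polar_lintegral, ← lintegral_mul_const _ hK]
    · apply lintegral_congr
      intro σ
      rw [← lintegral_const_mul _ (by
        apply Measurable.mul (by fun_prop)
        exact Measurable.ite measurableSet_Iio measurable_const measurable_const)]
      apply setLIntegral_congr_fun measurableSet_Ioi
      intro r hr
      simp only
      rw [nrm_smul hr, norm_smul, norm_S2, Real.norm_of_nonneg (le_of_lt hr), mul_one]
      ring
    · apply Measurable.mul (hK.comp measurable_nrm)
      exact Measurable.ite (measurableSet_lt measurable_norm measurable_const) measurable_const measurable_const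

/-- the surface measure is invariant -/
lemma sph_inv (g : R3 ≃ₗᵢ[ℝ] R3) (H : S2 → ℝ≥0∞) (hH : Measurable H) :
    ∫⁻ σ, H (isoS g σ) ∂sphMeasure = ∫⁻ σ, H σ ∂sphMeasure := by
  have key := radial_key
  have h1 := key _ hH
  have h2 := key _ (hH.comp (measurable_isoS g))
  have h3 := (g.measurePreserving).lintegral_comp (f := fun x => H (nrm x) * (if ‖x‖ < 1 then 1 else 0)) (by
    apply Measurable.mul (hH.comp measurable_nrm)
    exact Measurable.ite (measurableSet_lt measurable_norm measurable_const) measurable_const measurable_const)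
  have h4 : ∀ x : R3, x ≠ 0 → nrm (g x) = isoS g (nrm x) := by
    intro x hx
    have hgx : g x ≠ 0 := by simpa using hx
    ext1
    rw [nrm_coe hgx]
    simp [isoS, nrm_coe hx]
  have h5 : ∫⁻ x : R3, (fun x => H (nrm x) * (if ‖x‖ < 1 then 1 else 0)) (g x) =
      ∫⁻ x : R3, (H ∘ isoS g) (nrm x) * (if ‖x‖ < 1 then 1 else 0) := by
    apply lintegral_congr_ae
    have : ∀ᵐ x : R3, x ≠ 0 := by simp [ae_iff]
    filter_upwards [this] with x hx
    simp only [Function.comp, LinearIsometryEquiv.norm_map, h4 x hx]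
  rw [h5, h2, h1] at h3
  exact (ENNReal.mul_left_inj lint_r2_pos.1 lint_r2_pos.2).1 h3

lemma exists_iso (x y : S2) : ∃ g : R3 ≃ₗᵢ[ℝ] R3, isoS g x = y := by
  refine ⟨(ℝ ∙ ((x:R3) - y))ᗮ.reflection, ?_⟩
  ext1
  exact Submodule.reflection_sub (by rw [norm_S2, norm_S2])

/-- kernel -/
def kerS (δ : ℝ) (x y : S2) : ℝ≥0∞ := if ‖(x:R3) - y‖ < δ then 1 else 0

lemma measurable_kerS (δ : ℝ) : Measurable (fun p : S2 × S2 => kerS δ p.1 p.2) := by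
  unfold kerS
  refine Measurable.ite (measurableSet_lt (by fun_prop) measurable_const) measurable_const measurable_const

lemma measurable_kerS_left (δ : ℝ) (y : S2) : Measurable (fun x => kerS δ x y) := by
  unfold kerS
  refine Measurable.ite (measurableSet_lt (by fun_prop) measurable_const) measurable_const measurable_const

lemma measurable_kerS_right (δ : ℝ) (x : S2) : Measurable (fun y => kerS δ x y) := by
  unfold kerS
  refine Measurable.ite (measurableSet_lt (by fun_prop) measurable_const) measurable_const measurable_const

def InvS (μ : Measure S2) : Prop := ∀ (g : R3 ≃ₗᵢ[ℝ] R3) (H : S2 → ℝ≥0∞), Measurable H →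
  ∫⁻ σ, H (isoS g σ) ∂μ = ∫⁻ σ, H σ ∂μ

lemma kerS_const (μ : Measure S2) (hμ : InvS μ) (δ : ℝ) (y z : S2) :
    ∫⁻ x, kerS δ x y ∂μ = ∫⁻ x, kerS δ x z ∂μ := by
  obtain ⟨g, hg⟩ := exists_iso y z
  have := hμ g (fun x => kerS δ x z) (measurable_kerS_left δ z)
  rw [← this]
  apply lintegral_congr
  intro x
  have : ‖((isoS g x : S2) : R3) - z‖ = ‖(x:R3) - y‖ := by
    rw [← hg]
    simp only [isoS]
    rw [← map_sub, LinearIsometryEquiv.norm_map]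
  simp only [kerS, this]

lemma kerS_symm (δ : ℝ) (x y : S2) : kerS δ x y = kerS δ y x := by
  simp only [kerS, norm_sub_rev]

lemma inv_le (μ ν : Measure S2) [IsFiniteMeasure μ] [IsFiniteMeasure ν] (hμ : InvS μ) (hν : InvS ν)
    (hpos : ∀ δ > 0, (∫⁻ x, kerS δ x e0 ∂ν) ≠ 0)
    (H : S2 → NNReal) (hH : Continuous H) :
    ν univ * ∫⁻ x, H x ∂μ ≤ μ univ * ∫⁻ x, H x ∂ν := by
  have hHm : Measurable (fun x => (H x : ℝ≥0∞)) := by fun_prop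
  have huc : UniformContinuous H := CompactSpace.uniformContinuous_of_continuous hH
  have main : ∀ ε : NNReal, 0 < ε → ν univ * ∫⁻ x, H x ∂μ ≤ μ univ * ∫⁻ x, H x ∂ν + ε * (ν univ * μ univ) := by
    intro ε hε
    obtain ⟨δ, hδ, hd⟩ := Metric.uniformContinuous_iff.1 huc ε hε
    set cν := ∫⁻ x, kerS δ x e0 ∂ν with hcν
    set cμ := ∫⁻ x, kerS δ x e0 ∂μ with hcμ
    have fin : cν ≠ ⊤ := by
      apply ne_of_lt
      calc cν ≤ ∫⁻ x, 1 ∂ν := lintegral_mono (fun x => by simp only [kerS]; split_ifs <;> simp)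
        _ < ⊤ := by simp
    have t1 : ∀ F : S2 → ℝ≥0∞, Measurable F → ∫⁻ x, ∫⁻ y, kerS δ x y * F x ∂ν ∂μ = cν * ∫⁻ x, F x ∂μ := by
      intro F hF
      rw [← lintegral_const_mul _ hF]
      apply lintegral_congr
      intro x
      rw [lintegral_mul_const _ (measurable_kerS_right δ x)]
      congr 1
      rw [lintegral_congr (fun y => kerS_symm δ x y)]
      exact kerS_const ν hν δ x e0
    have t2 : ∀ F : S2 → ℝ≥0∞, Measurable F → ∫⁻ x, ∫⁻ y, kerS δ x y * F y ∂ν ∂μ = cμ * ∫⁻ x, F x ∂ν := by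
      intro F hF
      rw [lintegral_lintegral_swap, ← lintegral_const_mul _ hF]
      · apply lintegral_congr
        intro y
        rw [lintegral_mul_const _ (measurable_kerS_left δ y)]
        congr 1
        exact kerS_const μ hμ δ y e0
      · apply Measurable.aemeasurable
        exact (measurable_kerS δ).mul (hF.comp measurable_snd)
    have t3 : cν * μ univ = cμ * ν univ := by
      have a := t1 (fun _ => 1) measurable_const
      have b := t2 (fun _ => 1) measurable_const
      simp only [lintegral_const, one_mul] at a b
      rw [← a, ← b]
    have t4 : cν * ∫⁻ x, H x ∂μ ≤ cμ * ∫⁻ x, H x ∂ν + ε * (cν * μ univ) := by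
      rw [← t1 _ hHm]
      have e := t1 (fun _ => (ε:ℝ≥0∞)) measurable_const
      have : cμ * ∫⁻ x, H x ∂ν + ε * (cν * μ univ) = ∫⁻ x, ∫⁻ y, (kerS δ x y * H y + kerS δ x y * ε) ∂ν ∂μ := by
        have hx : ∀ x, ∫⁻ y, (kerS δ x y * H y + kerS δ x y * ε) ∂ν =
            ∫⁻ y, kerS δ x y * H y ∂ν + ∫⁻ y, kerS δ x y * ε ∂ν :=
          fun x => lintegral_add_left ((measurable_kerS_right δ x).mul hHm) _
        rw [lintegral_congr hx, lintegral_add_left, t2 _ hHm, e]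
        · simp only [lintegral_const]; ring
        · exact Measurable.lintegral_prod_right' (f := fun p : S2 × S2 => kerS δ p.1 p.2 * H p.2) ((measurable_kerS δ).mul (hHm.comp measurable_snd))
      rw [this]
      apply lintegral_mono; intro x
      apply lintegral_mono; intro y
      simp only [kerS]
      split_ifs with h
      · simp only [one_mul]
        have : dist (H x) (H y) < ε := hd (by rw [Subtype.dist_eq, dist_eq_norm]; exact h)
        rw [NNReal.dist_eq] at this
        have := (abs_lt.1 this).2
        have : H x ≤ H y + ε := by
          rw [← NNReal.coe_le_coe]; push_cast; linarith
        exact_mod_cast this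
      · simp
    have hp := hpos δ hδ
    have : cν * (ν univ * ∫⁻ x, H x ∂μ) ≤ cν * (μ univ * ∫⁻ x, H x ∂ν + ε * (ν univ * μ univ)) := by
      calc cν * (ν univ * ∫⁻ x, H x ∂μ) = ν univ * (cν * ∫⁻ x, H x ∂μ) := by ring
        _ ≤ ν univ * (cμ * ∫⁻ x, H x ∂ν + ε * (cν * μ univ)) := by gcongr
        _ = (cμ * ν univ) * ∫⁻ x, H x ∂ν + ν univ * (ε * (cν * μ univ)) := by ring
        _ = _ := by rw [← t3]; ring
    exact (ENNReal.mul_le_mul_iff_right hp fin).1 this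
  have hfin : ν univ * μ univ ≠ ⊤ := ENNReal.mul_ne_top (measure_ne_top _ _) (measure_ne_top _ _)
  apply ENNReal.le_of_forall_pos_le_add
  intro ε hε _
  set M := (ν univ * μ univ).toNNReal
  have := main (ε / (M + 1)) (by positivity)
  refine this.trans ?_
  gcongr
  rw [← ENNReal.coe_toNNReal hfin, ← ENNReal.coe_mul]
  norm_cast
  rw [div_mul_eq_mul_div]
  apply div_le_of_le_mul₀ (by positivity) (by positivity)
  gcongr
  simp [M]

lemma invS_sph : InvS sphMeasure := fun g H hH => sph_inv g H hH

instance : sphMeasure.IsOpenPosMeasure := by unfold sphMeasure; infer_instance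

lemma kerS_pos (δ : ℝ) (hδ : 0 < δ) : (∫⁻ x, kerS δ x e0 ∂sphMeasure) ≠ 0 := by
  have : (fun x => kerS δ x e0) = (Metric.ball e0 δ).indicator (fun _ => 1) := by
    ext x
    simp [kerS, indicator, Subtype.dist_eq, dist_eq_norm]
  rw [this, lintegral_indicator Metric.isOpen_ball.measurableSet]
  simp only [lintegral_const, one_mul, Measure.restrict_apply_univ]
  exact (Metric.isOpen_ball.measure_pos _ ⟨e0, Metric.mem_ball_self hδ⟩).ne'

lemma sph_univ_ne : sphMeasure univ ≠ 0 := by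
  exact (isOpen_univ.measure_pos sphMeasure ⟨e0, mem_univ _⟩).ne'

lemma kerS_pos_of_inv (μ : Measure S2) [IsFiniteMeasure μ] (hμ : InvS μ) (h0 : μ univ ≠ 0) (δ : ℝ) (hδ : 0 < δ) :
    (∫⁻ x, kerS δ x e0 ∂μ) ≠ 0 := by
  intro h
  have h1 : ∫⁻ x, ∫⁻ y, kerS δ x y ∂sphMeasure ∂μ = (∫⁻ x, kerS δ x e0 ∂sphMeasure) * μ univ := by
    have : ∀ x, ∫⁻ y, kerS δ x y ∂sphMeasure = ∫⁻ x, kerS δ x e0 ∂sphMeasure := by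
      intro x
      rw [lintegral_congr (fun y => kerS_symm δ x y)]
      exact kerS_const _ invS_sph δ x e0
    simp_rw [this]
    simp
  rw [lintegral_lintegral_swap (measurable_kerS δ).aemeasurable] at h1
  rw [lintegral_congr (fun y => (kerS_const _ hμ δ y e0).trans h)] at h1
  simp at h1
  rcases h1 with h1 | h1
  · exact kerS_pos δ hδ h1
  · exact h0 (by simp [h1])

/-- uniqueness of invariant measures -/
lemma sph_unique (μ : Measure S2) [IsFiniteMeasure μ] (hμ : InvS μ) (H : S2 → ℝ≥0∞) (hH : Measurable H) :
    ∫⁻ x, H x ∂μ = (μ univ / sphMeasure univ) * ∫⁻ x, H x ∂sphMeasure := by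
  by_cases h0 : μ univ = 0
  · have : μ = 0 := Measure.measure_univ_eq_zero.1 h0
    simp [this]
  set c := μ univ / sphMeasure univ
  have hc : c ≠ ⊤ := ENNReal.div_ne_top (measure_ne_top _ _) sph_univ_ne
  have : μ = c • sphMeasure := by
    have : IsFiniteMeasure (c • sphMeasure) := by
      constructor
      simp only [Measure.smul_apply, smul_eq_mul]
      exact ENNReal.mul_lt_top hc.lt_top (measure_lt_top _ _)
    apply ext_of_forall_lintegral_eq_of_IsFiniteMeasure
    intro H
    have a := inv_le μ sphMeasure hμ invS_sph kerS_pos H H.continuous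
    have b := inv_le sphMeasure μ invS_sph hμ (kerS_pos_of_inv μ hμ h0) H H.continuous
    have e := le_antisymm a b
    rw [lintegral_smul_measure, smul_eq_mul]
    have s0 := sph_univ_ne
    have s1 := measure_ne_top sphMeasure univ
    rw [← ENNReal.mul_right_inj s0 s1, e, ← mul_assoc, ENNReal.mul_div_cancel s0 s1]
  conv_lhs => rw [this]
  rw [lintegral_smul_measure, smul_eq_mul]

lemma polar2 (f : ℝ × ℝ → ℝ≥0∞) (hf : Measurable f) : ∫⁻ p, f p =
    ∫⁻ r in Ioi (0:ℝ), ∫⁻ θ in Ioo (-π) π, ENNReal.ofReal r * f (r * cos θ, r * sin θ) := by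
  rw [← lintegral_comp_polarCoord_symm, polarCoord_target, Measure.volume_eq_prod, ← Measure.prod_restrict,
    lintegral_prod]
  · rfl
  · apply Measurable.aemeasurable
    simp only [polarCoord_symm_apply, smul_eq_mul]
    apply Measurable.mul (by fun_prop)
    apply hf.comp
    fun_prop

lemma lint_R3 (F : R3 → ℝ≥0∞) (hF : Measurable F) : ∫⁻ x, F x =
    ∫⁻ x : ℝ, ∫⁻ p : ℝ × ℝ, F !₂[x, p.1, p.2] := by
  have m1 := (PiLp.volume_preserving_toLp (Fin 3))
  rw [← m1.lintegral_comp hF]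
  have m2 := (volume_preserving_piFinSuccAbove (fun _ : Fin 3 => ℝ) 0).symm
  rw [← m2.lintegral_comp_emb (MeasurableEquiv.measurableEmbedding _)]
  have m3 := (MeasurePreserving.id (volume : Measure ℝ)).prod (volume_preserving_finTwoArrow ℝ).symm
  rw [Measure.volume_eq_prod]
  have m3' : MeasurePreserving (Prod.map id (MeasurableEquiv.finTwoArrow (α := ℝ)).symm) ((volume : Measure ℝ).prod (volume : Measure (ℝ × ℝ))) ((volume : Measure ℝ).prod (volume : Measure (Fin 2 → ℝ))) := m3
  rw [← m3'.lintegral_comp]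
  · rw [lintegral_prod]
    · apply lintegral_congr; intro x
      apply lintegral_congr; intro p
      simp only [Prod.map]
      congr 1
      ext i
      fin_cases i <;> simp [MeasurableEquiv.piFinSuccAbove, MeasurableEquiv.finTwoArrow]
    · apply Measurable.aemeasurable
      apply hF.comp
      apply m1.measurable.comp
      apply m2.measurable.comp
      exact m3'.measurable
  · apply hF.comp
    apply m1.measurable.comp
    exact m2.measurable

lemma hatbox_aux (Ψ : ℝ → ℝ → ℝ≥0∞) (hΨ : Measurable (fun p : ℝ × ℝ => Ψ p.1 p.2)) (x : ℝ) :
    ∫⁻ p : ℝ × ℝ, Ψ x (√(p.1^2+p.2^2)) = ENNReal.ofReal (2*π) * ∫⁻ r in Ioi (0:ℝ), ENNReal.ofReal r * Ψ x r := by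
  have hx : Measurable (Ψ x) := hΨ.comp (measurable_const.prodMk measurable_id)
  rw [polar2 (fun p => Ψ x (√(p.1^2+p.2^2))) (by fun_prop), ← lintegral_const_mul _ (by fun_prop)]
  apply setLIntegral_congr_fun measurableSet_Ioi
  intro r hr
  simp only
  have : ∀ θ, √((r * cos θ)^2 + (r * sin θ)^2) = r := by
    intro θ
    rw [show (r * cos θ)^2 + (r * sin θ)^2 = r^2 by nlinarith [sin_sq_add_cos_sq θ]]
    exact Real.sqrt_sq (le_of_lt hr)
  simp_rw [this]
  rw [setLIntegral_const, Real.volume_Ioo, show π - -π = 2 * π by ring, mul_comm]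

lemma hatbox_e0 (g : ℝ → ℝ≥0∞) (hg : Measurable g) :
    ∫⁻ σ, g ⟪(e0 : R3), (σ : R3)⟫ ∂sphMeasure =
      ENNReal.ofReal (2*π) * ∫⁻ θ in Ioo 0 π, ENNReal.ofReal (sin θ) * g (cos θ) := by
  have h1 := radial_key (fun σ => g ⟪(e0 : R3), (σ : R3)⟫) (by fun_prop)
  have hite : Measurable (fun r : ℝ => (if r < 1 then 1 else 0 : ℝ≥0∞)) :=
    Measurable.ite measurableSet_Iio measurable_const measurable_const
  rw [lint_R3] at h1
  swap
  · apply Measurable.mul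
    · exact Measurable.comp (g := fun σ : S2 => g ⟪(e0 : R3), (σ : R3)⟫) (by fun_prop) measurable_nrm
    · exact hite.comp measurable_norm
  set Ψ : ℝ → ℝ → ℝ≥0∞ := fun x r => g (x / √(x^2+r^2)) * (if √(x^2+r^2) < 1 then 1 else 0) with hΨ
  have hΨm : Measurable (fun p : ℝ × ℝ => Ψ p.1 p.2) := by
    apply Measurable.mul
    · apply hg.comp; fun_prop
    · exact hite.comp (by fun_prop)
  have h2 : ∀ x : ℝ, x ≠ 0 → ∀ p : ℝ × ℝ, (fun x : R3 => g ⟪(e0 : R3), (nrm x : R3)⟫ * (if ‖x‖ < 1 then 1 else 0)) !₂[x, p.1, p.2]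
      = Ψ x (√(p.1^2+p.2^2)) := by
    intro x hx p
    have hne : (!₂[x, p.1, p.2] : R3) ≠ 0 := by
      intro h
      have := congrFun (congrArg (fun y : R3 => (y : Fin 3 → ℝ)) h) 0
      simp at this
      exact hx this
    have hn : ‖(!₂[x, p.1, p.2] : R3)‖ = √(x^2 + (p.1^2+p.2^2)) := by
      rw [EuclideanSpace.norm_eq]
      simp [Fin.sum_univ_three, add_assoc]
    simp only [hΨ]
    rw [nrm_coe hne, hn, Real.sq_sqrt (by positivity), inner_smul_right]
    congr 2
    simp [e0, EuclideanSpace.inner_single_left]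
    ring
  have h3 : ∫⁻ x : ℝ, ∫⁻ p : ℝ × ℝ, (fun x : R3 => g ⟪(e0 : R3), (nrm x : R3)⟫ * (if ‖x‖ < 1 then 1 else 0)) !₂[x, p.1, p.2]
     = ∫⁻ x : ℝ, ENNReal.ofReal (2*π) * ∫⁻ r in Ioi (0:ℝ), ENNReal.ofReal r * Ψ x r := by
    apply lintegral_congr_ae
    have : ∀ᵐ x : ℝ, x ≠ 0 := by simp [ae_iff]
    filter_upwards [this] with x hx
    rw [← hatbox_aux Ψ hΨm]
    exact lintegral_congr (h2 x hx)
  have hΨm2 : Measurable (fun p : ℝ × ℝ => (Ioi (0:ℝ)).indicator (fun r => ENNReal.ofReal r * Ψ p.1 r) p.2) := by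
    have : (fun p : ℝ × ℝ => (Ioi (0:ℝ)).indicator (fun r => ENNReal.ofReal r * Ψ p.1 r) p.2) =
      {p : ℝ × ℝ | 0 < p.2}.indicator (fun p => ENNReal.ofReal p.2 * Ψ p.1 p.2) := by
      ext p; simp [indicator]
    rw [this]
    exact (Measurable.mul (by fun_prop) hΨm).indicator (measurableSet_lt measurable_const measurable_snd)
  have h4 : ∫⁻ x : ℝ, ∫⁻ r in Ioi (0:ℝ), ENNReal.ofReal r * Ψ x r =
     (∫⁻ r in Ioi (0:ℝ), ENNReal.ofReal (r ^ 2) * (if r < 1 then 1 else 0)) * ∫⁻ θ in Ioo 0 π, ENNReal.ofReal (sin θ) * g (cos θ) := by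
    simp_rw [← lintegral_indicator measurableSet_Ioi]
    rw [← lintegral_prod (f := fun p : ℝ × ℝ => (Ioi (0:ℝ)).indicator (fun r => ENNReal.ofReal r * Ψ p.1 r) p.2) hΨm2.aemeasurable,
      ← Measure.volume_eq_prod, polar2 _ hΨm2, lintegral_indicator measurableSet_Ioi,
      ← lintegral_mul_const _ (by fun_prop)]
    apply setLIntegral_congr_fun measurableSet_Ioi
    intro r hr
    have hr : 0 < r := hr
    simp only
    rw [← lintegral_indicator measurableSet_Ioo, ← lintegral_indicator measurableSet_Ioo, ← lintegral_const_mul _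
      (Measurable.indicator (by fun_prop) measurableSet_Ioo)]
    apply lintegral_congr
    intro θ
    by_cases hθ : θ ∈ Ioo 0 π
    · have hs : 0 < sin θ := sin_pos_of_mem_Ioo hθ
      have : θ ∈ Ioo (-π) π := ⟨by linarith [hθ.1, pi_pos], hθ.2⟩
      rw [indicator_of_mem hθ, indicator_of_mem this, indicator_of_mem (show r * sin θ ∈ Ioi 0 from mul_pos hr hs)]
      simp only [hΨ]
      rw [show (r * cos θ)^2 + (r * sin θ)^2 = r^2 by nlinarith [sin_sq_add_cos_sq θ], Real.sqrt_sq hr.le,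
        mul_div_cancel_left₀ _ hr.ne', ENNReal.ofReal_mul hr.le, sq, ENNReal.ofReal_mul hr.le]
      ring
    · rw [indicator_of_notMem hθ, mul_zero]
      by_cases h' : θ ∈ Ioo (-π) π
      · have hs : sin θ ≤ 0 := by
          apply sin_nonpos_of_nonpos_of_neg_pi_le _ h'.1.le
          by_contra hc; push Not at hc; exact hθ ⟨hc, h'.2⟩
        rw [indicator_of_mem h', indicator_of_notMem (by simp only [mem_Ioi, not_lt]; exact mul_nonpos_of_nonneg_of_nonpos hr.le hs), mul_zero]
      · rw [indicator_of_notMem h']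
  simp only at h3
  rw [h3, lintegral_const_mul _ (by
    simp_rw [← lintegral_indicator measurableSet_Ioi]
    exact hΨm2.lintegral_prod_right'), h4] at h1
  rw [← mul_assoc, mul_comm (ENNReal.ofReal (2*π)), mul_assoc, mul_comm] at h1
  exact ((ENNReal.mul_left_inj lint_r2_pos.1 lint_r2_pos.2).1 h1).symm

lemma ang_indep (g : ℝ → ℝ≥0∞) (hg : Measurable g) (x y : S2) :
    ∫⁻ σ, g ⟪(x : R3), (σ : R3)⟫ ∂sphMeasure = ∫⁻ σ, g ⟪(y : R3), (σ : R3)⟫ ∂sphMeasure := by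
  obtain ⟨A, hA⟩ := exists_iso x y
  have := sph_inv A (fun σ => g ⟪(y : R3), (σ : R3)⟫) (by fun_prop)
  rw [← this, ← hA]
  simp [isoS]

/-- Angular integral. -/
def Lam (g : ℝ → ℝ≥0∞) : ℝ≥0∞ := ∫⁻ σ, g ⟪(e0 : R3), (σ : R3)⟫ ∂sphMeasure

lemma Lam_eq (g : ℝ → ℝ≥0∞) (hg : Measurable g) (x : S2) :
    ∫⁻ σ, g ⟪(x : R3), (σ : R3)⟫ ∂sphMeasure = Lam g := ang_indep g hg x e0

@[fun_prop]
lemma Measurable.vOut' {α : Type*} [MeasurableSpace α] {f g : α → R3} {h : α → S2} (hf : Measurable f)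
    (hg : Measurable g) (hh : Measurable h) : Measurable (fun a => vOut (f a) (g a) (h a)) := by
  unfold vOut
  fun_prop

@[fun_prop]
lemma Measurable.vOutStar' {α : Type*} [MeasurableSpace α] {f g : α → R3} {h : α → S2} (hf : Measurable f)
    (hg : Measurable g) (hh : Measurable h) : Measurable (fun a => vOutStar (f a) (g a) (h a)) := by
  unfold vOutStar
  fun_prop

@[fun_prop]
lemma Measurable.cosAngle' {α : Type*} [MeasurableSpace α] {f g : α → R3} {h : α → S2} (hf : Measurable f)
    (hg : Measurable g) (hh : Measurable h) : Measurable (fun a => cosAngle (f a) (g a) (h a)) := by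
  unfold cosAngle
  fun_prop

@[fun_prop]
lemma Measurable.nrm' {α : Type*} [MeasurableSpace α] {f : α → R3} (hf : Measurable f) :
    Measurable (fun a => nrm (f a)) := measurable_nrm.comp hf

/-- `sin (θ/2)` -/
def sh (x : ℝ) : ℝ := √((1 - x) / 2)
/-- `cos (θ/2)` -/
def ch (x : ℝ) : ℝ := √((1 + x) / 2)

@[fun_prop]
lemma measurable_sh : Measurable sh := by unfold sh; fun_prop
@[fun_prop]
lemma measurable_ch : Measurable ch := by unfold ch; fun_prop

lemma sh_nonneg (x : ℝ) : 0 ≤ sh x := Real.sqrt_nonneg _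
lemma ch_nonneg (x : ℝ) : 0 ≤ ch x := Real.sqrt_nonneg _

lemma norm_sub_S2 (ω σ : S2) : ‖(ω : R3) - σ‖ = 2 * sh ⟪(ω : R3), (σ : R3)⟫ := by
  have h := norm_sub_sq_real (ω : R3) σ
  rw [norm_S2, norm_S2] at h
  have hs : ‖(ω : R3) - σ‖ ^ 2 = 2 ^ 2 * ((1 - ⟪(ω : R3), (σ : R3)⟫) / 2) := by rw [h]; ring
  rw [sh, ← Real.sqrt_sq (norm_nonneg ((ω : R3) - σ)), hs, Real.sqrt_mul (by norm_num)]
  rw [Real.sqrt_sq (by norm_num)]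

lemma inner_S2_le (ω σ : S2) : ⟪(ω : R3), (σ : R3)⟫ ≤ 1 := by
  have := real_inner_le_norm (ω : R3) σ
  simpa [norm_S2] using this

lemma inner_S2_ge (ω σ : S2) : -1 ≤ ⟪(ω : R3), (σ : R3)⟫ := by
  have := (abs_le.1 (abs_real_inner_le_norm (ω : R3) σ)).1
  simpa [norm_S2] using this

lemma sh_pos {x : ℝ} (h : x < 1) : 0 < sh x := Real.sqrt_pos.2 (by linarith)

lemma nrm_iso (g : R3 ≃ₗᵢ[ℝ] R3) {x : R3} (hx : x ≠ 0) : isoS g (nrm x) = nrm (g x) := by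
  have hgx : g x ≠ 0 := by simpa using hx
  ext1
  rw [nrm_coe hgx]
  simp [isoS, nrm_coe hx]

lemma law_n (q : ℝ → ℝ≥0∞) (hq : Measurable q) (hfin : Lam q ≠ ⊤) (G : S2 → ℝ≥0∞) (hG : Measurable G)
    (hq1 : ∀ x, 1 ≤ x → q x = 0) :
    ∫⁻ ω, ∫⁻ σ, q ⟪(ω : R3), (σ : R3)⟫ * G (nrm ((ω : R3) - σ)) ∂sphMeasure ∂sphMeasure
      = Lam q * ∫⁻ n, G n ∂sphMeasure := by
  set d : S2 × S2 → ℝ≥0∞ := fun p => q ⟪(p.1 : R3), (p.2 : R3)⟫ with hd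
  have hdm : Measurable d := by fun_prop
  set m : S2 × S2 → S2 := fun p => nrm ((p.1 : R3) - p.2) with hm
  have hmm : Measurable m := by fun_prop
  set μ := ((sphMeasure.prod sphMeasure).withDensity d).map m with hμ
  have form : ∀ K : S2 → ℝ≥0∞, Measurable K → ∫⁻ n, K n ∂μ =
      ∫⁻ ω, ∫⁻ σ, q ⟪(ω : R3), (σ : R3)⟫ * K (nrm ((ω : R3) - σ)) ∂sphMeasure ∂sphMeasure := by
    intro K hK
    rw [hμ, lintegral_map hK hmm, lintegral_withDensity_eq_lintegral_mul _ hdm (by fun_prop)]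
    rw [lintegral_prod]
    · rfl
    · apply Measurable.aemeasurable
      exact hdm.mul (hK.comp hmm)
  have tot : μ univ = Lam q * sphMeasure univ := by
    have := form (fun _ => 1) measurable_const
    simp only [lintegral_const, one_mul, mul_one] at this
    rw [this, lintegral_congr (fun x => Lam_eq q hq x)]
    simp
  have : IsFiniteMeasure μ := ⟨by
    rw [tot]; exact ENNReal.mul_lt_top hfin.lt_top (measure_lt_top _ _)⟩
  have inv : InvS μ := by
    intro g H hH
    rw [form (fun σ => H (isoS g σ)) (hH.comp (measurable_isoS g)), form _ hH]
    have e1 : ∀ ω σ : S2, q ⟪(ω : R3), (σ : R3)⟫ * (H (isoS g (nrm ((ω : R3) - σ)))) =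
        q ⟪(isoS g ω : R3), (isoS g σ : R3)⟫ * H (nrm ((isoS g ω : R3) - isoS g σ)) := by
      intro ω σ
      have e2 : ⟪(isoS g ω : R3), (isoS g σ : R3)⟫ = ⟪(ω : R3), (σ : R3)⟫ := by simp [isoS]
      rw [e2]
      by_cases h : (1:ℝ) ≤ ⟪(ω : R3), (σ : R3)⟫
      · rw [hq1 _ h, zero_mul, zero_mul]
      · have : (ω : R3) - σ ≠ 0 := by
          rw [← norm_ne_zero_iff, norm_sub_S2]
          exact (mul_pos two_pos (sh_pos (not_le.1 h))).ne'
        rw [nrm_iso g this, map_sub]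
        rfl
    simp only [e1]
    have e3 : ∀ ω, ∫⁻ σ, q ⟪(isoS g ω : R3), (isoS g σ : R3)⟫ * H (nrm ((isoS g ω : R3) - isoS g σ)) ∂sphMeasure
       = ∫⁻ σ, q ⟪(isoS g ω : R3), (σ : R3)⟫ * H (nrm ((isoS g ω : R3) - σ)) ∂sphMeasure := by
      intro ω
      exact sph_inv g (fun σ => q ⟪(isoS g ω : R3), (σ : R3)⟫ * H (nrm ((isoS g ω : R3) - σ))) (by fun_prop)
    rw [lintegral_congr e3]
    exact sph_inv g (fun ω => ∫⁻ σ, q ⟪(ω : R3), (σ : R3)⟫ * H (nrm ((ω : R3) - σ)) ∂sphMeasure) (by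
      apply Measurable.lintegral_prod_right' (f := fun p : S2 × S2 => q ⟪(p.1 : R3), (p.2 : R3)⟫ * H (nrm ((p.1 : R3) - p.2)))
      fun_prop)
  rw [← form G hG, sph_unique μ inv G hG, tot, ENNReal.mul_div_cancel_right sph_univ_ne (measure_ne_top _ _)]

lemma cosAngle_polar (v : R3) (r : ℝ) (hr : 0 < r) (ω σ : S2) :
    cosAngle v (v - r • (ω : R3)) σ = ⟪(ω : R3), (σ : R3)⟫ := by
  unfold cosAngle
  rw [sub_sub_cancel, norm_smul, norm_S2, mul_one, Real.norm_of_nonneg hr.le, smul_smul, inv_mul_cancel₀ hr.ne', one_smul]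

lemma vOut_polar (v : R3) (r : ℝ) (hr : 0 < r) (ω σ : S2) (h : ⟪(ω : R3), (σ : R3)⟫ < 1) :
    vOut v (v - r • (ω : R3)) σ = v - (r * sh ⟪(ω : R3), (σ : R3)⟫) • (nrm ((ω : R3) - σ) : R3) := by
  have : (ω : R3) - σ ≠ 0 := by
    rw [← norm_ne_zero_iff, norm_sub_S2]
    exact (mul_pos two_pos (sh_pos h)).ne'
  have hp := sh_pos h
  rw [nrm_coe this, norm_sub_S2, smul_smul]
  unfold vOut
  rw [sub_sub_cancel, norm_smul, norm_S2, mul_one, Real.norm_of_nonneg hr.le]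
  rw [show r * sh ⟪(ω : R3), (σ : R3)⟫ * (2 * sh ⟪(ω : R3), (σ : R3)⟫)⁻¹ = r / 2 by field_simp]
  module

lemma scale_lint (G : ℝ → ℝ≥0∞) (s : ℝ) (hs : 0 < s) :
    ∫⁻ r in Ioi (0:ℝ), ENNReal.ofReal s * G (r * s) = ∫⁻ r in Ioi (0:ℝ), G r := by
  have := lintegral_image_eq_lintegral_abs_deriv_mul (s := Ioi (0:ℝ)) (f := fun r => r * s) (f' := fun _ => s)
    measurableSet_Ioi (fun x _ => by simpa using ((hasDerivAt_id x).mul_const s).hasDerivWithinAt)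
    (fun x _ y _ h => by simpa [hs.ne'] using h) G
  have im : (fun r => r * s) '' Ioi (0:ℝ) = Ioi 0 := by
    ext x
    simp only [mem_image, mem_Ioi]
    constructor
    · rintro ⟨y, hy, rfl⟩; positivity
    · intro hx; exact ⟨x / s, by positivity, by field_simp⟩
  rw [im] at this
  rw [this, abs_of_pos hs]

/-- Carleman-type bound. -/
lemma carl (γ : ℝ) (hγ : 0 ≤ γ) (q : ℝ → ℝ≥0∞) (hq : Measurable q) (hfin : Lam q ≠ ⊤) (F : R3 → ℝ≥0∞) (hF : Measurable F)
    (v : R3) :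
    ∫⁻ w, ∫⁻ σ, ENNReal.ofReal (‖v - w‖ ^ γ) * q (cosAngle v w σ) *
      ENNReal.ofReal (sh (cosAngle v w σ) ^ (γ + 3)) * F (vOut v w σ) ∂sphMeasure
      ≤ Lam q * ∫⁻ x, F x * ENNReal.ofReal (‖x - v‖ ^ γ) := by
  set q1 : ℝ → ℝ≥0∞ := (Iio 1).indicator q with hq1
  have hq1m : Measurable q1 := hq.indicator measurableSet_Iio
  have hle : Lam q1 ≤ Lam q := lintegral_mono (fun σ => indicator_le_self _ _ _)
  have hfin1 : Lam q1 ≠ ⊤ := ne_top_of_le_ne_top hfin hle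
  set Φ : R3 → ℝ≥0∞ := fun x => F (v - x) * ENNReal.ofReal (‖x‖ ^ γ) with hΦ
  have hΦm : Measurable Φ := by fun_prop
  set G : S2 → ℝ≥0∞ := fun n => ∫⁻ r in Ioi (0:ℝ), ENNReal.ofReal (r ^ 2) * Φ (r • (n : R3)) with hG
  have hGm : Measurable G := by
    apply Measurable.lintegral_prod_right' (f := fun p : S2 × ℝ => ENNReal.ofReal (p.2 ^ 2) * Φ (p.2 • (p.1 : R3)))
    fun_prop
  have hR : ∫⁻ x, F x * ENNReal.ofReal (‖x - v‖ ^ γ) = ∫⁻ n, G n ∂sphMeasure := by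
    rw [← polar_lintegral Φ hΦm, ← lintegral_sub_left_eq_self _ v]
    simp [hΦ]
  rw [hR]
  refine le_trans (le_of_eq ?_) (mul_le_mul_left hle _)
  rw [← law_n q1 hq1m hfin1 G hGm (by intro x hx; simp [hq1, hx])]
  set K : R3 → ℝ≥0∞ := fun w => ∫⁻ σ, ENNReal.ofReal (‖v - w‖ ^ γ) * q (cosAngle v w σ) *
      ENNReal.ofReal (sh (cosAngle v w σ) ^ (γ + 3)) * F (vOut v w σ) ∂sphMeasure with hK
  have hKm : Measurable K := by
    apply Measurable.lintegral_prod_right' (f := fun p : R3 × S2 => ENNReal.ofReal (‖v - p.1‖ ^ γ) * q (cosAngle v p.1 p.2) *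
      ENNReal.ofReal (sh (cosAngle v p.1 p.2) ^ (γ + 3)) * F (vOut v p.1 p.2))
    fun_prop
  rw [← lintegral_sub_left_eq_self _ v, polar_lintegral _ (by fun_prop)]
  apply lintegral_congr
  intro ω
  have : ∀ r ∈ Ioi (0:ℝ), ENNReal.ofReal (r ^ 2) * K (v - r • (ω : R3)) = ∫⁻ σ, q1 ⟪(ω : R3), (σ : R3)⟫ *
      (ENNReal.ofReal (sh ⟪(ω : R3), (σ : R3)⟫) * (ENNReal.ofReal ((r * sh ⟪(ω : R3), (σ : R3)⟫) ^ 2) *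
        Φ ((r * sh ⟪(ω : R3), (σ : R3)⟫) • (nrm ((ω : R3) - σ) : R3)))) ∂sphMeasure := by
    intro r hr
    have hr : 0 < r := hr
    simp only [hK]
    rw [← lintegral_const_mul _ (by fun_prop)]
    apply lintegral_congr
    intro σ
    rw [cosAngle_polar v r hr, sub_sub_cancel, norm_smul, norm_S2, mul_one, Real.norm_of_nonneg hr.le]
    set x := ⟪(ω : R3), (σ : R3)⟫ with hx
    by_cases h : x < 1
    · have hs := sh_pos h
      rw [vOut_polar v r hr ω σ h, ← hx]
      simp only [hq1, hΦ, indicator_of_mem (show x ∈ Iio 1 from h)]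
      rw [norm_smul, norm_S2, mul_one, Real.norm_of_nonneg (by positivity)]
      have : ENNReal.ofReal (r^2) * ENNReal.ofReal (r^γ) * ENNReal.ofReal (sh x ^ (γ + 3)) =
        ENNReal.ofReal (sh x) * ENNReal.ofReal ((r * sh x)^2) * ENNReal.ofReal ((r * sh x)^γ) := by
        rw [← ENNReal.ofReal_mul (by positivity), ← ENNReal.ofReal_mul (by positivity), ← ENNReal.ofReal_mul (by positivity), ← ENNReal.ofReal_mul (by positivity)]
        congr 1
        rw [Real.mul_rpow hr.le hs.le, Real.rpow_add hs, show (3:ℝ) = ((3:ℕ):ℝ) by norm_num, Real.rpow_natCast]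
        ring
      have t2 := congrArg (fun z => z * (q x * F (v - (r * sh x) • (nrm ((ω : R3) - σ) : R3)))) this
      calc _ = _ := by ring
        _ = _ := t2
        _ = _ := by ring
    · have : sh x = 0 := by
        rw [sh]; apply Real.sqrt_eq_zero_of_nonpos; linarith
      simp [this, Real.zero_rpow (show γ + 3 ≠ 0 by positivity)]
  rw [setLIntegral_congr_fun measurableSet_Ioi this, lintegral_lintegral_swap]
  · apply lintegral_congr
    intro σ
    rw [lintegral_const_mul _ (by fun_prop)]
    set x := ⟪(ω : R3), (σ : R3)⟫ with hx
    by_cases h : x < 1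
    · rw [scale_lint (fun ρ => (ENNReal.ofReal (ρ ^ 2) *
        Φ (ρ • (nrm ((ω : R3) - σ) : R3)))) _ (sh_pos h)]
    · simp [hq1, not_lt.1 h]
  · apply Measurable.aemeasurable
    fun_prop

lemma norm_unit_le (u : R3) : ‖‖u‖⁻¹ • u‖ ≤ 1 := by
  rw [norm_smul, norm_inv, norm_norm]
  by_cases h : ‖u‖ = 0
  · simp [h]
  · rw [inv_mul_cancel₀ h]

lemma cosAngle_abs (v w : R3) (σ : S2) : |cosAngle v w σ| ≤ 1 := by
  unfold cosAngle
  refine (abs_real_inner_le_norm _ _).trans ?_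
  rw [norm_S2, mul_one]
  exact norm_unit_le _

lemma cosAngle_le (v w : R3) (σ : S2) : cosAngle v w σ ≤ 1 := (abs_le.1 (cosAngle_abs v w σ)).2
lemma cosAngle_ge (v w : R3) (σ : S2) : -1 ≤ cosAngle v w σ := (abs_le.1 (cosAngle_abs v w σ)).1

lemma sh_sq {x : ℝ} (h : x ≤ 1) : sh x ^ 2 = (1 - x) / 2 := Real.sq_sqrt (by linarith)
lemma ch_sq {x : ℝ} (h : -1 ≤ x) : ch x ^ 2 = (1 + x) / 2 := Real.sq_sqrt (by linarith)

lemma sh_ch_sq (v w : R3) (σ : S2) : sh (cosAngle v w σ) ^ 2 + ch (cosAngle v w σ) ^ 2 = 1 := by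
  rw [sh_sq (cosAngle_le v w σ), ch_sq (cosAngle_ge v w σ)]; ring

lemma norm_mul_cosAngle (v w : R3) (σ : S2) : ‖v - w‖ * cosAngle v w σ = ⟪v - w, (σ : R3)⟫ := by
  unfold cosAngle
  rw [inner_smul_left]
  by_cases h : ‖v - w‖ = 0
  · have : v - w = 0 := norm_eq_zero.1 h
    simp [this]
  · simp; field_simp

lemma vOut_sub (v w : R3) (σ : S2) : ‖vOut v w σ - v‖ = sh (cosAngle v w σ) * ‖v - w‖ := by
  have h : vOut v w σ - v = (‖v - w‖ / 2) • (σ : R3) - (2⁻¹ : ℝ) • (v - w) := by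
    unfold vOut; module
  have hsq : ‖vOut v w σ - v‖ ^ 2 = (sh (cosAngle v w σ) * ‖v - w‖) ^ 2 := by
    rw [h, norm_sub_sq_real, norm_smul, norm_smul, norm_S2, mul_pow (sh _), sh_sq (cosAngle_le v w σ), inner_smul_left,
      inner_smul_right, real_inner_comm, ← norm_mul_cosAngle]
    simp
    ring
  have := sh_nonneg (cosAngle v w σ)
  exact (sq_eq_sq₀ (norm_nonneg _) (by positivity)).1 hsq

lemma vOutStar_sub (v w : R3) (σ : S2) : ‖vOutStar v w σ - v‖ = ch (cosAngle v w σ) * ‖v - w‖ := by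
  have h : vOutStar v w σ - v = -((‖v - w‖ / 2) • (σ : R3) + (2⁻¹ : ℝ) • (v - w)) := by
    unfold vOutStar; module
  have hsq : ‖vOutStar v w σ - v‖ ^ 2 = (ch (cosAngle v w σ) * ‖v - w‖) ^ 2 := by
    rw [h, norm_neg, norm_add_sq_real, norm_smul, norm_smul, norm_S2, mul_pow (ch _), ch_sq (cosAngle_ge v w σ), inner_smul_left,
      inner_smul_right, real_inner_comm, ← norm_mul_cosAngle]
    simp
    ring
  have := ch_nonneg (cosAngle v w σ)
  exact (sq_eq_sq₀ (norm_nonneg _) (by positivity)).1 hsq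

lemma vOut_add (v w : R3) (σ : S2) : vOut v w σ + vOutStar v w σ = v + w := by
  unfold vOut vOutStar; module

lemma vOut_diff (v w : R3) (σ : S2) : vOut v w σ - vOutStar v w σ = ‖v - w‖ • (σ : R3) := by
  unfold vOut vOutStar; module

lemma vOut_energy (v w : R3) (σ : S2) : ‖vOut v w σ‖ ^ 2 + ‖vOutStar v w σ‖ ^ 2 = ‖v‖ ^ 2 + ‖w‖ ^ 2 := by
  have h1 := parallelogram_law_with_norm ℝ (vOut v w σ) (vOutStar v w σ)
  have h2 := parallelogram_law_with_norm ℝ v w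
  rw [vOut_add, vOut_diff, norm_smul, norm_S2, mul_one, norm_norm] at h1
  linarith

/-- Negation on the sphere. -/
lemma sph_neg (H : S2 → ℝ≥0∞) (hH : Measurable H) : ∫⁻ σ, H (-σ) ∂sphMeasure = ∫⁻ σ, H σ ∂sphMeasure :=
  sph_inv (LinearIsometryEquiv.neg ℝ) H hH

lemma vOutStar_eq (v w : R3) (σ : S2) : vOutStar v w σ = vOut v w (-σ) := by
  unfold vOut vOutStar; simp [sub_eq_add_neg]

lemma cosAngle_neg (v w : R3) (σ : S2) : cosAngle v w (-σ) = -cosAngle v w σ := by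
  unfold cosAngle; simp

lemma sh_neg (x : ℝ) : sh (-x) = ch x := by simp [sh, ch]
lemma ch_neg (x : ℝ) : ch (-x) = sh x := by simp [sh, ch, sub_eq_add_neg]

lemma Lam_neg (q : ℝ → ℝ≥0∞) (hq : Measurable q) : Lam (fun x => q (-x)) = Lam q := by
  unfold Lam
  rw [← sph_neg _ (by fun_prop)]
  simp

lemma carlY (γ : ℝ) (hγ : 0 ≤ γ) (q : ℝ → ℝ≥0∞) (hq : Measurable q) (hfin : Lam q ≠ ⊤) (F : R3 → ℝ≥0∞) (hF : Measurable F)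
    (v : R3) :
    ∫⁻ w, ∫⁻ σ, ENNReal.ofReal (‖v - w‖ ^ γ) * q (cosAngle v w σ) *
      ENNReal.ofReal (ch (cosAngle v w σ) ^ (γ + 3)) * F (vOutStar v w σ) ∂sphMeasure
      ≤ Lam q * ∫⁻ x, F x * ENNReal.ofReal (‖x - v‖ ^ γ) := by
  have h := carl γ hγ (fun x => q (-x)) (by fun_prop) (by rwa [Lam_neg q hq]) F hF v
  rw [Lam_neg q hq] at h
  refine le_trans (le_of_eq ?_) h
  apply lintegral_congr
  intro w
  rw [← sph_neg _ (by fun_prop)]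
  apply lintegral_congr
  intro σ
  rw [vOutStar_eq, neg_neg, cosAngle_neg, ch_neg]

/-- product measure -/
def PM : Measure (R3 × S2) := (volume : Measure R3).prod sphMeasure

instance : SFinite PM := by unfold PM; infer_instance
instance : SigmaFinite PM := by unfold PM; infer_instance

lemma lint_PM (P : R3 × S2 → ℝ≥0∞) (hP : Measurable P) : ∫⁻ p, P p ∂PM = ∫⁻ w, ∫⁻ σ, P (w, σ) ∂sphMeasure := by
  unfold PM
  rw [lintegral_prod _ hP.aemeasurable]

lemma Lam_one : Lam (fun _ => 1) ≠ ⊤ := by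
  simp [Lam]

lemma null_coll {Z : Set R3} (hZ : MeasurableSet Z) (h0 : volume Z = 0) {v : R3} (hv : v ∉ Z) :
    ∀ᵐ p ∂PM, vOut v p.1 p.2 ∉ Z ∧ vOutStar v p.1 p.2 ∉ Z := by
  have hF : Measurable (Z.indicator (fun _ => (1:ℝ≥0∞))) := measurable_const.indicator hZ
  have hz : ∫⁻ x, (Z.indicator (fun _ => (1:ℝ≥0∞))) x * ENNReal.ofReal (‖x - v‖ ^ (0:ℝ)) = 0 := by
    simp [lintegral_indicator hZ, h0]
  have h1 := carl 0 le_rfl (fun _ => 1) measurable_const Lam_one _ hF v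
  have h2 := carlY 0 le_rfl (fun _ => 1) measurable_const Lam_one _ hF v
  rw [hz, mul_zero, nonpos_iff_eq_zero] at h1 h2
  rw [← lint_PM (fun p => ENNReal.ofReal (‖v - p.1‖ ^ (0:ℝ)) * 1 *
      ENNReal.ofReal (sh (cosAngle v p.1 p.2) ^ ((0:ℝ) + 3)) * (Z.indicator (fun _ => (1:ℝ≥0∞))) (vOut v p.1 p.2)) (by fun_prop),
      lintegral_eq_zero_iff (by fun_prop)] at h1
  rw [← lint_PM (fun p => ENNReal.ofReal (‖v - p.1‖ ^ (0:ℝ)) * 1 *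
      ENNReal.ofReal (ch (cosAngle v p.1 p.2) ^ ((0:ℝ) + 3)) * (Z.indicator (fun _ => (1:ℝ≥0∞))) (vOutStar v p.1 p.2)) (by fun_prop),
      lintegral_eq_zero_iff (by fun_prop)] at h2
  filter_upwards [h1, h2] with p h1 h2
  constructor
  · intro hX
    simp only [indicator_of_mem hX, rpow_zero, ENNReal.ofReal_one, mul_one, one_mul, Pi.zero_apply, ENNReal.ofReal_eq_zero] at h1
    have hs : sh (cosAngle v p.1 p.2) = 0 := by
      by_contra hne
      have := lt_of_le_of_ne (sh_nonneg (cosAngle v p.1 p.2)) (Ne.symm hne)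
      have := Real.rpow_pos_of_pos this (0+3)
      linarith
    have := vOut_sub v p.1 p.2
    rw [hs, zero_mul, norm_eq_zero, sub_eq_zero] at this
    rw [this] at hX; exact hv hX
  · intro hX
    simp only [indicator_of_mem hX, rpow_zero, ENNReal.ofReal_one, mul_one, one_mul, Pi.zero_apply, ENNReal.ofReal_eq_zero] at h2
    have hs : ch (cosAngle v p.1 p.2) = 0 := by
      by_contra hne
      have := lt_of_le_of_ne (ch_nonneg (cosAngle v p.1 p.2)) (Ne.symm hne)
      have := Real.rpow_pos_of_pos this (0+3)
      linarith
    have := vOutStar_sub v p.1 p.2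
    rw [hs, zero_mul, norm_eq_zero, sub_eq_zero] at this
    rw [this] at hX; exact hv hX



def Lb (b : ℝ → ℝ) (χ : ℝ → ℝ≥0∞) : ℝ≥0∞ := Lam (fun x => ENNReal.ofReal (b x) * χ x)

lemma Lb_mono (b : ℝ → ℝ) {χ ψ : ℝ → ℝ≥0∞} (h : ∀ x, χ x ≤ ψ x) : Lb b χ ≤ Lb b ψ :=
  lintegral_mono (fun σ => by simp only; gcongr; exact h _)

lemma Lam_hat (q : ℝ → ℝ≥0∞) (hq : Measurable q) :
    Lam q = ENNReal.ofReal (2*π) * ∫⁻ θ in Ioo 0 π, ENNReal.ofReal (sin θ) * q (cos θ) := hatbox_e0 q hq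

lemma lint_b_fin {b : ℝ → ℝ} (hb : GradCutoff b) :
    ∫⁻ θ in Ioo 0 π, ENNReal.ofReal (sin θ) * ENNReal.ofReal (b (cos θ)) ≠ ⊤ := by
  have h := hb.integrable
  rw [intervalIntegrable_iff_integrableOn_Ioo_of_le pi_pos.le] at h
  have h2 := h.lintegral_lt_top
  refine ne_of_lt (lt_of_eq_of_lt ?_ h2)
  apply setLIntegral_congr_fun measurableSet_Ioo
  intro θ hθ
  simp only
  rw [ENNReal.ofReal_mul (hb.nonneg _), mul_comm]

lemma Lb_one_fin {b : ℝ → ℝ} (hb : GradCutoff b) : Lb b (fun _ => 1) ≠ ⊤ := by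
  have hm := hb.measurable
  unfold Lb
  rw [Lam_hat _ (by fun_prop)]
  simp only [mul_one]
  exact ENNReal.mul_ne_top ENNReal.ofReal_ne_top (lint_b_fin hb)

lemma Lb_fin {b : ℝ → ℝ} (hb : GradCutoff b) {χ : ℝ → ℝ≥0∞} (h : ∀ x, χ x ≤ 1) : Lb b χ ≠ ⊤ :=
  ne_top_of_le_ne_top (Lb_one_fin hb) (Lb_mono b h)

lemma Lb_one_pos {b : ℝ → ℝ} (hb : GradCutoff b) : Lb b (fun _ => 1) ≠ 0 := by
  have hm := hb.measurable
  unfold Lb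
  rw [Lam_hat _ (by fun_prop)]
  simp only [mul_one]
  have h2 : ENNReal.ofReal (2*π) ≠ 0 := by simp [pi_pos]
  refine mul_ne_zero h2 ?_
  intro h
  have hp := hb.pos
  rw [intervalIntegral.integral_of_le pi_pos.le, integral_Ioc_eq_integral_Ioo,
    integral_eq_lintegral_of_nonneg_ae] at hp
  · have : ∫⁻ θ in Ioo 0 π, ENNReal.ofReal (b (cos θ) * sin θ) = 0 := by
      rw [← h]
      apply setLIntegral_congr_fun measurableSet_Ioo
      intro θ hθ
      simp only
      rw [ENNReal.ofReal_mul (hb.nonneg _), mul_comm]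
    rw [this] at hp
    simp at hp
  · filter_upwards [ae_restrict_mem measurableSet_Ioo] with θ hθ
    exact mul_nonneg (hb.nonneg _) (sin_pos_of_mem_Ioo hθ).le
  · apply Measurable.aestronglyMeasurable
    fun_prop

/-- grazing indicator -/
def graz (ε : ℝ) (x : ℝ) : ℝ≥0∞ := if sh x ≤ ε ∨ ch x ≤ ε then 1 else 0
/-- non-grazing indicator -/
def ngraz (ε : ℝ) (x : ℝ) : ℝ≥0∞ := if sh x ≤ ε ∨ ch x ≤ ε then 0 else 1

lemma measurableSet_graz (ε : ℝ) : MeasurableSet {x | sh x ≤ ε ∨ ch x ≤ ε} :=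
  (measurableSet_le measurable_sh measurable_const).union (measurableSet_le measurable_ch measurable_const)

@[fun_prop]
lemma measurable_graz (ε : ℝ) : Measurable (graz ε) :=
  Measurable.ite (measurableSet_graz ε) measurable_const measurable_const
@[fun_prop]
lemma measurable_ngraz (ε : ℝ) : Measurable (ngraz ε) :=
  Measurable.ite (measurableSet_graz ε) measurable_const measurable_const

lemma graz_le (ε x : ℝ) : graz ε x ≤ 1 := by unfold graz; split_ifs <;> simp
lemma ngraz_le (ε x : ℝ) : ngraz ε x ≤ 1 := by unfold ngraz; split_ifs <;> simp
lemma graz_mono {ε ε' : ℝ} (h : ε ≤ ε') (x : ℝ) : graz ε x ≤ graz ε' x := by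
  unfold graz
  split_ifs with h1 h2
  · exact le_rfl
  · exact absurd (h1.imp (fun h' => h'.trans h) (fun h' => h'.trans h)) h2
  · simp
  · exact le_rfl

lemma Lb_graz_small {b : ℝ → ℝ} (hb : GradCutoff b) {η : ℝ≥0∞} (hη : 0 < η) :
    ∃ ε : ℝ, 0 < ε ∧ ε ≤ 1/4 ∧ Lb b (graz ε) ≤ η := by
  have hm := hb.measurable
  have key : Filter.Tendsto (fun n : ℕ => Lb b (graz (1 / ((n:ℝ) + 1)))) Filter.atTop (nhds 0) := by
    have e : ∀ n : ℕ, Lb b (graz (1 / ((n:ℝ) + 1))) = ENNReal.ofReal (2*π) * ∫⁻ θ in Ioo 0 π, ENNReal.ofReal (sin θ) *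
        (ENNReal.ofReal (b (cos θ)) * graz (1 / ((n:ℝ) + 1)) (cos θ)) := by
      intro n
      unfold Lb
      rw [Lam_hat _ (by fun_prop)]
    simp_rw [e]
    rw [show (0:ℝ≥0∞) = ENNReal.ofReal (2*π) * 0 by simp]
    apply ENNReal.Tendsto.const_mul _ (Or.inr ENNReal.ofReal_ne_top)
    rw [show (0:ℝ≥0∞) = ∫⁻ θ in Ioo 0 π, 0 by simp]
    apply tendsto_lintegral_of_dominated_convergence (fun θ => ENNReal.ofReal (sin θ) * ENNReal.ofReal (b (cos θ)))
    · intro n; fun_prop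
    · intro n
      refine Filter.Eventually.of_forall (fun θ => ?_)
      simp only
      gcongr
      calc _ ≤ ENNReal.ofReal (b (cos θ)) * 1 := by gcongr; exact graz_le _ _
        _ = _ := mul_one _
    · exact lint_b_fin hb
    · filter_upwards [ae_restrict_mem measurableSet_Ioo] with θ hθ
      have c1 : cos θ < 1 := by
        rw [← cos_zero]
        exact cos_lt_cos_of_nonneg_of_le_pi le_rfl hθ.2.le hθ.1
      have c2 : -1 < cos θ := by
        rw [← cos_pi]
        exact cos_lt_cos_of_nonneg_of_le_pi hθ.1.le le_rfl hθ.2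
      have p1 : 0 < sh (cos θ) := sh_pos c1
      have p2 : 0 < ch (cos θ) := by rw [← sh_neg]; exact sh_pos (by linarith)
      apply tendsto_const_nhds.congr'
      have t := tendsto_one_div_add_atTop_nhds_zero_nat (𝕜 := ℝ)
      filter_upwards [t.eventually (gt_mem_nhds p1), t.eventually (gt_mem_nhds p2)] with n h1 h2
      have : graz (1 / ((n:ℝ) + 1)) (cos θ) = 0 := by
        unfold graz; rw [if_neg]; push Not; exact ⟨h1, h2⟩
      rw [this]; simp
  obtain ⟨n, h1, h2⟩ := ((key.eventually (gt_mem_nhds hη)).and (Filter.eventually_ge_atTop 3)).exists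
  refine ⟨1 / ((n:ℝ)+1), by positivity, ?_, h1.le⟩
  apply one_div_le_one_div_of_le (by norm_num)
  have : (3:ℝ) ≤ n := by exact_mod_cast h2
  linarith

lemma Lb_split {b : ℝ → ℝ} (hb : GradCutoff b) (ε : ℝ) : Lb b (graz ε) + Lb b (ngraz ε) = Lb b (fun _ => 1) := by
  have hm := hb.measurable
  unfold Lb Lam
  rw [← lintegral_add_left (by fun_prop)]
  apply lintegral_congr
  intro σ
  rw [← mul_add]
  congr 1
  unfold graz ngraz
  split_ifs <;> simp

lemma mlint {α β : Type*} [MeasurableSpace α] [MeasurableSpace β] {ν : Measure β} [SFinite ν] {f : α → β → ℝ≥0∞}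
    (hf : Measurable (fun p : α × β => f p.1 p.2)) : Measurable (fun x => ∫⁻ y, f x y ∂ν) :=
  hf.lintegral_prod_right'

lemma triple_polar (G : R3 × R3 × S2 → ℝ≥0∞) (hG : Measurable G) :
    ∫⁻ v, ∫⁻ w, ∫⁻ σ, G (v, w, σ) ∂sphMeasure =
    ∫⁻ ω, ∫⁻ σ, (∫⁻ r in Ioi (0:ℝ), ∫⁻ z : R3, ENNReal.ofReal (r ^ 2) *
      G (z + (r / 2) • (ω : R3), z - (r / 2) • (ω : R3), σ)) ∂sphMeasure ∂sphMeasure := by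
  have hH : Measurable (fun p : R3 × R3 => ∫⁻ σ, G (p.1, p.2, σ) ∂sphMeasure) := mlint (by fun_prop)
  set H : R3 → R3 → ℝ≥0∞ := fun v w => ∫⁻ σ, G (v, w, σ) ∂sphMeasure with hHd
  have s1 : ∫⁻ v, ∫⁻ w, H v w = ∫⁻ u, ∫⁻ z, H (z + (2⁻¹:ℝ) • u) (z - (2⁻¹:ℝ) • u) := by
    have : ∀ v, ∫⁻ w, H v w = ∫⁻ u, H v (v - u) := fun v => (lintegral_sub_left_eq_self (fun w => H v w) v).symm
    rw [lintegral_congr this, lintegral_lintegral_swap]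
    · apply lintegral_congr
      intro u
      rw [← lintegral_add_right_eq_self _ ((2⁻¹:ℝ) • u)]
      apply lintegral_congr
      intro z
      congr 1
      module
    · apply Measurable.aemeasurable
      exact hH.comp (g := fun p : R3 × R3 => H p.1 p.2) (f := fun p : R3 × R3 => (p.1, p.1 - p.2)) (by fun_prop)
  rw [s1, polar_lintegral]
  · apply lintegral_congr
    intro ω
    rw [lintegral_lintegral_swap (by
      apply Measurable.aemeasurable
      apply mlint (f := fun (p : S2 × ℝ) (z : R3) => ENNReal.ofReal (p.2 ^ 2) *
        G (z + (p.2 / 2) • (ω : R3), z - (p.2 / 2) • (ω : R3), p.1))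
      fun_prop)]
    apply lintegral_congr
    intro r
    have s2 : ∫⁻ σ, ∫⁻ z : R3, ENNReal.ofReal (r ^ 2) *
      G (z + (r / 2) • (ω : R3), z - (r / 2) • (ω : R3), σ) ∂volume ∂sphMeasure = ∫⁻ z : R3, ∫⁻ σ, ENNReal.ofReal (r ^ 2) *
      G (z + (r / 2) • (ω : R3), z - (r / 2) • (ω : R3), σ) ∂sphMeasure :=
      lintegral_lintegral_swap (by
        apply Measurable.aemeasurable
        fun_prop)
    rw [s2, ← lintegral_const_mul]
    · apply lintegral_congr
      intro z
      rw [lintegral_const_mul _ (by fun_prop)]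
      simp only [hHd, smul_smul]
      rw [show (2⁻¹:ℝ) * r = r / 2 by ring]
    · exact hH.comp (g := fun p : R3 × R3 => H p.1 p.2) (f := fun z : R3 => (z + (2⁻¹:ℝ) • (r • (ω : R3)), z - (2⁻¹:ℝ) • (r • (ω : R3)))) (by fun_prop)
  · apply mlint (f := fun (u : R3) (z : R3) => H (z + (2⁻¹:ℝ) • u) (z - (2⁻¹:ℝ) • u))
    exact hH.comp (g := fun p : R3 × R3 => H p.1 p.2) (f := fun p : R3 × R3 => (p.2 + (2⁻¹:ℝ) • p.1, p.2 - (2⁻¹:ℝ) • p.1)) (by fun_prop)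

/-- pre-post collisional change of variables -/
lemma prepost (G : R3 × R3 × S2 → ℝ≥0∞) (hG : Measurable G) :
    ∫⁻ v, ∫⁻ w, ∫⁻ σ, G (v, w, σ) ∂sphMeasure =
    ∫⁻ v, ∫⁻ w, ∫⁻ σ, G (vOut v w σ, vOutStar v w σ, nrm (v - w)) ∂sphMeasure := by
  rw [triple_polar G hG, triple_polar (fun p => G (vOut p.1 p.2.1 p.2.2, vOutStar p.1 p.2.1 p.2.2, nrm (p.1 - p.2.1))) (by fun_prop)]
  rw [lintegral_lintegral_swap (by
      apply Measurable.aemeasurable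
      apply mlint (f := fun (p : S2 × S2) (r : ℝ) => ∫⁻ z : R3, ENNReal.ofReal (r ^ 2) *
        G (z + (r / 2) • (p.1 : R3), z - (r / 2) • (p.1 : R3), p.2))
      apply mlint (f := fun (p : (S2 × S2) × ℝ) (z : R3) => ENNReal.ofReal (p.2 ^ 2) *
        G (z + (p.2 / 2) • (p.1.1 : R3), z - (p.2 / 2) • (p.1.1 : R3), p.1.2))
      fun_prop)]
  apply lintegral_congr; intro ω
  apply lintegral_congr; intro σ
  apply setLIntegral_congr_fun measurableSet_Ioi
  intro r hr
  have hr : 0 < r := hr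
  apply lintegral_congr; intro z
  simp only
  have hd : z + (r / 2) • (ω : R3) - (z - (r / 2) • (ω : R3)) = r • (ω : R3) := by module
  have hX : vOut (z + (r / 2) • (ω : R3)) (z - (r / 2) • (ω : R3)) σ = z + (r / 2) • (σ : R3) := by
    unfold vOut
    rw [hd, norm_smul, norm_S2, mul_one, Real.norm_of_nonneg hr.le]
    module
  have hY : vOutStar (z + (r / 2) • (ω : R3)) (z - (r / 2) • (ω : R3)) σ = z - (r / 2) • (σ : R3) := by
    unfold vOutStar
    rw [hd, norm_smul, norm_S2, mul_one, Real.norm_of_nonneg hr.le]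
    module
  rw [hX, hY, hd, nrm_smul hr]

lemma vOut_swap (v w : R3) (σ : S2) : vOut w v (-σ) = vOutStar v w σ := by
  unfold vOut vOutStar; rw [norm_sub_rev]; simp [sub_eq_add_neg, add_comm]
lemma vOutStar_swap (v w : R3) (σ : S2) : vOutStar w v (-σ) = vOut v w σ := by
  unfold vOut vOutStar; rw [norm_sub_rev]; simp [sub_eq_add_neg, add_comm]
lemma cosAngle_swap (v w : R3) (σ : S2) : cosAngle w v (-σ) = cosAngle v w σ := by
  unfold cosAngle
  rw [norm_sub_rev, ← neg_sub v w, smul_neg, inner_neg_left, show ((-σ : S2) : R3) = -(σ : R3) from rfl, inner_neg_right, neg_neg]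

lemma swap_lint (G : R3 × R3 × S2 → ℝ≥0∞) (hG : Measurable G) :
    ∫⁻ v, ∫⁻ w, ∫⁻ σ, G (v, w, σ) ∂sphMeasure =
    ∫⁻ v, ∫⁻ w, ∫⁻ σ, G (w, v, -σ) ∂sphMeasure := by
  rw [lintegral_lintegral_swap (by
    apply Measurable.aemeasurable
    apply mlint (f := fun (p : R3 × R3) (σ : S2) => G (p.1, p.2, σ))
    fun_prop)]
  apply lintegral_congr; intro v
  apply lintegral_congr; intro w
  exact (sph_neg _ (by fun_prop)).symm

@[fun_prop]
lemma Measurable.Bker' {α : Type*} [MeasurableSpace α] {γ : ℝ} {b : ℝ → ℝ} {f g : α → R3} {h : α → S2} (hb : Measurable b) (hf : Measurable f)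
    (hg : Measurable g) (hh : Measurable h) : Measurable (fun a => Bker γ b (f a) (g a) (h a)) := by
  unfold Bker
  fun_prop

lemma Bker_nonneg {γ : ℝ} {b : ℝ → ℝ} (hb : GradCutoff b) (v w : R3) (σ : S2) : 0 ≤ Bker γ b v w σ :=
  mul_nonneg (by positivity) (hb.nonneg _)

lemma Bker_swap {γ : ℝ} {b : ℝ → ℝ} (v w : R3) (σ : S2) : Bker γ b w v (-σ) = Bker γ b v w σ := by
  unfold Bker; rw [cosAngle_swap, norm_sub_rev]

lemma coll_swap_dist (v w : R3) (σ : S2) : ‖vOut v w σ - vOutStar v w σ‖ = ‖v - w‖ := by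
  rw [vOut_diff, norm_smul, norm_S2, mul_one, norm_norm]

/-- relation valid when `v ≠ w` -/
lemma Bker_post {γ : ℝ} {b : ℝ → ℝ} {v w : R3} (h : v ≠ w) (σ : S2) :
    Bker γ b (vOut v w σ) (vOutStar v w σ) (nrm (v - w)) = Bker γ b v w σ := by
  have h' : v - w ≠ 0 := sub_ne_zero.2 h
  have h'' : ‖v - w‖ ≠ 0 := norm_ne_zero_iff.2 h'
  unfold Bker cosAngle
  rw [coll_swap_dist, vOut_diff, smul_smul, inv_mul_cancel₀ h'', one_smul, nrm_coe h', real_inner_comm]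

lemma vOut_post {v w : R3} (h : v ≠ w) (σ : S2) :
    vOut (vOut v w σ) (vOutStar v w σ) (nrm (v - w)) = v ∧ vOutStar (vOut v w σ) (vOutStar v w σ) (nrm (v - w)) = w := by
  have h' : v - w ≠ 0 := sub_ne_zero.2 h
  have h'' : ‖v - w‖ ≠ 0 := norm_ne_zero_iff.2 h'
  constructor
  · rw [vOut, coll_swap_dist, vOut_add, nrm_coe h', smul_smul]
    rw [show ‖v - w‖ / 2 * ‖v - w‖⁻¹ = 2⁻¹ by field_simp]
    module
  · rw [vOutStar, coll_swap_dist, vOut_add, nrm_coe h', smul_smul]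
    rw [show ‖v - w‖ / 2 * ‖v - w‖⁻¹ = 2⁻¹ by field_simp]
    module

/-- collision functional -/
def JJ (γ : ℝ) (b : ℝ → ℝ) (v : R3) (P : R3 × S2 → ℝ≥0∞) : ℝ≥0∞ :=
  ∫⁻ p, ENNReal.ofReal (Bker γ b v p.1 p.2) * P p ∂PM

lemma JJ_mono {γ : ℝ} {b : ℝ → ℝ} {v : R3} {P P' : R3 × S2 → ℝ≥0∞} (h : ∀ p, P p ≤ P' p) :
    JJ γ b v P ≤ JJ γ b v P' := lintegral_mono (fun p => by simp only; gcongr; exact h p)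

lemma JJ_mono_ae {γ : ℝ} {b : ℝ → ℝ} {v : R3} {P P' : R3 × S2 → ℝ≥0∞} (h : ∀ᵐ p ∂PM, P p ≤ P' p) :
    JJ γ b v P ≤ JJ γ b v P' := lintegral_mono_ae (by filter_upwards [h] with p hp; gcongr)

lemma JJ_add {γ : ℝ} {b : ℝ → ℝ} (hb : GradCutoff b) {v : R3} {P P' : R3 × S2 → ℝ≥0∞} (hP : Measurable P) :
    JJ γ b v (fun p => P p + P' p) = JJ γ b v P + JJ γ b v P' := by
  have := hb.measurable
  unfold JJ
  simp_rw [mul_add]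
  rw [lintegral_add_left (by fun_prop)]

lemma JJ_const_mul {γ : ℝ} {b : ℝ → ℝ} (hb : GradCutoff b) {v : R3} {P : R3 × S2 → ℝ≥0∞} (hP : Measurable P) (c : ℝ≥0∞) :
    JJ γ b v (fun p => c * P p) = c * JJ γ b v P := by
  have := hb.measurable
  unfold JJ
  rw [← lintegral_const_mul _ (by fun_prop)]
  apply lintegral_congr; intro p; ring

/-- weighted mass around `v` -/
def WI (γ : ℝ) (v : R3) (F : R3 → ℝ≥0∞) : ℝ≥0∞ := ∫⁻ x, F x * ENNReal.ofReal (‖x - v‖ ^ γ)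

lemma sh_le_one {x : ℝ} (h : -1 ≤ x) : sh x ≤ 1 := by
  unfold sh; rw [Real.sqrt_le_iff]; constructor <;> linarith
lemma ch_le_one {x : ℝ} (h : x ≤ 1) : ch x ≤ 1 := by
  unfold ch; rw [Real.sqrt_le_iff]; constructor <;> linarith

lemma pow5_le {γ : ℝ} (h0 : 0 < γ) (h2 : γ ≤ 2) {x : ℝ} (hx : 0 ≤ x) (hx1 : x ≤ 1) : x ^ 5 ≤ x ^ (γ + 3) := by
  rw [← Real.rpow_natCast x 5]
  exact Real.rpow_le_rpow_of_exponent_ge' hx hx1 (by linarith) (by push_cast; linarith)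

lemma carlJX {γ : ℝ} (h0 : 0 < γ) (h2 : γ ≤ 2) {b : ℝ → ℝ} (hb : GradCutoff b) {χ : ℝ → ℝ≥0∞} (hχ : Measurable χ)
    (hχ1 : ∀ x, χ x ≤ 1) {F : R3 → ℝ≥0∞} (hF : Measurable F) (v : R3) :
    JJ γ b v (fun p => χ (cosAngle v p.1 p.2) * ENNReal.ofReal (sh (cosAngle v p.1 p.2) ^ 5) * F (vOut v p.1 p.2))
      ≤ Lb b χ * WI γ v F := by
  have hm := hb.measurable
  unfold JJ
  rw [lint_PM _ (by fun_prop)]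
  refine le_trans ?_ (carl γ h0.le (fun x => ENNReal.ofReal (b x) * χ x) (by fun_prop) (Lb_fin hb hχ1) F hF v)
  apply lintegral_mono; intro w
  apply lintegral_mono; intro σ
  simp only
  rw [Bker, ENNReal.ofReal_mul (by positivity)]
  have : ENNReal.ofReal (sh (cosAngle v w σ) ^ 5) ≤ ENNReal.ofReal (sh (cosAngle v w σ) ^ (γ+3)) :=
    ENNReal.ofReal_le_ofReal (pow5_le h0 h2 (sh_nonneg _) (sh_le_one (cosAngle_ge _ _ _)))
  calc _ = ENNReal.ofReal (‖v - w‖ ^ γ) * (ENNReal.ofReal (b (cosAngle v w σ)) * χ (cosAngle v w σ)) * ENNReal.ofReal (sh (cosAngle v w σ) ^ 5) * F (vOut v w σ) := by ring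
    _ ≤ _ := by gcongr

lemma carlJY {γ : ℝ} (h0 : 0 < γ) (h2 : γ ≤ 2) {b : ℝ → ℝ} (hb : GradCutoff b) {χ : ℝ → ℝ≥0∞} (hχ : Measurable χ)
    (hχ1 : ∀ x, χ x ≤ 1) {F : R3 → ℝ≥0∞} (hF : Measurable F) (v : R3) :
    JJ γ b v (fun p => χ (cosAngle v p.1 p.2) * ENNReal.ofReal (ch (cosAngle v p.1 p.2) ^ 5) * F (vOutStar v p.1 p.2))
      ≤ Lb b χ * WI γ v F := by
  have hm := hb.measurable
  unfold JJ
  rw [lint_PM _ (by fun_prop)]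
  refine le_trans ?_ (carlY γ h0.le (fun x => ENNReal.ofReal (b x) * χ x) (by fun_prop) (Lb_fin hb hχ1) F hF v)
  apply lintegral_mono; intro w
  apply lintegral_mono; intro σ
  simp only
  rw [Bker, ENNReal.ofReal_mul (by positivity)]
  have : ENNReal.ofReal (ch (cosAngle v w σ) ^ 5) ≤ ENNReal.ofReal (ch (cosAngle v w σ) ^ (γ+3)) :=
    ENNReal.ofReal_le_ofReal (pow5_le h0 h2 (ch_nonneg _) (ch_le_one (cosAngle_le _ _ _)))
  calc _ = ENNReal.ofReal (‖v - w‖ ^ γ) * (ENNReal.ofReal (b (cosAngle v w σ)) * χ (cosAngle v w σ)) * ENNReal.ofReal (ch (cosAngle v w σ) ^ 5) * F (vOutStar v w σ) := by ring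
    _ ≤ _ := by gcongr

lemma carlJW {γ : ℝ} (h0 : 0 < γ) {b : ℝ → ℝ} (hb : GradCutoff b) {χ : ℝ → ℝ≥0∞} (hχ : Measurable χ)
    {F : R3 → ℝ≥0∞} (hF : Measurable F) (v : R3) :
    JJ γ b v (fun p => χ (cosAngle v p.1 p.2) * F p.1) = Lb b χ * WI γ v F := by
  have hm := hb.measurable
  unfold JJ WI
  rw [lint_PM _ (by fun_prop), ← lintegral_const_mul _ (by fun_prop)]
  apply lintegral_congr; intro w
  by_cases h : v = w
  · have : ‖v - w‖ ^ γ = 0 := by rw [h]; simp [Real.zero_rpow h0.ne']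
    rw [norm_sub_rev w v, this]
    simp [Bker, this]
  · have h' : v - w ≠ 0 := sub_ne_zero.2 h
    have hc : ∀ σ, cosAngle v w σ = ⟪(nrm (v - w) : R3), (σ : R3)⟫ := by
      intro σ; rw [nrm_coe h']; rfl
    have e : ∀ σ : S2, ENNReal.ofReal (Bker γ b v w σ) * (χ (cosAngle v w σ) * F w) =
       (fun x => ENNReal.ofReal (b x) * χ x) ⟪(nrm (v - w) : R3), (σ : R3)⟫ * (F w * ENNReal.ofReal (‖v - w‖ ^ γ)) := by
      intro σ
      rw [Bker, ENNReal.ofReal_mul (by positivity), hc]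
      ring
    rw [lintegral_congr e, lintegral_mul_const _ (by fun_prop), Lam_eq (fun x => ENNReal.ofReal (b x) * χ x) (by fun_prop) (nrm (v - w)), norm_sub_rev w v]
    rfl

def N2 (F : R3 → ℝ≥0∞) : ℝ≥0∞ := ∫⁻ x, F x * ENNReal.ofReal (1 + ‖x‖ ^ 2)

lemma rpow_le_sq {γ : ℝ} (h0 : 0 < γ) (h2 : γ ≤ 2) {x : ℝ} (hx : 0 ≤ x) : x ^ γ ≤ 1 + x ^ 2 := by
  rcases le_total x 1 with h | h
  · have := Real.rpow_le_one hx h h0.le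
    nlinarith [sq_nonneg x]
  · have := Real.rpow_le_rpow_of_exponent_le h h2
    rw [Real.rpow_two] at this
    linarith

lemma dist_rpow_le {γ : ℝ} (h0 : 0 < γ) (h2 : γ ≤ 2) (x v : R3) :
    ‖x - v‖ ^ γ ≤ 2 * (1 + ‖v‖ ^ 2) * (1 + ‖x‖ ^ 2) := by
  have h := rpow_le_sq h0 h2 (norm_nonneg (x - v))
  have h1 := norm_sub_le x v
  have h3 : ‖x - v‖ ^ 2 ≤ (‖x‖ + ‖v‖) ^ 2 := by gcongr
  nlinarith [sq_nonneg (‖x‖ - ‖v‖), mul_nonneg (sq_nonneg ‖x‖) (sq_nonneg ‖v‖)]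

lemma WI_le {γ : ℝ} (h0 : 0 < γ) (h2 : γ ≤ 2) (v : R3) (F : R3 → ℝ≥0∞) (hF : Measurable F) :
    WI γ v F ≤ ENNReal.ofReal (2 * (1 + ‖v‖ ^ 2)) * N2 F := by
  unfold WI N2
  rw [← lintegral_const_mul _ (by fun_prop)]
  apply lintegral_mono; intro x
  simp only
  calc F x * ENNReal.ofReal (‖x - v‖ ^ γ) ≤ F x * ENNReal.ofReal (2 * (1 + ‖v‖ ^ 2) * (1 + ‖x‖ ^ 2)) := by
        gcongr; exact dist_rpow_le h0 h2 x v
    _ = _ := by rw [ENNReal.ofReal_mul (by positivity)]; ring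

lemma graz_pow {x ε : ℝ} (h1 : -1 ≤ x) (h2 : x ≤ 1) (hε : ε ≤ 1/4) (hs : sh x ≤ ε) : 1 ≤ 2 * ch x ^ 5 := by
  have a := sh_nonneg x
  have c := ch_nonneg x
  have s : sh x ^ 2 + ch x ^ 2 = 1 := by
    unfold sh ch; rw [Real.sq_sqrt (by linarith), Real.sq_sqrt (by linarith)]; ring
  have e1 : sh x ^ 2 ≤ 1/16 := by nlinarith
  have e2 : 15/16 ≤ ch x ^ 2 := by linarith
  have e3 : 15/16 ≤ ch x := by
    by_contra h
    push Not at h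
    nlinarith
  calc (1:ℝ) ≤ 2 * (15/16) ^ 5 := by norm_num
    _ ≤ _ := by gcongr

lemma graz_pow' {x ε : ℝ} (h1 : -1 ≤ x) (h2 : x ≤ 1) (hε : ε ≤ 1/4) (hs : ch x ≤ ε) : 1 ≤ 2 * sh x ^ 5 := by
  have := graz_pow (x := -x) (by linarith) (by linarith) hε (by rwa [sh_neg])
  rwa [ch_neg] at this

lemma JJ_two {γ : ℝ} (h0 : 0 < γ) (h2 : γ ≤ 2) {b : ℝ → ℝ} (hb : GradCutoff b) {ε : ℝ} (hε0 : 0 < ε) (hε : ε ≤ 1/4)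
    {k h : R3 → ℝ≥0∞} (hk : Measurable k) (hh : Measurable h) (v : R3) {P : R3 × S2 → ℝ≥0∞}
    (H1 : ∀ p, P p ≤ h (vOut v p.1 p.2) + h (vOutStar v p.1 p.2) + h p.1)
    (H2 : ∀ p, P p ≤ k (vOut v p.1 p.2) + k p.1) (H3 : ∀ p, P p ≤ k (vOutStar v p.1 p.2) + k p.1) :
    JJ γ b v P ≤ 6 * (Lb b (graz ε) * WI γ v k) + 3 * ENNReal.ofReal (ε⁻¹ ^ 5) * (Lb b (fun _ => 1) * WI γ v h) := by
  have hm := hb.measurable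
  set e := ENNReal.ofReal (ε⁻¹ ^ 5)
  have he1 : 1 ≤ ε⁻¹ := by rw [one_le_inv₀ hε0]; linarith
  have he : 1 ≤ e := by
    rw [ENNReal.one_le_ofReal]
    exact one_le_pow₀ he1
  have key : ∀ p : R3 × S2, P p ≤
    (2 * (graz ε (cosAngle v p.1 p.2) * ENNReal.ofReal (sh (cosAngle v p.1 p.2) ^ 5) * k (vOut v p.1 p.2)) +
    (2 * (graz ε (cosAngle v p.1 p.2) * ENNReal.ofReal (ch (cosAngle v p.1 p.2) ^ 5) * k (vOutStar v p.1 p.2)) +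
    2 * (graz ε (cosAngle v p.1 p.2) * k p.1))) +
    (e * (1 * ENNReal.ofReal (sh (cosAngle v p.1 p.2) ^ 5) * h (vOut v p.1 p.2)) +
    (e * (1 * ENNReal.ofReal (ch (cosAngle v p.1 p.2) ^ 5) * h (vOutStar v p.1 p.2)) +
    e * (1 * h p.1))) := by
    intro p
    have c1 := cosAngle_ge v p.1 p.2
    have c2 := cosAngle_le v p.1 p.2
    set x := cosAngle v p.1 p.2
    have tw : (2:ℝ≥0∞) = ENNReal.ofReal 2 := by simp
    by_cases hg : sh x ≤ ε ∨ ch x ≤ ε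
    · have hgr : graz ε x = 1 := by simp [graz, hg]
      rw [hgr]
      refine le_trans ?_ le_self_add
      rcases hg with hs | hc
      · refine (H3 p).trans (le_trans ?_ le_add_self)
        apply add_le_add
        · have := graz_pow c1 c2 hε hs
          rw [← ENNReal.one_le_ofReal, ENNReal.ofReal_mul (by norm_num), ← tw] at this
          calc _ = 1 * k (vOutStar v p.1 p.2) := by rw [one_mul]
            _ ≤ (2 * ENNReal.ofReal (ch x ^ 5)) * k (vOutStar v p.1 p.2) := by gcongr
            _ = _ := by ring
        · rw [one_mul, two_mul]; exact le_self_add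
      · refine (H2 p).trans ?_
        apply add_le_add
        · have := graz_pow' c1 c2 hε hc
          rw [← ENNReal.one_le_ofReal, ENNReal.ofReal_mul (by norm_num), ← tw] at this
          calc _ = 1 * k (vOut v p.1 p.2) := by rw [one_mul]
            _ ≤ (2 * ENNReal.ofReal (sh x ^ 5)) * k (vOut v p.1 p.2) := by gcongr
            _ = _ := by ring
        · refine le_trans ?_ le_add_self
          rw [one_mul, two_mul]; exact le_self_add
    · push Not at hg
      refine le_trans ?_ le_add_self
      refine (H1 p).trans ?_
      rw [add_assoc]
      have aux : ∀ y, ε < y → 1 ≤ e * (1 * ENNReal.ofReal (y ^ 5)) := by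
        intro y hy
        rw [one_mul, ← ENNReal.ofReal_mul (by positivity), ENNReal.one_le_ofReal, ← mul_pow]
        apply one_le_pow₀
        rw [inv_mul_eq_div, le_div_iff₀ hε0]; linarith
      gcongr ?_ + (?_ + ?_)
      · calc _ = 1 * h (vOut v p.1 p.2) := by rw [one_mul]
          _ ≤ (e * (1 * ENNReal.ofReal (sh x ^ 5))) * h (vOut v p.1 p.2) := by gcongr; exact aux _ hg.1
          _ = _ := by ring
      · calc _ = 1 * h (vOutStar v p.1 p.2) := by rw [one_mul]
          _ ≤ (e * (1 * ENNReal.ofReal (ch x ^ 5))) * h (vOutStar v p.1 p.2) := by gcongr; exact aux _ hg.2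
          _ = _ := by ring
      · rw [one_mul]; exact le_mul_of_one_le_left' he
  refine (JJ_mono key).trans ?_
  rw [JJ_add hb (by fun_prop), JJ_add hb (by fun_prop), JJ_add hb (by fun_prop), JJ_add hb (by fun_prop), JJ_add hb (by fun_prop)]
  rw [JJ_const_mul hb (by fun_prop), JJ_const_mul hb (by fun_prop), JJ_const_mul hb (by fun_prop), JJ_const_mul hb (by fun_prop), JJ_const_mul hb (by fun_prop), JJ_const_mul hb (by fun_prop)]
  have a1 := carlJX h0 h2 hb (measurable_graz ε) (graz_le ε) hk v
  have a2 := carlJY h0 h2 hb (measurable_graz ε) (graz_le ε) hk v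
  have a3 := (carlJW h0 hb (measurable_graz ε) hk v).le
  have a4 := carlJX h0 h2 hb (χ := fun _ => 1) (by fun_prop) (fun _ => le_rfl) hh v
  have a5 := carlJY h0 h2 hb (χ := fun _ => 1) (by fun_prop) (fun _ => le_rfl) hh v
  have a6 := (carlJW h0 hb (χ := fun _ => 1) (by fun_prop) hh v).le
  calc _ ≤ (2 * (Lb b (graz ε) * WI γ v k) + (2 * (Lb b (graz ε) * WI γ v k) + 2 * (Lb b (graz ε) * WI γ v k))) +
     (e * (Lb b (fun _ => 1) * WI γ v h) + (e * (Lb b (fun _ => 1) * WI γ v h) + e * (Lb b (fun _ => 1) * WI γ v h))) := by gcongr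
    _ = _ := by ring

/-- gain and loss functionals -/
def PA (f : R3 → ℝ) (v : R3) (p : R3 × S2) : ℝ := f (vOut v p.1 p.2) * f (vOutStar v p.1 p.2) * (1 - f p.1)
def PL (f : R3 → ℝ) (v : R3) (p : R3 × S2) : ℝ := f p.1 * (1 - f (vOut v p.1 p.2)) * (1 - f (vOutStar v p.1 p.2))
def AA (γ : ℝ) (b : ℝ → ℝ) (f : R3 → ℝ) (v : R3) : ℝ≥0∞ := JJ γ b v (fun p => ENNReal.ofReal (PA f v p))
def LL (γ : ℝ) (b : ℝ → ℝ) (f : R3 → ℝ) (v : R3) : ℝ≥0∞ := JJ γ b v (fun p => ENNReal.ofReal (PL f v p))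

/-- admissible function -/
structure Uf (f : R3 → ℝ) : Prop where
  meas : Measurable f
  nn : ∀ v, 0 ≤ f v
  le1 : ∀ v, f v ≤ 1

lemma Uf.zero : Uf (fun _ => 0) := ⟨by fun_prop, by simp, by simp⟩

lemma three_diff {a b c a' b' c' : ℝ} (ha : 0 ≤ a) (hb : 0 ≤ b) (hc : 0 ≤ c) (ha' : 0 ≤ a') (hb' : 0 ≤ b') (hc' : 0 ≤ c')
    (ha1 : a ≤ 1) (hb1 : b ≤ 1) (hc1 : c ≤ 1) (ha1' : a' ≤ 1) (hb1' : b' ≤ 1) (hc1' : c' ≤ 1) :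
    |a * b * c - a' * b' * c'| ≤ |a - a'| + |b - b'| + |c - c'| := by
  have : a * b * c - a' * b' * c' = (a - a') * (b * c) + (b - b') * (a' * c) + (c - c') * (a' * b') := by ring
  rw [this]
  have h1 : |(a - a') * (b * c)| ≤ |a - a'| := by
    rw [abs_mul, abs_of_nonneg (mul_nonneg hb hc)]
    exact mul_le_of_le_one_right (abs_nonneg _) (mul_le_one₀ hb1 hc hc1)
  have h2 : |(b - b') * (a' * c)| ≤ |b - b'| := by
    rw [abs_mul, abs_of_nonneg (mul_nonneg ha' hc)]
    exact mul_le_of_le_one_right (abs_nonneg _) (mul_le_one₀ ha1' hc hc1)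
  have h3 : |(c - c') * (a' * b')| ≤ |c - c'| := by
    rw [abs_mul, abs_of_nonneg (mul_nonneg ha' hb')]
    exact mul_le_of_le_one_right (abs_nonneg _) (mul_le_one₀ ha1' hb' hb1')
  exact (abs_add_three _ _ _).trans (by linarith)

lemma prod3_le {a b c : ℝ} (ha : 0 ≤ a) (hb : 0 ≤ b) (hc : 0 ≤ c) (ha1 : a ≤ 1) (hb1 : b ≤ 1) (hc1 : c ≤ 1) :
    0 ≤ a * b * c ∧ a * b * c ≤ a ∧ a * b * c ≤ b ∧ a * b * c ≤ c := by
  have h := mul_nonneg ha hb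
  refine ⟨mul_nonneg h hc, ?_, ?_, ?_⟩
  · nlinarith [mul_nonneg ha hc]
  · nlinarith [mul_nonneg ha hc]
  · nlinarith [mul_nonneg ha hc]

lemma abs_sub_le_add {a b : ℝ} (ha : 0 ≤ a) (hb : 0 ≤ b) : |a - b| ≤ a + b := by
  rw [abs_le]; constructor <;> linarith

section
variable {γ : ℝ} {b : ℝ → ℝ} {f g : R3 → ℝ}

lemma diffA (h0 : 0 < γ) (h2 : γ ≤ 2) (hb : GradCutoff b) {ε : ℝ} (hε0 : 0 < ε) (hε : ε ≤ 1/4)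
    (hf : Uf f) (hg : Uf g) (v : R3) :
    JJ γ b v (fun p => ENNReal.ofReal |PA f v p - PA g v p|) ≤ 6 * (Lb b (graz ε) * WI γ v (fun x => ENNReal.ofReal (f x + g x)))
      + 3 * ENNReal.ofReal (ε⁻¹ ^ 5) * (Lb b (fun _ => 1) * WI γ v (fun x => ENNReal.ofReal |f x - g x|)) := by
  have hfm := hf.meas
  have hgm := hg.meas
  have q1 : ∀ x, 0 ≤ 1 - f x := fun x => by linarith [hf.le1 x]
  have q2 : ∀ x, 0 ≤ 1 - g x := fun x => by linarith [hg.le1 x]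
  have q3 : ∀ x, 1 - f x ≤ 1 := fun x => by linarith [hf.nn x]
  have q4 : ∀ x, 1 - g x ≤ 1 := fun x => by linarith [hg.nn x]
  have pf : ∀ p, 0 ≤ PA f v p ∧ PA f v p ≤ f (vOut v p.1 p.2) ∧ PA f v p ≤ f (vOutStar v p.1 p.2) ∧ PA f v p ≤ 1 - f p.1 := fun p =>
    prod3_le (hf.nn _) (hf.nn _) (q1 _) (hf.le1 _) (hf.le1 _) (q3 _)
  have pg : ∀ p, 0 ≤ PA g v p ∧ PA g v p ≤ g (vOut v p.1 p.2) ∧ PA g v p ≤ g (vOutStar v p.1 p.2) ∧ PA g v p ≤ 1 - g p.1 := fun p =>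
    prod3_le (hg.nn _) (hg.nn _) (q2 _) (hg.le1 _) (hg.le1 _) (q4 _)
  apply JJ_two h0 h2 hb hε0 hε (by fun_prop) (by fun_prop) v
  · intro p
    rw [← ENNReal.ofReal_add (by positivity) (by positivity), ← ENNReal.ofReal_add (by positivity) (by positivity)]
    apply ENNReal.ofReal_le_ofReal
    refine (three_diff (hf.nn _) (hf.nn _) (q1 _) (hg.nn _) (hg.nn _) (q2 _) (hf.le1 _) (hf.le1 _) (q3 _) (hg.le1 _) (hg.le1 _) (q4 _)).trans ?_
    rw [show 1 - f p.1 - (1 - g p.1) = -(f p.1 - g p.1) by ring, abs_neg]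
  · intro p
    refine le_trans ?_ le_self_add
    apply ENNReal.ofReal_le_ofReal
    exact (abs_sub_le_add (pf p).1 (pg p).1).trans (add_le_add (pf p).2.1 (pg p).2.1)
  · intro p
    refine le_trans ?_ le_self_add
    apply ENNReal.ofReal_le_ofReal
    exact (abs_sub_le_add (pf p).1 (pg p).1).trans (add_le_add (pf p).2.2.1 (pg p).2.2.1)

lemma diffL (h0 : 0 < γ) (h2 : γ ≤ 2) (hb : GradCutoff b) {ε : ℝ} (hε0 : 0 < ε) (hε : ε ≤ 1/4)
    (hf : Uf f) (hg : Uf g) (v : R3) :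
    JJ γ b v (fun p => ENNReal.ofReal |PL f v p - PL g v p|) ≤ 6 * (Lb b (graz ε) * WI γ v (fun x => ENNReal.ofReal (f x + g x)))
      + 3 * ENNReal.ofReal (ε⁻¹ ^ 5) * (Lb b (fun _ => 1) * WI γ v (fun x => ENNReal.ofReal |f x - g x|)) := by
  have hfm := hf.meas
  have hgm := hg.meas
  have q1 : ∀ x, 0 ≤ 1 - f x := fun x => by linarith [hf.le1 x]
  have q2 : ∀ x, 0 ≤ 1 - g x := fun x => by linarith [hg.le1 x]
  have q3 : ∀ x, 1 - f x ≤ 1 := fun x => by linarith [hf.nn x]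
  have q4 : ∀ x, 1 - g x ≤ 1 := fun x => by linarith [hg.nn x]
  have pf : ∀ p, 0 ≤ PL f v p ∧ PL f v p ≤ f p.1 := fun p =>
    have := prod3_le (hf.nn p.1) (q1 (vOut v p.1 p.2)) (q1 (vOutStar v p.1 p.2)) (hf.le1 _) (q3 _) (q3 _)
    ⟨this.1, this.2.1⟩
  have pg : ∀ p, 0 ≤ PL g v p ∧ PL g v p ≤ g p.1 := fun p =>
    have := prod3_le (hg.nn p.1) (q2 (vOut v p.1 p.2)) (q2 (vOutStar v p.1 p.2)) (hg.le1 _) (q4 _) (q4 _)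
    ⟨this.1, this.2.1⟩
  apply JJ_two h0 h2 hb hε0 hε (by fun_prop) (by fun_prop) v
  · intro p
    rw [← ENNReal.ofReal_add (by positivity) (by positivity), ← ENNReal.ofReal_add (by positivity) (by positivity)]
    apply ENNReal.ofReal_le_ofReal
    refine (three_diff (hf.nn _) (q1 _) (q1 _) (hg.nn _) (q2 _) (q2 _) (hf.le1 _) (q3 _) (q3 _) (hg.le1 _) (q4 _) (q4 _)).trans ?_
    rw [show 1 - f (vOut v p.1 p.2) - (1 - g (vOut v p.1 p.2)) = -(f (vOut v p.1 p.2) - g (vOut v p.1 p.2)) by ring, abs_neg]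
    rw [show 1 - f (vOutStar v p.1 p.2) - (1 - g (vOutStar v p.1 p.2)) = -(f (vOutStar v p.1 p.2) - g (vOutStar v p.1 p.2)) by ring, abs_neg]
    linarith
  · intro p
    refine le_trans ?_ le_add_self
    apply ENNReal.ofReal_le_ofReal
    exact (abs_sub_le_add (pf p).1 (pg p).1).trans (add_le_add (pf p).2 (pg p).2)
  · intro p
    refine le_trans ?_ le_add_self
    apply ENNReal.ofReal_le_ofReal
    exact (abs_sub_le_add (pf p).1 (pg p).1).trans (add_le_add (pf p).2 (pg p).2)
end

lemma enn_small_mul {c η : ℝ≥0∞} (hc : c ≠ ⊤) (hη : 0 < η) : ∃ x, 0 < x ∧ c * x ≤ η := by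
  refine ⟨η / (c + 1), ENNReal.div_pos hη.ne' (by simp [hc]), ?_⟩
  calc c * (η / (c + 1)) ≤ (c + 1) * (η / (c + 1)) := by gcongr; exact le_self_add
    _ ≤ η := ENNReal.mul_div_le

@[fun_prop]
lemma Measurable.PA' {f : R3 → ℝ} (hf : Measurable f) (v : R3) : Measurable (PA f v) := by unfold PA; fun_prop
@[fun_prop]
lemma Measurable.PL' {f : R3 → ℝ} (hf : Measurable f) (v : R3) : Measurable (PL f v) := by unfold PL; fun_prop

section
variable {γ : ℝ} {b : ℝ → ℝ} {f g : R3 → ℝ}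

lemma Uf.PA_nn (hf : Uf f) (v : R3) (p) : 0 ≤ PA f v p :=
  mul_nonneg (mul_nonneg (hf.nn _) (hf.nn _)) (by linarith [hf.le1 p.1])
lemma Uf.PL_nn (hf : Uf f) (v : R3) (p) : 0 ≤ PL f v p :=
  mul_nonneg (mul_nonneg (hf.nn _) (by linarith [hf.le1 (vOut v p.1 p.2)])) (by linarith [hf.le1 (vOutStar v p.1 p.2)])

lemma N2_add (hf : Uf f) (hg : Uf g) : N2 (fun x => ENNReal.ofReal (f x + g x)) =
    N2 (fun x => ENNReal.ofReal (f x)) + N2 (fun x => ENNReal.ofReal (g x)) := by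
  have := hf.meas
  unfold N2
  rw [← lintegral_add_left (by fun_prop)]
  apply lintegral_congr; intro x
  simp only
  rw [ENNReal.ofReal_add (hf.nn x) (hg.nn x), add_mul]

lemma diff_small (h0 : 0 < γ) (h2 : γ ≤ 2) (hb : GradCutoff b) (v : R3) {E η : ℝ≥0∞} (hE : E ≠ ⊤) (hη : 0 < η) :
    ∃ δ : ℝ≥0∞, 0 < δ ∧ ∀ f g : R3 → ℝ, Uf f → Uf g → N2 (fun x => ENNReal.ofReal (f x)) ≤ E → N2 (fun x => ENNReal.ofReal (g x)) ≤ E →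
      N2 (fun x => ENNReal.ofReal |f x - g x|) ≤ δ → JJ γ b v (fun p => ENNReal.ofReal |PA f v p - PA g v p|) ≤ η ∧
      JJ γ b v (fun p => ENNReal.ofReal |PL f v p - PL g v p|) ≤ η := by
  have hη2 : 0 < η / 2 := ENNReal.half_pos hη.ne'
  set q := ENNReal.ofReal (2 * (1 + ‖v‖ ^ 2))
  obtain ⟨x, hx, hx'⟩ := enn_small_mul (c := 6 * (q * (E + E))) (by finiteness) hη2
  obtain ⟨ε, hε0, hε, hL⟩ := Lb_graz_small hb hx
  obtain ⟨δ, hδ, hδ'⟩ := enn_small_mul (c := 3 * ENNReal.ofReal (ε⁻¹ ^ 5) * (Lb b (fun _ => 1) * q)) (by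
    have := Lb_one_fin hb
    finiteness) hη2
  refine ⟨δ, hδ, ?_⟩
  intro f g hf hg hfE hgE hfg
  have hfm := hf.meas
  have hgm := hg.meas
  have main : 6 * (Lb b (graz ε) * WI γ v (fun x => ENNReal.ofReal (f x + g x)))
      + 3 * ENNReal.ofReal (ε⁻¹ ^ 5) * (Lb b (fun _ => 1) * WI γ v (fun x => ENNReal.ofReal |f x - g x|)) ≤ η := by
    rw [← ENNReal.add_halves η]
    apply add_le_add
    · refine le_trans ?_ hx'
      calc _ ≤ 6 * (x * (q * N2 (fun x => ENNReal.ofReal (f x + g x)))) := by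
            gcongr
            exact WI_le h0 h2 v _ (by fun_prop)
        _ ≤ 6 * (x * (q * (E + E))) := by
            rw [N2_add hf hg]; gcongr
        _ = _ := by ring
    · refine le_trans ?_ hδ'
      calc _ ≤ 3 * ENNReal.ofReal (ε⁻¹ ^ 5) * (Lb b (fun _ => 1) * (q * δ)) := by
            gcongr
            exact (WI_le h0 h2 v _ (by fun_prop)).trans (by gcongr)
        _ = _ := by ring
  exact ⟨(diffA h0 h2 hb hε0 hε hf hg v).trans main, (diffL h0 h2 hb hε0 hε hf hg v).trans main⟩

lemma AA_fin (h0 : 0 < γ) (h2 : γ ≤ 2) (hb : GradCutoff b) (hf : Uf f) (hE : N2 (fun x => ENNReal.ofReal (f x)) ≠ ⊤) (v : R3) :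
    AA γ b f v ≠ ⊤ ∧ LL γ b f v ≠ ⊤ := by
  have hm := hf.meas
  have hw : WI γ v (fun x => ENNReal.ofReal (f x)) ≠ ⊤ :=
    ne_top_of_le_ne_top (by finiteness) (WI_le h0 h2 v _ (by fun_prop))
  have h1 := diffA (ε := 1/4) h0 h2 hb (by norm_num) le_rfl hf Uf.zero v
  have h3 := diffL (ε := 1/4) h0 h2 hb (by norm_num) le_rfl hf Uf.zero v
  have e1 : ∀ p, ENNReal.ofReal |PA f v p - PA (fun _ => 0) v p| = ENNReal.ofReal (PA f v p) := by
    intro p; rw [show PA (fun _ => 0) v p = 0 by simp [PA], sub_zero, abs_of_nonneg (hf.PA_nn v p)]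
  have e2 : ∀ p, ENNReal.ofReal |PL f v p - PL (fun _ => 0) v p| = ENNReal.ofReal (PL f v p) := by
    intro p; rw [show PL (fun _ => 0) v p = 0 by simp [PL], sub_zero, abs_of_nonneg (hf.PL_nn v p)]
  have e3 : ∀ x, ENNReal.ofReal |f x - 0| = ENNReal.ofReal (f x) := by
    intro x; rw [sub_zero, abs_of_nonneg (hf.nn x)]
  simp only [e1, e2, e3, add_zero] at h1 h3
  have c1 := Lb_one_fin hb
  have c2 := Lb_fin hb (graz_le (1/4))
  exact ⟨ne_top_of_le_ne_top (by finiteness) h1, ne_top_of_le_ne_top (by finiteness) h3⟩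

lemma JJ_sub {v : R3} (hb : GradCutoff b) {P P' : R3 × S2 → ℝ} (hP : Measurable P) (hP' : Measurable P') :
    JJ γ b v (fun p => ENNReal.ofReal (P p)) ≤ JJ γ b v (fun p => ENNReal.ofReal (P' p)) + JJ γ b v (fun p => ENNReal.ofReal |P p - P' p|) := by
  rw [← JJ_add hb (by fun_prop)]
  apply JJ_mono; intro p
  refine le_trans ?_ ENNReal.ofReal_add_le
  apply ENNReal.ofReal_le_ofReal
  linarith [le_abs_self (P p - P' p)]

lemma JJ_sub_abs {v : R3} (hb : GradCutoff b) {P P' : R3 × S2 → ℝ} (hP : Measurable P) (hP' : Measurable P')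
    (hf : JJ γ b v (fun p => ENNReal.ofReal (P p)) ≠ ⊤) (hf' : JJ γ b v (fun p => ENNReal.ofReal (P' p)) ≠ ⊤) {η : ℝ}
    (hη : 0 ≤ η) (h : JJ γ b v (fun p => ENNReal.ofReal |P p - P' p|) ≤ ENNReal.ofReal η) :
    |(JJ γ b v (fun p => ENNReal.ofReal (P p))).toReal - (JJ γ b v (fun p => ENNReal.ofReal (P' p))).toReal| ≤ η := by
  have h1 := (JJ_sub (γ := γ) (v := v) hb hP hP').trans (add_le_add_right h _)
  have h' : JJ γ b v (fun p => ENNReal.ofReal |P' p - P p|) ≤ ENNReal.ofReal η := by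
    simpa only [abs_sub_comm] using h
  have h2 := (JJ_sub (γ := γ) (v := v) hb hP' hP).trans (add_le_add_right h' _)
  have g1 := ENNReal.toReal_mono (by finiteness) h1
  have g2 := ENNReal.toReal_mono (by finiteness) h2
  rw [ENNReal.toReal_add (by finiteness) (by finiteness), ENNReal.toReal_ofReal hη] at g1 g2
  rw [abs_le]; constructor <;> linarith

lemma Bint {v : R3} (hb : GradCutoff b) {P : R3 × S2 → ℝ} (hP : Measurable P) (hn : ∀ p, 0 ≤ P p)
    (hf : JJ γ b v (fun p => ENNReal.ofReal (P p)) ≠ ⊤) :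
    Integrable (fun p => Bker γ b v p.1 p.2 * P p) PM ∧
    ∫ p, Bker γ b v p.1 p.2 * P p ∂PM = (JJ γ b v (fun p => ENNReal.ofReal (P p))).toReal := by
  have hm := hb.measurable
  have e : ∀ p : R3 × S2, ENNReal.ofReal (Bker γ b v p.1 p.2 * P p) = ENNReal.ofReal (Bker γ b v p.1 p.2) * ENNReal.ofReal (P p) :=
    fun p => ENNReal.ofReal_mul (Bker_nonneg hb _ _ _)
  have nn : ∀ p : R3 × S2, 0 ≤ Bker γ b v p.1 p.2 * P p := fun p => mul_nonneg (Bker_nonneg hb _ _ _) (hn p)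
  constructor
  · refine ⟨by fun_prop, ?_⟩
    rw [hasFiniteIntegral_iff_ofReal (Filter.Eventually.of_forall nn), lintegral_congr e]
    exact lt_of_le_of_ne le_top hf
  · rw [integral_eq_lintegral_of_nonneg_ae (Filter.Eventually.of_forall nn) (by fun_prop), lintegral_congr e]
    rfl

lemma QFD_eq (h0 : 0 < γ) (h2 : γ ≤ 2) (hb : GradCutoff b) (hf : Uf f) (hE : N2 (fun x => ENNReal.ofReal (f x)) ≠ ⊤) (v : R3) :
    QFD γ b f v = (AA γ b f v).toReal * (1 - f v) - f v * (LL γ b f v).toReal := by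
  have hm := hf.meas
  obtain ⟨a1, a2⟩ := AA_fin h0 h2 hb hf hE v
  obtain ⟨i1, j1⟩ := Bint hb (by fun_prop) (hf.PA_nn v) a1
  obtain ⟨i2, j2⟩ := Bint hb (by fun_prop) (hf.PL_nn v) a2
  unfold QFD AA LL
  rw [← j1, ← j2, mul_comm (∫ p, _ ∂PM), ← integral_const_mul, ← integral_const_mul, ← integral_sub (i1.const_mul _) (i2.const_mul _)]
  unfold PM
  rw [integral_prod]
  · congr 1; funext w; congr 1; funext σ
    simp only [PA, PL]
    ring
  · exact (i1.const_mul _).sub (i2.const_mul _)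

lemma AA_cont (h0 : 0 < γ) (h2 : γ ≤ 2) (hb : GradCutoff b) (v : R3) {F : ℝ → R3 → ℝ} (hF : ∀ t, Uf (F t)) {E : ℝ≥0∞} (hE : E ≠ ⊤)
    (hFE : ∀ t, N2 (fun x => ENNReal.ofReal (F t x)) ≤ E)
    (hc : ∀ t, ∀ δ : ℝ≥0∞, 0 < δ → ∀ᶠ s in nhds t, N2 (fun x => ENNReal.ofReal |F s x - F t x|) ≤ δ) :
    Continuous (fun t => (AA γ b (F t) v).toReal) ∧ Continuous (fun t => (LL γ b (F t) v).toReal) := by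
  have fin := fun t => AA_fin h0 h2 hb (hF t) (ne_top_of_le_ne_top hE (hFE t)) v
  have hm := fun t => (hF t).meas
  have key : ∀ t, ∀ η > 0, ∀ᶠ s in nhds t, |(AA γ b (F s) v).toReal - (AA γ b (F t) v).toReal| < η ∧ |(LL γ b (F s) v).toReal - (LL γ b (F t) v).toReal| < η := by
    intro t η hη
    obtain ⟨δ, hδ, H⟩ := diff_small (η := ENNReal.ofReal (η/2)) h0 h2 hb v hE (by simpa using hη)
    filter_upwards [hc t δ hδ] with s hs
    obtain ⟨H1, H2⟩ := H _ _ (hF s) (hF t) (hFE s) (hFE t) hs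
    have mA := fun t => (hm t).PA' v
    have mL := fun t => (hm t).PL' v
    exact ⟨(JJ_sub_abs hb (mA s) (mA t) (fin s).1 (fin t).1 (by linarith) H1).trans_lt (by linarith),
      (JJ_sub_abs hb (mL s) (mL t) (fin s).2 (fin t).2 (by linarith) H2).trans_lt (by linarith)⟩
  constructor <;> rw [continuous_iff_continuousAt] <;> intro t <;> rw [ContinuousAt, Metric.tendsto_nhds] <;> intro η hη
  · filter_upwards [key t η hη] with s hs using hs.1
  · filter_upwards [key t η hη] with s hs using hs.2
end

lemma mild_ode {a l φ : ℝ → ℝ} {c : ℝ} (ha : Continuous a) (hl : Continuous l) (hφ0 : ∀ t, 0 ≤ φ t) (hφ1 : ∀ t, φ t ≤ 1)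
    (hφ : ∀ t, 0 ≤ t → φ t = c + ∫ τ in (0:ℝ)..t, (a τ * (1 - φ τ) - φ τ * l τ)) (hneg : ∀ t, t ≤ 0 → φ t = φ 0) :
    Continuous φ ∧ ∀ t, 0 < t → HasDerivAt φ (a t * (1 - φ t) - φ t * l t) t := by
  set q : ℝ → ℝ := fun τ => a τ * (1 - φ τ) - φ τ * l τ with hq
  set S : Set ℝ := {t | 0 ≤ t ∧ IntervalIntegrable q volume 0 t} with hS
  have hdown : ∀ t ∈ S, ∀ s, 0 ≤ s → s ≤ t → s ∈ S := by
    intro t ht s hs hst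
    refine ⟨hs, ht.2.mono_set ?_⟩
    rw [uIcc_of_le hs, uIcc_of_le ht.1]
    exact Icc_subset_Icc_right hst
  have hSm : MeasurableSet S := by
    apply Set.OrdConnected.measurableSet
    constructor
    intro x hx y hy z hz
    exact hdown y hy z (hx.1.trans hz.1) hz.2
  have hcS : ∀ t ∈ S, ContinuousOn φ (Icc 0 t) := by
    intro t ht
    have := intervalIntegral.continuousOn_primitive_interval' (a := 0) ht.2 left_mem_uIcc
    rw [uIcc_of_le ht.1] at this
    exact ((continuousOn_const (c := c)).add this).congr (fun s hs => hφ s hs.1)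
  have hcS' : ContinuousOn φ S := by
    intro t ht
    by_cases h : ∃ t' ∈ S, t < t'
    · obtain ⟨t', ht', htt⟩ := h
      have h1 : ContinuousWithinAt φ (Icc 0 t') t := hcS t' ht' t ⟨ht.1, htt.le⟩
      refine h1.mono_of_mem_nhdsWithin ?_
      have : Iio t' ∈ nhds t := Iio_mem_nhds htt
      filter_upwards [mem_nhdsWithin_of_mem_nhds this, self_mem_nhdsWithin] with s hs hs'
      exact ⟨hs'.1, le_of_lt hs⟩
    · push Not at h
      exact (hcS t ht t ⟨ht.1, le_rfl⟩).mono (fun s hs => ⟨hs.1, h s hs⟩)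
  have hm1 : AEStronglyMeasurable φ (volume.restrict (S : Set ℝ)) := hcS'.aestronglyMeasurable hSm
  have hm2 : AEStronglyMeasurable φ (volume.restrict (Ici 0 \ S)) := by
    have : AEStronglyMeasurable (fun _ : ℝ => c) (volume.restrict (Ici 0 \ S)) := aestronglyMeasurable_const
    refine this.congr ?_
    filter_upwards [ae_restrict_mem (measurableSet_Ici.diff hSm)] with t ht
    rw [hφ t ht.1, intervalIntegral.integral_undef, add_zero]
    intro h
    exact ht.2 ⟨ht.1, h⟩
  have hm : AEStronglyMeasurable φ (volume.restrict (Ici 0)) := by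
    have : AEStronglyMeasurable φ (volume.restrict (S ∪ (Ici 0 \ S))) := by
      rw [aestronglyMeasurable_union_iff]; exact ⟨hm1, hm2⟩
    refine this.mono_set ?_
    intro x hx
    by_cases h : x ∈ S
    · exact Or.inl h
    · exact Or.inr ⟨hx, h⟩
  have hIntg : ∀ t, 0 ≤ t → IntervalIntegrable q volume 0 t := by
    intro t ht
    rw [intervalIntegrable_iff_integrableOn_Ioc_of_le ht]
    have hb1 : IntegrableOn (fun τ => |a τ| + |l τ|) (Ioc 0 t) volume :=
      ((ha.abs.add hl.abs).integrableOn_Icc (a := 0) (b := t)).mono_set Ioc_subset_Icc_self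
    refine Integrable.mono' hb1 ?_ ?_
    · have hm' : AEStronglyMeasurable φ (volume.restrict (Ioc 0 t)) := hm.mono_set (fun x hx => hx.1.le)
      exact (ha.aestronglyMeasurable.mul (aestronglyMeasurable_const.sub hm')).sub (hm'.mul hl.aestronglyMeasurable)
    · refine Filter.Eventually.of_forall (fun τ => ?_)
      rw [Real.norm_eq_abs]
      refine (abs_sub _ _).trans ?_
      rw [abs_mul, abs_mul, abs_of_nonneg (hφ0 τ), abs_of_nonneg (show 0 ≤ 1 - φ τ by linarith [hφ1 τ])]
      have := hφ0 τ
      have := hφ1 τ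
      have := abs_nonneg (a τ)
      have := abs_nonneg (l τ)
      nlinarith
  have hcon : ContinuousOn φ (Ici 0) := by
    refine hcS'.mono (fun t ht => ⟨ht, hIntg t ht⟩)
  have hcont : Continuous φ := by
    have : φ = fun t => φ (max t 0) := by
      funext t
      rcases le_total t 0 with h | h
      · rw [max_eq_right h, hneg t h]
      · rw [max_eq_left h]
    rw [this]
    exact hcon.comp_continuous (by fun_prop) (fun x => mem_Ici.2 (le_max_right _ _))
  refine ⟨hcont, ?_⟩
  intro t ht
  have hqc : Continuous q := by fun_prop
  have h1 : HasDerivAt (fun s => c + ∫ τ in (0:ℝ)..s, q τ) (q t) t :=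
    (intervalIntegral.integral_hasDerivAt_right (hIntg t ht.le) (hqc.stronglyMeasurableAtFilter _ _) hqc.continuousAt).const_add c
  refine h1.congr_of_eventuallyEq ?_
  filter_upwards [Ioi_mem_nhds ht] with s hs using hφ s (le_of_lt hs)

/-- cleaned-up solution -/
structure Cl (γ : ℝ) (b : ℝ → ℝ) (Z : Set R3) (f : ℝ → R3 → ℝ) (M E : ℝ≥0∞) : Prop where
  h0 : 0 < γ
  h2 : γ ≤ 2
  hb : GradCutoff b
  Zm : MeasurableSet Z
  Z0 : volume Z = 0
  uf : ∀ t, Uf (f t)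
  zero : ∀ t, ∀ v ∈ Z, f t v = 0
  mass : ∀ t, ∫⁻ v, ENNReal.ofReal (f t v) = M
  energy : ∀ t, N2 (fun v => ENNReal.ofReal (f t v)) = E
  Efin : E ≠ ⊤
  cont : ∀ v, Continuous (fun t => f t v)
  deriv : ∀ v, v ∉ Z → ∀ t, 0 < t → HasDerivAt (fun s => f s v)
    ((AA γ b (f t) v).toReal * (1 - f t v) - f t v * (LL γ b (f t) v).toReal) t

lemma AA_congr {γ : ℝ} {b : ℝ → ℝ} {Z : Set R3} (hZ : MeasurableSet Z) (h0 : volume Z = 0) {f g : R3 → ℝ} (h : ∀ v, v ∉ Z → f v = g v)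
    {v : R3} (hv : v ∉ Z) : AA γ b f v = AA γ b g v ∧ LL γ b f v = LL γ b g v := by
  have h1 := null_coll hZ h0 hv
  have h2 : ∀ᵐ p : R3 × S2 ∂PM, p.1 ∉ Z := by
    have : ∀ᵐ w : R3, w ∉ Z := measure_eq_zero_iff_ae_notMem.1 h0
    exact Measure.quasiMeasurePreserving_fst.ae this
  constructor
  · apply lintegral_congr_ae
    filter_upwards [h1, h2] with p hp hp'
    simp only [PA, h _ hp.1, h _ hp.2, h _ hp']
  · apply lintegral_congr_ae
    filter_upwards [h1, h2] with p hp hp'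
    simp only [PL, h _ hp.1, h _ hp.2, h _ hp']

lemma N2_wnorm {h : R3 → ℝ} (hh : MemL1s 2 h) : N2 (fun x => ENNReal.ofReal |h x|) = ENNReal.ofReal (wnorm 2 h) := by
  have e : ∀ v : R3, |h v| * (1 + ‖v‖ ^ 2) ^ ((2:ℝ) / 2) = |h v| * (1 + ‖v‖ ^ 2) := by
    intro v; rw [div_self two_ne_zero, Real.rpow_one]
  unfold MemL1s at hh
  unfold wnorm N2
  simp only [e] at hh ⊢
  rw [ofReal_integral_eq_lintegral_ofReal hh (Filter.Eventually.of_forall (fun v => by positivity))]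
  apply lintegral_congr; intro v
  rw [ENNReal.ofReal_mul (abs_nonneg _)]

lemma clean_exists {γ : ℝ} (h0 : 0 < γ) (h2 : γ ≤ 2) {b : ℝ → ℝ} (hb : GradCutoff b) {f₀ : R3 → ℝ} {f : ℝ → R3 → ℝ}
    (hf : IsFDSolution γ b f₀ f) {N : Set R3} (hN : volume N = 0) : ∃ Z g M E, Cl γ b Z g M E ∧ (∀ t, 0 ≤ t → ∀ v, v ∉ Z → g t v = f t v) ∧
      (∀ v, v ∉ Z → g 0 v = f₀ v) ∧ ∀ v, v ∉ Z → v ∉ N := by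
  obtain ⟨Z₁, hZ1, hmild⟩ := hf.mild
  obtain ⟨Z₀, hZ₀⟩ : ∃ Z₀, Z₀ = Z₁ ∪ N := ⟨_, rfl⟩
  have hZ0 : volume Z₀ = 0 := by rw [hZ₀]; exact measure_union_null hZ1 hN
  replace hmild := fun t ht v (hv : v ∉ Z₀) => hmild t ht v (fun h => hv (by rw [hZ₀]; exact Or.inl h))
  set Z := toMeasurable volume Z₀ with hZd
  have hZm : MeasurableSet Z := measurableSet_toMeasurable _ _
  have hZ : volume Z = 0 := by rw [hZd, measure_toMeasurable, hZ0]
  have hsub : ∀ v, v ∉ Z → v ∉ Z₀ := fun v hv h => hv (subset_toMeasurable _ _ h)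
  set F : ℝ → R3 → ℝ := fun t => f (max t 0) with hF
  set g : ℝ → R3 → ℝ := fun t v => Zᶜ.indicator (F t) v with hg
  have mx : ∀ t : ℝ, 0 ≤ max t 0 := fun t => le_max_right _ _
  have ufF : ∀ t, Uf (F t) := fun t => ⟨hf.measurable _, hf.nonneg _ (mx t), hf.le_one _ (mx t)⟩
  have gout : ∀ t v, v ∉ Z → g t v = F t v := fun t v hv => indicator_of_mem (show v ∈ Zᶜ from hv) _
  have gin : ∀ t v, v ∈ Z → g t v = 0 := fun t v hv => indicator_of_notMem (show v ∉ Zᶜ from fun h => h hv) _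
  have aeg : ∀ t, ∀ᵐ v, g t v = F t v := by
    intro t
    filter_upwards [measure_eq_zero_iff_ae_notMem.1 hZ] with v hv using gout t v hv
  have ufg : ∀ t, Uf (g t) := by
    intro t
    refine ⟨(ufF t).meas.indicator hZm.compl, fun v => ?_, fun v => ?_⟩
    · by_cases hv : v ∈ Z
      · rw [gin t v hv]
      · rw [gout t v hv]; exact (ufF t).nn v
    · by_cases hv : v ∈ Z
      · rw [gin t v hv]; exact zero_le_one
      · rw [gout t v hv]; exact (ufF t).le1 v
  have memF : ∀ t, MemL1s 2 (F t) := fun t => hf.memL12 _ (mx t)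
  have memsub : ∀ s t, MemL1s 2 (fun v => F s v - F t v) := by
    intro s t
    have m1 := (ufF s).meas
    have m2 := (ufF t).meas
    unfold MemL1s
    refine Integrable.mono' ((memF s).add (memF t)) (by fun_prop) (Filter.Eventually.of_forall (fun v => ?_))
    rw [Real.norm_of_nonneg (by positivity), Pi.add_apply, ← add_mul]
    gcongr
    exact abs_sub _ _
  have integ : ∀ t, Integrable (fun v => F t v * (1 + ‖v‖ ^ 2)) := by
    intro t
    refine (memF t).congr (Filter.Eventually.of_forall (fun v => ?_))
    simp only
    rw [div_self two_ne_zero, Real.rpow_one, abs_of_nonneg ((ufF t).nn v)]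
  have integ1 : ∀ t, Integrable (fun v => F t v) := by
    intro t
    have m1 := (ufF t).meas
    refine Integrable.mono' (integ t) (by fun_prop) (Filter.Eventually.of_forall (fun v => ?_))
    rw [Real.norm_of_nonneg ((ufF t).nn v)]
    nlinarith [mul_nonneg ((ufF t).nn v) (sq_nonneg ‖v‖)]
  have integ2 : ∀ t, Integrable (fun v => F t v * ‖v‖ ^ 2) := by
    intro t
    have m1 := (ufF t).meas
    refine Integrable.mono' (integ t) (by fun_prop) (Filter.Eventually.of_forall (fun v => ?_))
    rw [Real.norm_of_nonneg (mul_nonneg ((ufF t).nn v) (by positivity))]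
    nlinarith [(ufF t).nn v]
  have massF : ∀ t, ∫⁻ v, ENNReal.ofReal (F t v) = ENNReal.ofReal (∫ v, f₀ v) := by
    intro t
    rw [← hf.mass _ (mx t), ofReal_integral_eq_lintegral_ofReal (integ1 t) (Filter.Eventually.of_forall (ufF t).nn)]
  have N2F : ∀ t, N2 (fun v => ENNReal.ofReal (F t v)) = ENNReal.ofReal ((∫ v, f₀ v) + ∫ v, f₀ v * ‖v‖ ^ 2) := by
    intro t
    rw [← hf.mass _ (mx t), ← hf.energy _ (mx t), ← integral_add (integ1 t) (integ2 t), ofReal_integral_eq_lintegral_ofReal (f := fun v => F t v + F t v * ‖v‖ ^ 2) ((integ1 t).add (integ2 t))]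
    · unfold N2
      apply lintegral_congr; intro v
      rw [← ENNReal.ofReal_mul ((ufF t).nn v)]
      congr 1
      simp only [hF]
      ring
    · exact Filter.Eventually.of_forall (fun v => add_nonneg ((ufF t).nn v) (mul_nonneg ((ufF t).nn v) (by positivity)))
  have N2fin : ∀ t, N2 (fun v => ENNReal.ofReal (F t v)) ≠ ⊤ := fun t => by rw [N2F]; exact ENNReal.ofReal_ne_top
  have hc : ∀ t, ∀ δ : ℝ≥0∞, 0 < δ → ∀ᶠ s in nhds t, N2 (fun x => ENNReal.ofReal |F s x - F t x|) ≤ δ := by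
    intro t δ hδ
    obtain ⟨δ', hδ', hδ''⟩ : ∃ δ' : ℝ, 0 < δ' ∧ ENNReal.ofReal δ' ≤ δ := by
      by_cases h : δ = ⊤
      · exact ⟨1, one_pos, by rw [h]; exact le_top⟩
      · exact ⟨δ.toReal, ENNReal.toReal_pos hδ.ne' h, (ENNReal.ofReal_toReal h).le⟩
    obtain ⟨r, hr, H⟩ := hf.contL12 (max t 0) (mx t) δ' hδ'
    filter_upwards [Metric.ball_mem_nhds t hr] with s hs
    have hs : |s - t| < r := hs
    have := H (max s 0) (mx s) (lt_of_le_of_lt (abs_max_sub_max_le_abs s t 0) hs)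
    rw [N2_wnorm (memsub s t)]
    exact (ENNReal.ofReal_le_ofReal this.le).trans hδ''
  have hode : ∀ v, v ∉ Z → Continuous (fun t => F t v) ∧ ∀ t, 0 < t → HasDerivAt (fun s => F s v)
    ((AA γ b (F t) v).toReal * (1 - F t v) - F t v * (LL γ b (F t) v).toReal) t := by
    intro v hv
    obtain ⟨c1, c2⟩ := AA_cont h0 h2 hb v ufF (E := ENNReal.ofReal ((∫ v, f₀ v) + ∫ v, f₀ v * ‖v‖ ^ 2)) ENNReal.ofReal_ne_top (fun t => (N2F t).le) hc
    refine mild_ode (c := f₀ v) c1 c2 (fun t => (ufF t).nn v) (fun t => (ufF t).le1 v) ?_ ?_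
    · intro t ht
      have := hmild t ht v (hsub v hv)
      simp only [hF]
      rw [max_eq_left ht, this]
      congr 1
      apply intervalIntegral.integral_congr
      intro τ hτ
      rw [uIcc_of_le ht] at hτ
      have := QFD_eq h0 h2 hb (ufF τ) (N2fin τ) v
      simp only [hF, max_eq_left hτ.1] at this ⊢
      exact this
    · intro t ht
      simp only [hF, max_eq_right ht, max_self]
  refine ⟨Z, g, ENNReal.ofReal (∫ v, f₀ v), ENNReal.ofReal ((∫ v, f₀ v) + ∫ v, f₀ v * ‖v‖ ^ 2), ?_, ?_, ?_, ?_⟩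
  · refine ⟨h0, h2, hb, hZm, hZ, ufg, gin, ?_, ?_, ENNReal.ofReal_ne_top, ?_, ?_⟩
    · intro t
      rw [← massF t]
      apply lintegral_congr_ae
      filter_upwards [aeg t] with v hv
      rw [hv]
    · intro t
      rw [← N2F t]
      apply lintegral_congr_ae
      filter_upwards [aeg t] with v hv
      rw [hv]
    · intro v
      by_cases hv : v ∈ Z
      · simp only [gin _ v hv]; exact continuous_const
      · simp only [gout _ v hv]; exact (hode v hv).1
    · intro v hv t ht
      have := (hode v hv).2 t ht
      obtain ⟨e1, e2⟩ := AA_congr (γ := γ) (b := b) hZm hZ (gout t) hv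
      rw [e1, e2]
      simp only [gout _ v hv]
      exact this
  · intro t ht v hv
    rw [gout t v hv]; simp only [hF, max_eq_left ht]
  · intro v hv
    rw [gout 0 v hv]; simp only [hF, max_self]
    rw [hmild 0 le_rfl v (hsub v hv)]; simp
  · intro v hv h
    exact hsub v hv (by rw [hZ₀]; exact Or.inr h)

/-- tail indicator -/
def tl (κ : ℝ) (v x : R3) : ℝ≥0∞ := if κ * ‖v‖ ≤ ‖x‖ then 1 else 0

@[fun_prop]
lemma measurable_tl (κ : ℝ) (v : R3) : Measurable (tl κ v) :=
  Measurable.ite (measurableSet_le measurable_const measurable_norm) measurable_const measurable_const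

lemma tl_le (κ : ℝ) (v x : R3) : tl κ v x ≤ 1 := by unfold tl; split_ifs <;> simp

lemma WI_tail {γ : ℝ} (h0 : 0 < γ) (h2 : γ ≤ 2) {κ : ℝ} (hκ : 0 < κ) {v : R3} (hv : 0 < ‖v‖) {F : R3 → ℝ≥0∞} (hF : Measurable F) :
    WI γ v (fun x => F x * tl κ v x) ≤ ENNReal.ofReal (‖v‖ ^ γ * ((1 + κ⁻¹) ^ 2 / ‖v‖ ^ 2)) * N2 F := by
  unfold WI N2
  rw [← lintegral_const_mul _ (by fun_prop)]
  apply lintegral_mono; intro x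
  simp only [tl]
  split_ifs with h
  · rw [mul_one]
    have hx : ‖v‖ ≤ κ⁻¹ * ‖x‖ := by rw [inv_mul_eq_div, le_div_iff₀ hκ]; linarith
    have h1 : ‖x - v‖ ≤ (1 + κ⁻¹) * ‖x‖ := (norm_sub_le x v).trans (by linarith)
    have h3 : 1 ≤ (1 + κ⁻¹) * ‖x‖ / ‖v‖ := by
      rw [le_div_iff₀ hv]; linarith [norm_nonneg x]
    have : ‖x - v‖ ^ γ ≤ ‖v‖ ^ γ * ((1 + κ⁻¹) ^ 2 / ‖v‖ ^ 2) * (1 + ‖x‖ ^ 2) := by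
      calc ‖x - v‖ ^ γ ≤ ((1 + κ⁻¹) * ‖x‖) ^ γ := by gcongr
        _ = (‖v‖ * ((1 + κ⁻¹) * ‖x‖ / ‖v‖)) ^ γ := by congr 1; field_simp
        _ = ‖v‖ ^ γ * ((1 + κ⁻¹) * ‖x‖ / ‖v‖) ^ γ := by rw [Real.mul_rpow hv.le (by positivity)]
        _ ≤ ‖v‖ ^ γ * ((1 + κ⁻¹) * ‖x‖ / ‖v‖) ^ (2:ℝ) := by gcongr
        _ = ‖v‖ ^ γ * ((1 + κ⁻¹) ^ 2 / ‖v‖ ^ 2) * ‖x‖ ^ 2 := by rw [Real.rpow_two]; ring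
        _ ≤ _ := by gcongr; linarith
    calc F x * ENNReal.ofReal (‖x - v‖ ^ γ) ≤ F x * ENNReal.ofReal (‖v‖ ^ γ * ((1 + κ⁻¹) ^ 2 / ‖v‖ ^ 2) * (1 + ‖x‖ ^ 2)) := by gcongr
      _ = _ := by rw [ENNReal.ofReal_mul (by positivity)]; ring
  · simp

lemma WI_big {γ : ℝ} (h0 : 0 < γ) (h2 : γ ≤ 2) {v : R3} (hv : 1 ≤ ‖v‖) {F : R3 → ℝ≥0∞} (hF : Measurable F) :
    WI γ v F ≤ ENNReal.ofReal (2 * ‖v‖ ^ γ) * N2 F := by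
  unfold WI N2
  rw [← lintegral_const_mul _ (by fun_prop)]
  apply lintegral_mono; intro x
  simp only
  have h1 : ‖x - v‖ ≤ ‖v‖ * (1 + ‖x‖) := (norm_sub_le x v).trans (by nlinarith [norm_nonneg x])
  have : ‖x - v‖ ^ γ ≤ 2 * ‖v‖ ^ γ * (1 + ‖x‖ ^ 2) := by
    calc ‖x - v‖ ^ γ ≤ (‖v‖ * (1 + ‖x‖)) ^ γ := by gcongr
      _ = ‖v‖ ^ γ * (1 + ‖x‖) ^ γ := by rw [Real.mul_rpow (by positivity) (by positivity)]
      _ ≤ ‖v‖ ^ γ * (1 + ‖x‖) ^ (2:ℝ) := by gcongr; linarith [norm_nonneg x]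
      _ = ‖v‖ ^ γ * (1 + ‖x‖) ^ 2 := by rw [Real.rpow_two]
      _ ≤ ‖v‖ ^ γ * (2 * (1 + ‖x‖ ^ 2)) := by gcongr; nlinarith [sq_nonneg (‖x‖ - 1)]
      _ = _ := by ring
  calc F x * ENNReal.ofReal (‖x - v‖ ^ γ) ≤ F x * ENNReal.ofReal (2 * ‖v‖ ^ γ * (1 + ‖x‖ ^ 2)) := by gcongr
      _ = _ := by rw [ENNReal.ofReal_mul (by positivity)]; ring

lemma WI_lower {γ : ℝ} (h0 : 0 < γ) {v : R3} (hv : 0 < ‖v‖) {F : R3 → ℝ≥0∞} (hF : Measurable F) :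
    ENNReal.ofReal ((‖v‖ / 2) ^ γ) * ∫⁻ x, F x ≤ WI γ v F + ENNReal.ofReal ((‖v‖ / 2) ^ γ) * (ENNReal.ofReal (4 / ‖v‖ ^ 2) * N2 F) := by
  unfold WI N2
  rw [← lintegral_const_mul _ (by fun_prop), ← lintegral_const_mul _ (by fun_prop), ← lintegral_const_mul _ (by fun_prop), ← lintegral_add_left (by fun_prop)]
  apply lintegral_mono; intro x
  simp only
  rcases le_total ‖x‖ (‖v‖/2) with h | h
  · refine le_trans ?_ le_self_add
    rw [mul_comm]
    gcongr
    have := norm_sub_norm_le v x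
    rw [norm_sub_rev] at this
    linarith
  · refine le_trans ?_ le_add_self
    gcongr
    calc F x = F x * 1 := (mul_one _).symm
      _ ≤ F x * ENNReal.ofReal (4 / ‖v‖ ^ 2 * (1 + ‖x‖ ^ 2)) := by
          gcongr
          rw [ENNReal.one_le_ofReal, div_mul_eq_mul_div, le_div_iff₀ (by positivity)]
          nlinarith
      _ = _ := by rw [ENNReal.ofReal_mul (by positivity)]; ring

/-- geometric fact -/
lemma far_X {v w : R3} {σ : S2} {ε : ℝ} (hε0 : 0 < ε) (hε : ε ≤ 1/4) (hv : 0 < ‖v‖) (hc : ε < ch (cosAngle v w σ)) :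
    ε/4 * ‖v‖ ≤ ‖w‖ ∨ ε/4 * ‖v‖ ≤ ‖vOut v w σ‖ := by
  by_contra hcon
  push Not at hcon
  obtain ⟨h1, h2⟩ := hcon
  have e1 : vOut v w σ - w = -(vOutStar v w σ - v) := by
    rw [eq_sub_of_add_eq (vOut_add v w σ)]; abel
  have e2 : ‖vOut v w σ - w‖ = ch (cosAngle v w σ) * ‖v - w‖ := by rw [e1, norm_neg, vOutStar_sub]
  have e3 := norm_sub_le (vOut v w σ) w
  have e4 := norm_sub_norm_le v w
  have e5 : ε * ‖v - w‖ ≤ ch (cosAngle v w σ) * ‖v - w‖ := by gcongr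
  nlinarith [mul_pos hε0 hv, mul_pos hε0 (mul_pos hε0 hv)]

lemma far_Y {v w : R3} {σ : S2} {ε : ℝ} (hε0 : 0 < ε) (hε : ε ≤ 1/4) (hv : 0 < ‖v‖) (hc : ε < sh (cosAngle v w σ)) :
    ε/4 * ‖v‖ ≤ ‖w‖ ∨ ε/4 * ‖v‖ ≤ ‖vOutStar v w σ‖ := by
  by_contra hcon
  push Not at hcon
  obtain ⟨h1, h2⟩ := hcon
  have e1 : vOutStar v w σ - w = -(vOut v w σ - v) := by
    rw [eq_sub_of_add_eq' (vOut_add v w σ)]; abel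
  have e2 : ‖vOutStar v w σ - w‖ = sh (cosAngle v w σ) * ‖v - w‖ := by rw [e1, norm_neg, vOut_sub]
  have e3 := norm_sub_le (vOutStar v w σ) w
  have e4 := norm_sub_norm_le v w
  have e5 : ε * ‖v - w‖ ≤ sh (cosAngle v w σ) * ‖v - w‖ := by gcongr
  nlinarith [mul_pos hε0 hv, mul_pos hε0 (mul_pos hε0 hv)]

lemma loss_pre {γ : ℝ} (h0 : 0 < γ) (h2 : γ ≤ 2) {b : ℝ → ℝ} (hb : GradCutoff b) {ε : ℝ} (hε0 : 0 < ε) (hε : ε ≤ 1/4) {f : R3 → ℝ} (hf : Uf f)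
    {v : R3} (hv : 0 < ‖v‖) :
    Lb b (ngraz ε) * WI γ v (fun x => ENNReal.ofReal (f x)) ≤ LL γ b f v +
      (2 + 2 * ENNReal.ofReal (ε⁻¹ ^ 5)) * (Lb b (fun _ => 1) * WI γ v (fun x => ENNReal.ofReal (f x) * tl (ε/4) v x)) := by
  have hm := hb.measurable
  have hfm := hf.meas
  set e := ENNReal.ofReal (ε⁻¹ ^ 5)
  set G : R3 → ℝ≥0∞ := fun x => ENNReal.ofReal (f x) * tl (ε/4) v x with hG
  have hGm : Measurable G := by fun_prop
  rw [← carlJW h0 hb (measurable_ngraz ε) (F := fun x => ENNReal.ofReal (f x)) (by fun_prop) v]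
  have a4 := carlJX h0 h2 hb (χ := fun _ => 1) (by fun_prop) (fun _ => le_rfl) hGm v
  have a5 := carlJY h0 h2 hb (χ := fun _ => 1) (by fun_prop) (fun _ => le_rfl) hGm v
  have a6 := (carlJW h0 hb (χ := fun _ => 1) (by fun_prop) hGm v).le
  have key : ∀ p : R3 × S2, ngraz ε (cosAngle v p.1 p.2) * ENNReal.ofReal (f p.1) ≤ ENNReal.ofReal (PL f v p) +
    (2 * (1 * G p.1) + (e * (1 * ENNReal.ofReal (sh (cosAngle v p.1 p.2) ^ 5) * G (vOut v p.1 p.2)) +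
      e * (1 * ENNReal.ofReal (ch (cosAngle v p.1 p.2) ^ 5) * G (vOutStar v p.1 p.2)))) := by
    intro p
    unfold ngraz
    split_ifs with hg
    · simp
    push Not at hg
    have aux : ∀ y, ε < y → 1 ≤ e * (1 * ENNReal.ofReal (y ^ 5)) := by
      intro y hy
      rw [one_mul, ← ENNReal.ofReal_mul (by positivity), ENNReal.one_le_ofReal, ← mul_pow]
      apply one_le_pow₀
      rw [inv_mul_eq_div, le_div_iff₀ hε0]; linarith
    have bx : ENNReal.ofReal (f p.1 * f (vOut v p.1 p.2)) ≤ G p.1 + e * (1 * ENNReal.ofReal (sh (cosAngle v p.1 p.2) ^ 5) * G (vOut v p.1 p.2)) := by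
      rcases far_X hε0 hε hv hg.2 with h | h
      · refine le_trans ?_ le_self_add
        simp only [hG, tl, if_pos h, mul_one]
        apply ENNReal.ofReal_le_ofReal
        exact mul_le_of_le_one_right (hf.nn _) (hf.le1 _)
      · refine le_trans ?_ le_add_self
        simp only [hG, tl, if_pos h, mul_one]
        calc _ ≤ 1 * ENNReal.ofReal (f (vOut v p.1 p.2)) := by
              rw [one_mul]
              exact ENNReal.ofReal_le_ofReal (mul_le_of_le_one_left (hf.nn _) (hf.le1 _))
          _ ≤ (e * (1 * ENNReal.ofReal (sh (cosAngle v p.1 p.2) ^ 5))) * ENNReal.ofReal (f (vOut v p.1 p.2)) := by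
              gcongr; exact aux _ hg.1
          _ = _ := by ring
    have byy : ENNReal.ofReal (f p.1 * f (vOutStar v p.1 p.2)) ≤ G p.1 + e * (1 * ENNReal.ofReal (ch (cosAngle v p.1 p.2) ^ 5) * G (vOutStar v p.1 p.2)) := by
      rcases far_Y hε0 hε hv hg.1 with h | h
      · refine le_trans ?_ le_self_add
        simp only [hG, tl, if_pos h, mul_one]
        apply ENNReal.ofReal_le_ofReal
        exact mul_le_of_le_one_right (hf.nn _) (hf.le1 _)
      · refine le_trans ?_ le_add_self
        simp only [hG, tl, if_pos h, mul_one]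
        calc _ ≤ 1 * ENNReal.ofReal (f (vOutStar v p.1 p.2)) := by
              rw [one_mul]
              exact ENNReal.ofReal_le_ofReal (mul_le_of_le_one_left (hf.nn _) (hf.le1 _))
          _ ≤ (e * (1 * ENNReal.ofReal (ch (cosAngle v p.1 p.2) ^ 5))) * ENNReal.ofReal (f (vOutStar v p.1 p.2)) := by
              gcongr; exact aux _ hg.2
          _ = _ := by ring
    calc 1 * ENNReal.ofReal (f p.1) ≤ ENNReal.ofReal (PL f v p + (f p.1 * f (vOut v p.1 p.2) + f p.1 * f (vOutStar v p.1 p.2))) := by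
          rw [one_mul]
          apply ENNReal.ofReal_le_ofReal
          unfold PL
          nlinarith [mul_nonneg (hf.nn p.1) (mul_nonneg (hf.nn (vOut v p.1 p.2)) (hf.nn (vOutStar v p.1 p.2)))]
      _ ≤ ENNReal.ofReal (PL f v p) + (ENNReal.ofReal (f p.1 * f (vOut v p.1 p.2)) + ENNReal.ofReal (f p.1 * f (vOutStar v p.1 p.2))) :=
          ENNReal.ofReal_add_le.trans (by gcongr; exact ENNReal.ofReal_add_le)
      _ ≤ ENNReal.ofReal (PL f v p) + ((G p.1 + e * (1 * ENNReal.ofReal (sh (cosAngle v p.1 p.2) ^ 5) * G (vOut v p.1 p.2))) +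
          (G p.1 + e * (1 * ENNReal.ofReal (ch (cosAngle v p.1 p.2) ^ 5) * G (vOutStar v p.1 p.2)))) := by gcongr
      _ = _ := by ring
  refine (JJ_mono key).trans ?_
  rw [JJ_add hb (by fun_prop), JJ_add hb (by fun_prop), JJ_add hb (by fun_prop)]
  rw [JJ_const_mul hb (by fun_prop) 2, JJ_const_mul hb (by fun_prop) e, JJ_const_mul hb (by fun_prop) e]
  calc _ ≤ LL γ b f v + (2 * (Lb b (fun _ => 1) * WI γ v G) + (e * (Lb b (fun _ => 1) * WI γ v G) + e * (Lb b (fun _ => 1) * WI γ v G))) := by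
        unfold LL; gcongr
    _ = _ := by ring

lemma exists_big {C η : ℝ≥0∞} (hC : C ≠ ⊤) (hη : 0 < η) : ∃ R : ℝ, 1 ≤ R ∧ ∀ r, R ≤ r → C * ENNReal.ofReal (1 / r ^ 2) ≤ η := by
  obtain ⟨x, hx, hx'⟩ := enn_small_mul hC hη
  obtain ⟨y, hy, hy'⟩ : ∃ δ' : ℝ, 0 < δ' ∧ ENNReal.ofReal δ' ≤ x := by
    by_cases h : x = ⊤
    · exact ⟨1, one_pos, by rw [h]; exact le_top⟩
    · exact ⟨x.toReal, ENNReal.toReal_pos hx.ne' h, (ENNReal.ofReal_toReal h).le⟩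
  refine ⟨max 1 y⁻¹, le_max_left _ _, fun r hr => ?_⟩
  refine le_trans ?_ hx'
  gcongr
  refine le_trans (ENNReal.ofReal_le_ofReal ?_) hy'
  have h1 : 1 ≤ r := (le_max_left _ _).trans hr
  have h2 : y⁻¹ ≤ r := (le_max_right _ _).trans hr
  rw [div_le_iff₀ (by positivity)]
  have : 1 ≤ y * r := by
    calc 1 = y * y⁻¹ := by field_simp
      _ ≤ _ := by gcongr
  nlinarith

lemma loss_lower {γ : ℝ} {b : ℝ → ℝ} {Z : Set R3} {f : ℝ → R3 → ℝ} {M E : ℝ≥0∞} (C : Cl γ b Z f M E) (hM : M ≠ 0) :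
    ∃ c₁ R₀ : ℝ, 0 < c₁ ∧ 1 ≤ R₀ ∧ ∀ t v, R₀ ≤ ‖v‖ → ENNReal.ofReal (c₁ * ‖v‖ ^ γ) ≤ LL γ b (f t) v := by
  have hb := C.hb
  have l1 := Lb_one_fin hb
  have hMf : M ≠ ⊤ := by
    refine ne_top_of_le_ne_top C.Efin ?_
    rw [← C.mass 0, ← C.energy 0]
    apply lintegral_mono; intro x
    simp only
    calc ENNReal.ofReal (f 0 x) = ENNReal.ofReal (f 0 x) * 1 := (mul_one _).symm
      _ ≤ _ := by gcongr; rw [ENNReal.one_le_ofReal]; nlinarith [sq_nonneg ‖x‖]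
  obtain ⟨ε, hε0, hε, hL⟩ := Lb_graz_small hb (ENNReal.half_pos (Lb_one_pos hb))
  have hΛ : Lb b (ngraz ε) ≠ 0 := by
    intro h
    have h1 := Lb_split hb ε
    rw [h, add_zero] at h1
    rw [h1] at hL
    exact absurd hL (not_le.2 (ENNReal.half_lt_self (Lb_one_pos hb) l1))
  have hΛf : Lb b (ngraz ε) ≠ ⊤ := Lb_fin hb (ngraz_le ε)
  set Λ := Lb b (ngraz ε)
  set D := Λ * M with hD
  have hD0 : 0 < D := pos_iff_ne_zero.2 (mul_ne_zero hΛ hM)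
  have hDf : D ≠ ⊤ := by finiteness
  set K : ℝ := 4 * (1 + (ε/4)⁻¹) ^ 2
  set e := ENNReal.ofReal (ε⁻¹ ^ 5)
  have hEf := C.Efin
  obtain ⟨R, hR1, hR⟩ := exists_big (C := (2 + 2 * e) * (Lb b (fun _ => 1) * (ENNReal.ofReal K * E)) + Λ * (ENNReal.ofReal 4 * E))
    (by finiteness) (ENNReal.half_pos hD0.ne')
  refine ⟨(D / 2).toReal / 4, R, ?_, hR1, ?_⟩
  · have : 0 < (D/2).toReal := ENNReal.toReal_pos (ENNReal.half_pos hD0.ne').ne' (by finiteness)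
    positivity
  intro t v hv
  have hv0 : 0 < ‖v‖ := by linarith
  have hfm := (C.uf t).meas
  set A := ENNReal.ofReal ((‖v‖ / 2) ^ γ) with hA
  have hAv : ‖v‖ ^ γ ≤ 4 * (‖v‖ / 2) ^ γ := by
    rw [Real.div_rpow hv0.le (by norm_num)]
    have : (2:ℝ) ^ γ ≤ 2 ^ (2:ℝ) := by
      apply Real.rpow_le_rpow_of_exponent_le (by norm_num) C.h2
    rw [Real.rpow_two] at this
    have p2 : 0 < (2:ℝ) ^ γ := by positivity
    rw [mul_div_assoc', le_div_iff₀ p2]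
    have : 0 ≤ ‖v‖ ^ γ := by positivity
    nlinarith
  have w1 := WI_lower C.h0 hv0 (F := fun x => ENNReal.ofReal (f t x)) (by fun_prop)
  have w2 := loss_pre C.h0 C.h2 hb hε0 hε (C.uf t) hv0
  have w3 := WI_tail C.h0 C.h2 (κ := ε/4) (by positivity) hv0 (F := fun x => ENNReal.ofReal (f t x)) (by fun_prop)
  rw [C.mass t] at w1
  rw [C.energy t] at w1 w3
  have w3' : WI γ v (fun x => ENNReal.ofReal (f t x) * tl (ε/4) v x) ≤ A * (ENNReal.ofReal K * ENNReal.ofReal (1 / ‖v‖ ^ 2) * E) := by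
    refine w3.trans ?_
    calc _ ≤ ENNReal.ofReal ((‖v‖ / 2) ^ γ * (K * (1 / ‖v‖ ^ 2))) * E := by
          gcongr ENNReal.ofReal ?_ * E
          calc _ ≤ (4 * (‖v‖ / 2) ^ γ) * ((1 + (ε / 4)⁻¹) ^ 2 / ‖v‖ ^ 2) := by gcongr
            _ = _ := by simp only [K]; ring
      _ = _ := by rw [ENNReal.ofReal_mul (by positivity), ENNReal.ofReal_mul (by positivity)]; ring
  have e4 : ENNReal.ofReal (4 / ‖v‖ ^ 2) = ENNReal.ofReal 4 * ENNReal.ofReal (1 / ‖v‖ ^ 2) := by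
    rw [← ENNReal.ofReal_mul (by norm_num)]; congr 1; ring
  have tot : A * (D / 2) + A * (D / 2) ≤ LL γ b (f t) v + A * (D / 2) := by
    calc A * (D / 2) + A * (D / 2) = A * D := by rw [← mul_add, ENNReal.add_halves]
      _ = Λ * (A * M) := by rw [hD]; ring
      _ ≤ Λ * (WI γ v (fun x => ENNReal.ofReal (f t x)) + A * (ENNReal.ofReal (4 / ‖v‖ ^ 2) * E)) := by gcongr
      _ = Λ * WI γ v (fun x => ENNReal.ofReal (f t x)) + Λ * (A * (ENNReal.ofReal (4 / ‖v‖ ^ 2) * E)) := by ring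
      _ ≤ (LL γ b (f t) v + (2 + 2 * e) * (Lb b (fun _ => 1) * (A * (ENNReal.ofReal K * ENNReal.ofReal (1 / ‖v‖ ^ 2) * E))))
          + Λ * (A * (ENNReal.ofReal (4 / ‖v‖ ^ 2) * E)) := by
            gcongr
            refine w2.trans ?_
            gcongr
      _ = LL γ b (f t) v + A * (((2 + 2 * e) * (Lb b (fun _ => 1) * (ENNReal.ofReal K * E)) + Λ * (ENNReal.ofReal 4 * E)) * ENNReal.ofReal (1 / ‖v‖ ^ 2)) := by
            rw [e4]; ring
      _ ≤ _ := by gcongr; exact hR _ hv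
  have hfin : A * (D / 2) ≠ ⊤ := by finiteness
  have := (ENNReal.add_le_add_iff_right hfin).1 tot
  refine le_trans ?_ this
  rw [hA, ← ENNReal.ofReal_toReal (show D / 2 ≠ ⊤ by finiteness), ← ENNReal.ofReal_mul (by positivity), ENNReal.toReal_ofReal (by positivity)]
  apply ENNReal.ofReal_le_ofReal
  nlinarith [show 0 ≤ (D/2).toReal by positivity]

lemma barrier {φ φ' : ℝ → ℝ} {T μ : ℝ} (hc : Continuous φ) (hd : ∀ t, 0 < t → HasDerivAt φ (φ' t) t) (h0 : φ 0 ≤ μ)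
    (hn : ∀ t, 0 < t → t ≤ T → μ < φ t → φ' t ≤ 0) {t : ℝ} (ht0 : 0 ≤ t) (ht : t ≤ T) : φ t ≤ μ := by
  by_contra hcon
  push Not at hcon
  have hcomp : IsCompact (Icc 0 t ∩ {s | φ s ≤ μ}) := isCompact_Icc.inter_right (isClosed_le hc continuous_const)
  obtain ⟨u, hu, hu'⟩ := hcomp.exists_isGreatest ⟨0, ⟨le_rfl, ht0⟩, h0⟩
  have hut : u ≤ t := hu.1.2
  have hu0 : 0 ≤ u := hu.1.1
  have hgt : ∀ s, u < s → s ≤ t → μ < φ s := by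
    intro s hs hst
    by_contra h
    push Not at h
    exact absurd (hu' ⟨⟨hu0.trans hs.le, hst⟩, h⟩) (not_le.2 hs)
  have hanti : AntitoneOn φ (Icc u t) := by
    apply antitoneOn_of_deriv_nonpos (convex_Icc u t) hc.continuousOn
    · intro s hs
      rw [interior_Icc] at hs
      exact (hd s (hu0.trans_lt hs.1)).differentiableAt.differentiableWithinAt
    · intro s hs
      rw [interior_Icc] at hs
      rw [(hd s (hu0.trans_lt hs.1)).deriv]
      exact hn s (hu0.trans_lt hs.1) (hs.2.le.trans ht) (hgt s hs.1 hs.2.le)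
  have := hanti ⟨le_rfl, hut⟩ ⟨hut, le_rfl⟩ hut
  have h3 : φ u ≤ μ := hu.2
  linarith

/-- gain without the Fermi factor -/
def GG (γ : ℝ) (b : ℝ → ℝ) (f : R3 → ℝ) (v : R3) : ℝ≥0∞ :=
  JJ γ b v (fun p => ENNReal.ofReal (f (vOut v p.1 p.2)) * ENNReal.ofReal (f (vOutStar v p.1 p.2)))

lemma AA_le_GG {γ : ℝ} {b : ℝ → ℝ} {f : R3 → ℝ} (hf : Uf f) (v : R3) : AA γ b f v ≤ GG γ b f v := by
  apply JJ_mono; intro p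
  rw [← ENNReal.ofReal_mul (hf.nn _)]
  apply ENNReal.ofReal_le_ofReal
  exact mul_le_of_le_one_right (mul_nonneg (hf.nn _) (hf.nn _)) (by linarith [hf.nn p.1])

lemma ode_bound {γ : ℝ} {b : ℝ → ℝ} {Z : Set R3} {f : ℝ → R3 → ℝ} {M E : ℝ≥0∞} (C : Cl γ b Z f M E) {c₁ : ℝ} (hc₁ : 0 < c₁) {v : R3}
    (hl : ∀ t, ENNReal.ofReal (c₁ * ‖v‖ ^ γ) ≤ LL γ b (f t) v) {T m : ℝ} (hm : 0 ≤ m)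
    (hG : ∀ t, 0 ≤ t → t ≤ T → GG γ b (f t) v ≤ ENNReal.ofReal (c₁ * ‖v‖ ^ γ * m)) {t : ℝ} (ht0 : 0 ≤ t) (ht : t ≤ T) :
    f t v ≤ max (f 0 v) m := by
  by_cases hv : v ∈ Z
  · rw [C.zero t v hv]; exact hm.trans (le_max_right _ _)
  refine barrier (C.cont v) (C.deriv v hv) (le_max_left _ _) ?_ ht0 ht
  intro s hs hsT hgt
  have hf := C.uf s
  obtain ⟨f1, f2⟩ := AA_fin C.h0 C.h2 C.hb hf (by rw [C.energy s]; exact C.Efin) v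
  have a1 : (AA γ b (f s) v).toReal ≤ c₁ * ‖v‖ ^ γ * m := ENNReal.toReal_le_of_le_ofReal (by positivity) ((AA_le_GG hf v).trans (hG s hs.le hsT))
  have a2 : c₁ * ‖v‖ ^ γ ≤ (LL γ b (f s) v).toReal := (ENNReal.ofReal_le_iff_le_toReal f2).1 (hl s)
  have hgm : m < f s v := (le_max_right _ _).trans_lt hgt
  have n1 := hf.nn v
  have n2 := hf.le1 v
  have n3 : 0 ≤ (AA γ b (f s) v).toReal := ENNReal.toReal_nonneg
  have n4 : 0 ≤ c₁ * ‖v‖ ^ γ := by positivity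
  have g1 : f s v * (c₁ * ‖v‖ ^ γ) ≤ f s v * (LL γ b (f s) v).toReal := by gcongr
  nlinarith

/-- triple integral -/
def TI (G : R3 → R3 → S2 → ℝ≥0∞) : ℝ≥0∞ := ∫⁻ v, ∫⁻ w, ∫⁻ σ, G v w σ ∂sphMeasure

lemma TI_prepost {G : R3 → R3 → S2 → ℝ≥0∞} (hG : Measurable (fun p : R3 × R3 × S2 => G p.1 p.2.1 p.2.2)) :
    TI G = TI (fun v w σ => G (vOut v w σ) (vOutStar v w σ) (nrm (v - w))) :=
  prepost (fun p => G p.1 p.2.1 p.2.2) hG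

lemma TI_swap {G : R3 → R3 → S2 → ℝ≥0∞} (hG : Measurable (fun p : R3 × R3 × S2 => G p.1 p.2.1 p.2.2)) :
    TI G = TI (fun v w σ => G w v (-σ)) :=
  swap_lint (fun p => G p.1 p.2.1 p.2.2) hG

lemma TI_mono {G H : R3 → R3 → S2 → ℝ≥0∞} (h : ∀ v w σ, G v w σ ≤ H v w σ) : TI G ≤ TI H :=
  lintegral_mono (fun v => lintegral_mono (fun w => lintegral_mono (fun σ => h v w σ)))

lemma TI_add {G H : R3 → R3 → S2 → ℝ≥0∞} (hG : Measurable (fun p : R3 × R3 × S2 => G p.1 p.2.1 p.2.2)) :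
    TI (fun v w σ => G v w σ + H v w σ) = TI G + TI H := by
  unfold TI
  rw [← lintegral_add_left]
  · apply lintegral_congr; intro v
    rw [← lintegral_add_left]
    · apply lintegral_congr; intro w
      rw [← lintegral_add_left]
      exact hG.comp (g := fun p : R3 × R3 × S2 => G p.1 p.2.1 p.2.2) (f := fun σ => (v, w, σ)) (by fun_prop)
    · apply mlint (f := fun w σ => G v w σ)
      exact hG.comp (g := fun p : R3 × R3 × S2 => G p.1 p.2.1 p.2.2) (f := fun p : R3 × S2 => (v, p.1, p.2)) (by fun_prop)
  · apply mlint (f := fun v w => ∫⁻ σ, G v w σ ∂sphMeasure)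
    apply mlint (f := fun (p : R3 × R3) σ => G p.1 p.2 σ)
    exact hG.comp (g := fun p : R3 × R3 × S2 => G p.1 p.2.1 p.2.2) (f := fun p : (R3 × R3) × S2 => (p.1.1, p.1.2, p.2)) (by fun_prop)

section
variable {γ : ℝ} {b : ℝ → ℝ} {f : R3 → ℝ}

/-- loss density -/
def WD (γ : ℝ) (b : ℝ → ℝ) (f : R3 → ℝ) (v w : R3) (σ : S2) : ℝ≥0∞ :=
  ENNReal.ofReal (Bker γ b v w σ) * ENNReal.ofReal (f v * f w * (1 - f (vOut v w σ)) * (1 - f (vOutStar v w σ)))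

@[fun_prop]
lemma Measurable.WD' {α : Type*} [MeasurableSpace α] {g h : α → R3} {s : α → S2} (hb : Measurable b) (hf : Measurable f) (hg : Measurable g)
    (hh : Measurable h) (hs : Measurable s) : Measurable (fun a => WD γ b f (g a) (h a) (s a)) := by
  unfold WD; fun_prop

lemma WD_swap (v w : R3) (σ : S2) : WD γ b f w v (-σ) = WD γ b f v w σ := by
  unfold WD; rw [Bker_swap, vOut_swap, vOutStar_swap]; congr 2; ring

lemma JJ_TI (hb : Measurable b) {P : R3 → R3 × S2 → ℝ≥0∞} (hP : Measurable (fun p : R3 × R3 × S2 => P p.1 p.2)) :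
    ∫⁻ v, JJ γ b v (P v) = TI (fun v w σ => ENNReal.ofReal (Bker γ b v w σ) * P v (w, σ)) := by
  unfold TI
  apply lintegral_congr; intro v
  unfold JJ
  rw [lint_PM]
  have : Measurable (P v) := hP.comp (g := fun p : R3 × R3 × S2 => P p.1 p.2) (f := fun p => (v, p)) (by fun_prop)
  fun_prop

lemma T1_eq (hb : GradCutoff b) (hf : Uf f) {χ : R3 → ℝ≥0∞} (hχ : Measurable χ) :
    ∫⁻ v, ENNReal.ofReal (f v) * LL γ b f v * χ v = TI (fun v w σ => WD γ b f v w σ * χ v) := by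
  have hm := hf.meas
  have hbm := hb.measurable
  have e : ∀ v, ENNReal.ofReal (f v) * LL γ b f v * χ v = JJ γ b v (fun p => ENNReal.ofReal (f v) * χ v * ENNReal.ofReal (PL f v p)) := by
    intro v
    rw [JJ_const_mul hb (by fun_prop), LL]; ring
  rw [lintegral_congr e, JJ_TI (P := fun v p => ENNReal.ofReal (f v) * χ v * ENNReal.ofReal (PL f v p)) hbm (by unfold PL; fun_prop)]
  congr 1; funext v w σ
  unfold WD PL
  simp only
  rw [show f v * f w * (1 - f (vOut v w σ)) * (1 - f (vOutStar v w σ)) = f v * (f w * (1 - f (vOut v w σ)) * (1 - f (vOutStar v w σ))) by ring,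
    ENNReal.ofReal_mul (hf.nn v)]
  ring

lemma T2_eq (h0 : 0 < γ) (hb : GradCutoff b) (hf : Uf f) {χ : R3 → ℝ≥0∞} (hχ : Measurable χ) :
    ∫⁻ v, ENNReal.ofReal (1 - f v) * AA γ b f v * χ v = TI (fun v w σ => WD γ b f v w σ * χ (vOut v w σ)) := by
  have hm := hf.meas
  have hbm := hb.measurable
  have e : ∀ v, ENNReal.ofReal (1 - f v) * AA γ b f v * χ v = JJ γ b v (fun p => ENNReal.ofReal (1 - f v) * χ v * ENNReal.ofReal (PA f v p)) := by
    intro v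
    rw [JJ_const_mul hb (by fun_prop), AA]; ring
  rw [lintegral_congr e, JJ_TI (P := fun v p => ENNReal.ofReal (1 - f v) * χ v * ENNReal.ofReal (PA f v p)) hbm (by unfold PA; fun_prop)]
  rw [TI_prepost (G := fun v w σ => WD γ b f v w σ * χ (vOut v w σ)) (by fun_prop)]
  congr 1; funext v w σ
  unfold WD PA
  simp only
  by_cases h : v = w
  · have z1 : Bker γ b v w σ = 0 := by simp [Bker, h, Real.zero_rpow h0.ne']
    have z2 : Bker γ b (vOut v w σ) (vOutStar v w σ) (nrm (v - w)) = 0 := by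
      unfold Bker; rw [coll_swap_dist]; simp [h, Real.zero_rpow h0.ne']
    rw [z1, z2]; simp
  · rw [Bker_post h, (vOut_post h σ).1, (vOut_post h σ).2]
    rw [show f (vOut v w σ) * f (vOutStar v w σ) * (1 - f v) * (1 - f w) = (1 - f v) * (f (vOut v w σ) * f (vOutStar v w σ) * (1 - f w)) by ring,
      ENNReal.ofReal_mul (p := 1 - f v) (by linarith [hf.le1 v])]
    ring

lemma weak_form (h0 : 0 < γ) (hb : GradCutoff b) (hf : Uf f) {χ : R3 → ℝ≥0∞} (hχ : Measurable χ) {D : R3 → R3 → ℝ≥0∞}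
    (hD : Measurable (fun p : R3 × R3 => D p.1 p.2))
    (H : ∀ v w σ, χ v + χ w ≤ χ (vOut v w σ) + χ (vOutStar v w σ) + D v w) :
    2 * (∫⁻ v, ENNReal.ofReal (f v) * LL γ b f v * χ v) ≤ 2 * (∫⁻ v, ENNReal.ofReal (1 - f v) * AA γ b f v * χ v) +
      Lb b (fun _ => 1) * ∫⁻ v, ∫⁻ w, ENNReal.ofReal (f v) * ENNReal.ofReal (f w) * D v w * ENNReal.ofReal (‖w - v‖ ^ γ) := by
  have hm := hf.meas
  have hbm := hb.measurable
  rw [T1_eq hb hf hχ, T2_eq h0 hb hf hχ]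
  have s1 : TI (fun v w σ => WD γ b f v w σ * χ v) = TI (fun v w σ => WD γ b f v w σ * χ w) := by
    rw [TI_swap (by fun_prop)]; simp only [WD_swap]
  have s2 : TI (fun v w σ => WD γ b f v w σ * χ (vOut v w σ)) = TI (fun v w σ => WD γ b f v w σ * χ (vOutStar v w σ)) := by
    rw [TI_swap (by fun_prop)]; simp only [WD_swap, vOut_swap]
  have hDm : ∀ {α : Type} [MeasurableSpace α] {g h : α → R3}, Measurable g → Measurable h → Measurable (fun a => D (g a) (h a)) := by
    intro α _ g h hg hh
    exact hD.comp (g := fun p : R3 × R3 => D p.1 p.2) (f := fun a => (g a, h a)) (by fun_prop)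
  have hD3 : Measurable (fun p : R3 × R3 × S2 => D p.1 p.2.1) := hDm (by fun_prop) (by fun_prop)
  have hle : TI (fun v w σ => WD γ b f v w σ * χ v + WD γ b f v w σ * χ w) ≤
     TI (fun v w σ => (WD γ b f v w σ * χ (vOut v w σ) + WD γ b f v w σ * χ (vOutStar v w σ)) +
       ENNReal.ofReal (Bker γ b v w σ) * (ENNReal.ofReal (f v) * (1 * (ENNReal.ofReal (f w) * D v w)))) := by
    apply TI_mono; intro v w σ
    rw [← mul_add, ← mul_add]
    calc _ ≤ WD γ b f v w σ * (χ (vOut v w σ) + χ (vOutStar v w σ) + D v w) := mul_le_mul_right (H v w σ) _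
      _ = WD γ b f v w σ * (χ (vOut v w σ) + χ (vOutStar v w σ)) + WD γ b f v w σ * D v w := by ring
      _ ≤ _ := by
        refine add_le_add_right ?_ _
        rw [one_mul, ← mul_assoc (ENNReal.ofReal (f v)), ← ENNReal.ofReal_mul (hf.nn v), ← mul_assoc]
        refine mul_le_mul_left ?_ _
        unfold WD
        refine mul_le_mul_right (ENNReal.ofReal_le_ofReal ?_) _
        have := prod3_le (mul_nonneg (hf.nn v) (hf.nn w)) (show 0 ≤ 1 - f (vOut v w σ) by linarith [hf.le1 (vOut v w σ)]) (show 0 ≤ 1 - f (vOutStar v w σ) by linarith [hf.le1 (vOutStar v w σ)])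
          (mul_le_one₀ (hf.le1 v) (hf.nn w) (hf.le1 w)) (by linarith [hf.nn (vOut v w σ)]) (by linarith [hf.nn (vOutStar v w σ)])
        exact this.2.1
  rw [TI_add (by fun_prop), TI_add (by fun_prop), TI_add (by fun_prop), ← s1, ← s2, ← two_mul, ← two_mul] at hle
  refine hle.trans ?_
  gcongr
  rw [← JJ_TI (P := fun v p => ENNReal.ofReal (f v) * (1 * (ENNReal.ofReal (f p.1) * D v p.1))) hbm (by fun_prop), ← lintegral_const_mul]
  · apply lintegral_mono; intro v
    have hDv : Measurable (D v) := hDm (by fun_prop) (by fun_prop)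
    simp only
    rw [JJ_const_mul hb (by fun_prop), carlJW h0 hb (χ := fun _ => 1) (by fun_prop) (F := fun w => ENNReal.ofReal (f w) * D v w) (by fun_prop)]
    unfold WI
    rw [mul_left_comm, ← lintegral_const_mul _ (by fun_prop)]
    refine mul_le_mul_right (lintegral_mono fun w => ?_) _
    simp only
    apply le_of_eq; ring
  · apply mlint
    fun_prop
end

lemma one_add_pow_le' {u : ℝ} (h0 : 0 ≤ u) (h1 : u ≤ 1) (k : ℕ) : (1 + u) ^ k ≤ 1 + (2 ^ k - 1) * u := by
  induction k with
  | zero => simp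
  | succ k ih =>
    have h2 : (1:ℝ) ≤ 2 ^ k := one_le_pow₀ (by norm_num)
    rw [pow_succ, pow_succ]
    calc _ ≤ (1 + (2 ^ k - 1) * u) * (1 + u) := by gcongr
      _ ≤ _ := by
        have : 0 ≤ (2 ^ k - 1) * u * (1 - u) := mul_nonneg (mul_nonneg (by linarith) h0) (by linarith)
        nlinarith

lemma one_add_pow_le {u : ℝ} (h0 : 0 ≤ u) (h1 : u ≤ 1) (k : ℕ) : (1 + u) ^ k ≤ 1 + 2 ^ k * u :=
  (one_add_pow_le' h0 h1 k).trans (by linarith)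

def PP (n : ℝ) (q : ℕ) (s : ℝ) : ℝ := s * min s n ^ q
def DD (n : ℝ) (q : ℕ) (x y : ℝ) : ℝ := 2 ^ (q + 1) * min x y * (min x n ^ q + min y n ^ q)

lemma povz_aux {n : ℝ} (hn : 0 < n) (q : ℕ) {x y X Y : ℝ} (hy : 0 < y) (hX : 0 < X) (hY : 0 < Y) (h : X + Y = x + y)
    (hyx : y ≤ x) : PP n q X + PP n q Y ≤ PP n q x + PP n q y + DD n q x y := by
  have hx : 0 < x := by linarith
  have mx : 0 < min x n := lt_min hx hn
  have my : 0 < min y n := lt_min hy hn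
  have m1 : min X n ≤ min (x + y) n := min_le_min_right n (by linarith)
  have m2 : min Y n ≤ min (x + y) n := min_le_min_right n (by linarith)
  have m3 : min (x + y) n ≤ (1 + y / x) * min x n := by
    rcases le_total x n with h1 | h1
    · rw [min_eq_left h1]
      refine (min_le_left _ _).trans (le_of_eq ?_)
      field_simp
    · rw [min_eq_right h1]
      refine (min_le_right _ _).trans ?_
      have : 0 ≤ y / x := by positivity
      nlinarith
  have hu0 : 0 ≤ y / x := by positivity
  have hu1 : y / x ≤ 1 := by rw [div_le_one hx]; exact hyx
  unfold PP DD
  rw [min_eq_right hyx]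
  have p1 : 0 < min X n := lt_min hX hn
  have p2 : 0 < min Y n := lt_min hY hn
  calc X * min X n ^ q + Y * min Y n ^ q ≤ X * ((1 + y / x) * min x n) ^ q + Y * ((1 + y / x) * min x n) ^ q := by
        gcongr
        · exact m1.trans m3
        · exact m2.trans m3
    _ = x * min x n ^ q * (1 + y / x) ^ (q + 1) := by
        rw [← add_mul, h, mul_pow, pow_succ]
        field_simp
    _ ≤ x * min x n ^ q * (1 + 2 ^ (q + 1) * (y / x)) := by gcongr; exact one_add_pow_le hu0 hu1 _
    _ = x * min x n ^ q + 2 ^ (q + 1) * y * min x n ^ q := by field_simp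
    _ ≤ _ := by
        have a1 : 0 ≤ y * min y n ^ q := by positivity
        have a2 : 0 ≤ 2 ^ (q + 1) * y * min y n ^ q := by positivity
        linarith

lemma povz1 {n : ℝ} (hn : 0 < n) (q : ℕ) {x y X Y : ℝ} (hx : 0 < x) (hy : 0 < y) (hX : 0 < X) (hY : 0 < Y) (h : X + Y = x + y) :
    PP n q X + PP n q Y ≤ PP n q x + PP n q y + DD n q x y := by
  rcases le_total y x with h1 | h1
  · exact povz_aux hn q hy hX hY h h1
  · have := povz_aux hn q (x := y) (y := x) hx hX hY (by linarith) h1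
    have e : DD n q x y = DD n q y x := by unfold DD; rw [min_comm x y]; ring
    rw [e]; linarith

lemma povz2_aux {n : ℝ} (hn : 0 < n) (q : ℕ) {x y r : ℝ} (hy : 0 < y) (hr0 : 0 ≤ r) (hr : r ≤ 2 * (x + y)) (hyx : y ≤ x) :
    DD n q x y * r ≤ 8 * 2 ^ (q + 1) * (y * PP n q x + x * PP n q y) := by
  have hx : 0 < x := by linarith
  have mx : 0 < min x n := lt_min hx hn
  have my : 0 < min y n := lt_min hy hn
  have m1 : min y n ≤ min x n := min_le_min_right n hyx
  unfold DD PP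
  rw [min_eq_right hyx]
  calc _ ≤ 2 ^ (q + 1) * y * (min x n ^ q + min x n ^ q) * (4 * x) := by gcongr; linarith
    _ = 8 * 2 ^ (q + 1) * (y * (x * min x n ^ q)) := by ring
    _ ≤ _ := by
      gcongr
      have : 0 ≤ x * (y * min y n ^ q) := by positivity
      linarith

lemma povz2 {n : ℝ} (hn : 0 < n) (q : ℕ) {x y r : ℝ} (hx : 0 < x) (hy : 0 < y) (hr0 : 0 ≤ r) (hr : r ≤ 2 * (x + y)) :
    DD n q x y * r ≤ 8 * 2 ^ (q + 1) * (y * PP n q x + x * PP n q y) := by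
  rcases le_total y x with h1 | h1
  · exact povz2_aux hn q hy hr0 hr h1
  · have := povz2_aux hn q (x := y) (y := x) hx hr0 (by linarith) h1
    have e : DD n q x y = DD n q y x := by unfold DD; rw [min_comm x y]; ring
    rw [e]; linarith

lemma AA_unif {γ : ℝ} {b : ℝ → ℝ} {Z : Set R3} {f : ℝ → R3 → ℝ} {M E : ℝ≥0∞} (C : Cl γ b Z f M E) :
    ∃ K : ℝ, 0 ≤ K ∧ ∀ t v, (AA γ b (f t) v).toReal ≤ K * (1 + ‖v‖ ^ 2) ∧ (LL γ b (f t) v).toReal ≤ K * (1 + ‖v‖ ^ 2) := by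
  have c1 := Lb_one_fin C.hb
  have c2 := Lb_fin C.hb (graz_le (1/4))
  have hE := C.Efin
  set Q : ℝ≥0∞ := 12 * Lb b (graz (1/4)) * E + 6 * ENNReal.ofReal ((1/4:ℝ)⁻¹ ^ 5) * Lb b (fun _ => 1) * E with hQ
  have hQf : Q ≠ ⊤ := by rw [hQ]; finiteness
  have key : ∀ t v, AA γ b (f t) v ≤ Q * ENNReal.ofReal (1 + ‖v‖ ^ 2) ∧ LL γ b (f t) v ≤ Q * ENNReal.ofReal (1 + ‖v‖ ^ 2) := by
    intro t v
    have hf := C.uf t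
    have hm := hf.meas
    have hw : WI γ v (fun x => ENNReal.ofReal (f t x)) ≤ ENNReal.ofReal (2 * (1 + ‖v‖ ^ 2)) * E := by
      have := WI_le C.h0 C.h2 v (fun x => ENNReal.ofReal (f t x)) (by fun_prop)
      rwa [C.energy t] at this
    rw [ENNReal.ofReal_mul (by norm_num)] at hw
    have h1 := diffA (ε := 1/4) C.h0 C.h2 C.hb (by norm_num) le_rfl hf Uf.zero v
    have h3 := diffL (ε := 1/4) C.h0 C.h2 C.hb (by norm_num) le_rfl hf Uf.zero v
    have e1 : ∀ p, ENNReal.ofReal |PA (f t) v p - PA (fun _ => 0) v p| = ENNReal.ofReal (PA (f t) v p) := by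
      intro p; rw [show PA (fun _ => 0) v p = 0 by simp [PA], sub_zero, abs_of_nonneg (hf.PA_nn v p)]
    have e2 : ∀ p, ENNReal.ofReal |PL (f t) v p - PL (fun _ => 0) v p| = ENNReal.ofReal (PL (f t) v p) := by
      intro p; rw [show PL (fun _ => 0) v p = 0 by simp [PL], sub_zero, abs_of_nonneg (hf.PL_nn v p)]
    have e3 : ∀ x, ENNReal.ofReal |f t x - 0| = ENNReal.ofReal (f t x) := by
      intro x; rw [sub_zero, abs_of_nonneg (hf.nn x)]
    simp only [e1, e2, e3, add_zero] at h1 h3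
    have h5 : ENNReal.ofReal 2 = 2 := by simp
    rw [h5] at hw
    have h4 : 6 * (Lb b (graz (1/4)) * WI γ v (fun x => ENNReal.ofReal (f t x)))
      + 3 * ENNReal.ofReal ((1/4:ℝ)⁻¹ ^ 5) * (Lb b (fun _ => 1) * WI γ v (fun x => ENNReal.ofReal (f t x))) ≤ Q * ENNReal.ofReal (1 + ‖v‖ ^ 2) := by
      calc _ ≤ 6 * (Lb b (graz (1/4)) * (2 * ENNReal.ofReal (1 + ‖v‖ ^ 2) * E))
        + 3 * ENNReal.ofReal ((1/4:ℝ)⁻¹ ^ 5) * (Lb b (fun _ => 1) * (2 * ENNReal.ofReal (1 + ‖v‖ ^ 2) * E)) := by gcongr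
        _ = _ := by rw [hQ]; ring
    exact ⟨h1.trans h4, h3.trans h4⟩
  refine ⟨Q.toReal, ENNReal.toReal_nonneg, fun t v => ?_⟩
  have e : (Q * ENNReal.ofReal (1 + ‖v‖ ^ 2)).toReal = Q.toReal * (1 + ‖v‖ ^ 2) := by
    rw [ENNReal.toReal_mul, ENNReal.toReal_ofReal (by positivity)]
  rw [← e]
  exact ⟨ENNReal.toReal_mono (by finiteness) (key t v).1, ENNReal.toReal_mono (by finiteness) (key t v).2⟩

lemma measurable_AA {γ : ℝ} {b : ℝ → ℝ} (hb : GradCutoff b) {f : R3 → ℝ} (hf : Measurable f) :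
    Measurable (AA γ b f) ∧ Measurable (LL γ b f) := by
  have hbm := hb.measurable
  constructor
  · unfold AA JJ PA
    apply mlint; fun_prop
  · unfold LL JJ PL
    apply mlint; fun_prop

/-- truncated weight -/
def chi (n : ℝ) (q : ℕ) (v : R3) : ℝ := (1 + ‖v‖ ^ 2) * (n ^ q - min (1 + ‖v‖ ^ 2) n ^ q)

@[fun_prop]
lemma measurable_chi (n : ℝ) (q : ℕ) : Measurable (chi n q) := by unfold chi; fun_prop

lemma chi_nonneg {n : ℝ} (hn : 1 ≤ n) (q : ℕ) (v : R3) : 0 ≤ chi n q v := by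
  unfold chi
  have : min (1 + ‖v‖ ^ 2) n ^ q ≤ n ^ q := by
    gcongr
    exact min_le_right _ _
  exact mul_nonneg (by positivity) (by linarith)

lemma chi_zero {n : ℝ} (q : ℕ) {v : R3} (h : n ≤ 1 + ‖v‖ ^ 2) : chi n q v = 0 := by
  unfold chi; rw [min_eq_right h]; simp

lemma chi_le {n : ℝ} (hn : 1 ≤ n) (q : ℕ) (v : R3) : chi n q v ≤ n * n ^ q := by
  rcases le_total n (1 + ‖v‖ ^ 2) with h | h
  · rw [chi_zero q h]; positivity
  · unfold chi
    rw [min_eq_left h]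
    have : 0 ≤ (1 + ‖v‖ ^ 2) ^ q := by positivity
    have h3 : (1 + ‖v‖ ^ 2) ^ q ≤ n ^ q := by gcongr
    have h2 : n ^ q - (1 + ‖v‖ ^ 2) ^ q ≤ n ^ q := by linarith
    exact mul_le_mul h h2 (by linarith) (by linarith)

lemma chi_PP (n : ℝ) (q : ℕ) (v : R3) : chi n q v + PP n q (1 + ‖v‖ ^ 2) = n ^ q * (1 + ‖v‖ ^ 2) := by
  unfold chi PP; ring

lemma chi_weight {n : ℝ} (hn : 1 ≤ n) (q : ℕ) (v : R3) : (1 + ‖v‖ ^ 2) * chi n q v ≤ n * chi n q v := by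
  rcases le_total n (1 + ‖v‖ ^ 2) with h | h
  · rw [chi_zero q h]; simp
  · exact mul_le_mul_of_nonneg_right h (chi_nonneg hn q v)

lemma chi_int {n : ℝ} (hn : 1 ≤ n) (q : ℕ) : Integrable (chi n q) := by
  have h1 : Integrable (indicator (Metric.closedBall (0:R3) n) (fun _ => n * n ^ q)) := by
    rw [integrable_indicator_iff measurableSet_closedBall]
    exact integrableOn_const (by exact (isCompact_closedBall (0:R3) n).measure_lt_top.ne)
  refine h1.mono' (by fun_prop) (Filter.Eventually.of_forall fun v => ?_)
  rw [Real.norm_of_nonneg (chi_nonneg hn q v)]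
  by_cases h : v ∈ Metric.closedBall (0:R3) n
  · rw [indicator_of_mem h]; exact chi_le hn q v
  · rw [indicator_of_notMem h, chi_zero q]
    simp at h
    nlinarith

section
variable {γ : ℝ} {b : ℝ → ℝ} {Z : Set R3} {f : ℝ → R3 → ℝ} {M E : ℝ≥0∞}

def II (f : ℝ → R3 → ℝ) (n : ℝ) (q : ℕ) (t : ℝ) : ℝ := ∫ v, f t v * chi n q v

lemma fchi_int (C : Cl γ b Z f M E) {n : ℝ} (hn : 1 ≤ n) (q : ℕ) (t : ℝ) : Integrable (fun v => f t v * chi n q v) := by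
  have hm := (C.uf t).meas
  refine (chi_int hn q).mono' (by fun_prop) (Filter.Eventually.of_forall fun v => ?_)
  rw [Real.norm_of_nonneg (mul_nonneg ((C.uf t).nn v) (chi_nonneg hn q v))]
  exact mul_le_of_le_one_left (chi_nonneg hn q v) ((C.uf t).le1 v)

lemma II_cont (C : Cl γ b Z f M E) {n : ℝ} (hn : 1 ≤ n) (q : ℕ) : Continuous (II f n q) := by
  unfold II
  apply continuous_of_dominated (bound := chi n q)
  · intro t; exact (fchi_int C hn q t).1
  · intro t
    refine Filter.Eventually.of_forall fun v => ?_
    rw [Real.norm_of_nonneg (mul_nonneg ((C.uf t).nn v) (chi_nonneg hn q v))]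
    exact mul_le_of_le_one_left (chi_nonneg hn q v) ((C.uf t).le1 v)
  · exact chi_int hn q
  · exact Filter.Eventually.of_forall fun v => (C.cont v).mul continuous_const

lemma II_deriv (C : Cl γ b Z f M E) {n : ℝ} (hn : 1 ≤ n) (q : ℕ) {t : ℝ} (ht : 0 < t) :
    ∃ T1 T2 : ℝ≥0∞, T1 ≠ ⊤ ∧ T2 ≠ ⊤ ∧ T1 = ∫⁻ v, ENNReal.ofReal (f t v) * LL γ b (f t) v * ENNReal.ofReal (chi n q v) ∧
      T2 = ∫⁻ v, ENNReal.ofReal (1 - f t v) * AA γ b (f t) v * ENNReal.ofReal (chi n q v) ∧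
      HasDerivAt (II f n q) (T2.toReal - T1.toReal) t := by
  obtain ⟨K, hK, hb⟩ := AA_unif C
  have hfin : ∀ v, AA γ b (f t) v ≠ ⊤ ∧ LL γ b (f t) v ≠ ⊤ := AA_fin C.h0 C.h2 C.hb (C.uf t) (by rw [C.energy t]; exact C.Efin)
  have hm := (C.uf t).meas
  have hmA := (measurable_AA (γ := γ) C.hb hm).1
  have hmL := (measurable_AA (γ := γ) C.hb hm).2
  have hchi := chi_int hn q
  set G2 : R3 → ℝ := fun v => (AA γ b (f t) v).toReal * (1 - f t v) * chi n q v with hG2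
  set G1 : R3 → ℝ := fun v => f t v * (LL γ b (f t) v).toReal * chi n q v with hG1
  have nn2 : ∀ v, 0 ≤ G2 v := fun v => mul_nonneg (mul_nonneg ENNReal.toReal_nonneg (by linarith [(C.uf t).le1 v])) (chi_nonneg hn q v)
  have nn1 : ∀ v, 0 ≤ G1 v := fun v => mul_nonneg (mul_nonneg ((C.uf t).nn v) ENNReal.toReal_nonneg) (chi_nonneg hn q v)
  have bd2 : ∀ s v, (AA γ b (f s) v).toReal * (1 - f s v) * chi n q v ≤ K * n * chi n q v := by
    intro s v
    have h1 := chi_weight hn q v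
    calc _ ≤ K * (1 + ‖v‖ ^ 2) * 1 * chi n q v := by
          gcongr
          · exact chi_nonneg hn q v
          · linarith [(C.uf s).le1 v]
          · exact (hb s v).1
          · linarith [(C.uf s).nn v]
      _ = K * ((1 + ‖v‖ ^ 2) * chi n q v) := by ring
      _ ≤ K * (n * chi n q v) := by gcongr
      _ = _ := by ring
  have bd1 : ∀ s v, f s v * (LL γ b (f s) v).toReal * chi n q v ≤ K * n * chi n q v := by
    intro s v
    have h1 := chi_weight hn q v
    calc _ ≤ 1 * (K * (1 + ‖v‖ ^ 2)) * chi n q v := by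
          gcongr
          · exact chi_nonneg hn q v
          · exact (C.uf s).le1 v
          · exact (hb s v).2
      _ = K * ((1 + ‖v‖ ^ 2) * chi n q v) := by ring
      _ ≤ K * (n * chi n q v) := by gcongr
      _ = _ := by ring
  have i2 : Integrable G2 := by
    refine (hchi.const_mul (K * n)).mono' (by fun_prop) (Filter.Eventually.of_forall fun v => ?_)
    rw [Real.norm_of_nonneg (nn2 v)]; exact bd2 t v
  have i1 : Integrable G1 := by
    refine (hchi.const_mul (K * n)).mono' (by fun_prop) (Filter.Eventually.of_forall fun v => ?_)
    rw [Real.norm_of_nonneg (nn1 v)]; exact bd1 t v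
  have e2 : ∫⁻ v, ENNReal.ofReal (G2 v) = ∫⁻ v, ENNReal.ofReal (1 - f t v) * AA γ b (f t) v * ENNReal.ofReal (chi n q v) := by
    apply lintegral_congr; intro v
    rw [hG2]; simp only
    rw [ENNReal.ofReal_mul (mul_nonneg ENNReal.toReal_nonneg (by linarith [(C.uf t).le1 v])), ENNReal.ofReal_mul ENNReal.toReal_nonneg,
      ENNReal.ofReal_toReal (hfin v).1]
    ring
  have e1 : ∫⁻ v, ENNReal.ofReal (G1 v) = ∫⁻ v, ENNReal.ofReal (f t v) * LL γ b (f t) v * ENNReal.ofReal (chi n q v) := by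
    apply lintegral_congr; intro v
    rw [hG1]; simp only
    rw [ENNReal.ofReal_mul (mul_nonneg ((C.uf t).nn v) ENNReal.toReal_nonneg), ENNReal.ofReal_mul ((C.uf t).nn v),
      ENNReal.ofReal_toReal (hfin v).2]
  refine ⟨∫⁻ v, ENNReal.ofReal (G1 v), ∫⁻ v, ENNReal.ofReal (G2 v), i1.lintegral_lt_top.ne, i2.lintegral_lt_top.ne, e1, e2, ?_⟩
  rw [← integral_eq_lintegral_of_nonneg_ae (Filter.Eventually.of_forall nn2) i2.1,
    ← integral_eq_lintegral_of_nonneg_ae (Filter.Eventually.of_forall nn1) i1.1, ← integral_sub i2 i1]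
  have := hasDerivAt_integral_of_dominated_loc_of_deriv_le (μ := (volume : Measure R3)) (s := Ioi (0:ℝ)) (x₀ := t) (F := fun s v => f s v * chi n q v)
    (F' := fun s v => ((AA γ b (f s) v).toReal * (1 - f s v) - f s v * (LL γ b (f s) v).toReal) * chi n q v)
    (bound := fun v => K * n * chi n q v) (Ioi_mem_nhds ht) (Filter.Eventually.of_forall fun s => (fchi_int C hn q s).1) (fchi_int C hn q t)
    (by fun_prop) (Filter.Eventually.of_forall fun v s hs => ?_) (hchi.const_mul _) ?_
  · have h2 := this.2
    have e5 : ∫ v, (G2 v - G1 v) = ∫ v, ((AA γ b (f t) v).toReal * (1 - f t v) - f t v * (LL γ b (f t) v).toReal) * chi n q v := by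
      apply integral_congr_ae
      refine Filter.Eventually.of_forall fun v => ?_
      simp only [hG1, hG2]; ring
    rw [e5]; exact h2
  · have a1 : 0 ≤ (AA γ b (f s) v).toReal * (1 - f s v) * chi n q v :=
      mul_nonneg (mul_nonneg ENNReal.toReal_nonneg (by linarith [(C.uf s).le1 v])) (chi_nonneg hn q v)
    have a2 : 0 ≤ f s v * (LL γ b (f s) v).toReal * chi n q v :=
      mul_nonneg (mul_nonneg ((C.uf s).nn v) ENNReal.toReal_nonneg) (chi_nonneg hn q v)
    rw [Real.norm_eq_abs, abs_le, sub_mul]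
    constructor <;> linarith [bd1 s v, bd2 s v]
  · have : ∀ᵐ v : R3, v ∉ Z := measure_eq_zero_iff_ae_notMem.1 C.Z0
    filter_upwards [this] with v hv s hs
    exact (C.deriv v hv s hs).mul_const _
end

lemma PP_nonneg {n : ℝ} (hn : 1 ≤ n) (q : ℕ) {s : ℝ} (hs : 0 ≤ s) : 0 ≤ PP n q s := by
  unfold PP
  have : 0 ≤ min s n := le_min hs (by linarith)
  positivity

lemma DD_nonneg {n : ℝ} (hn : 1 ≤ n) (q : ℕ) {x y : ℝ} (hx : 0 ≤ x) (hy : 0 ≤ y) : 0 ≤ DD n q x y := by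
  unfold DD
  have : 0 ≤ min x n := le_min hx (by linarith)
  have : 0 ≤ min y n := le_min hy (by linarith)
  have : 0 ≤ min x y := le_min hx hy
  positivity

section
variable {γ : ℝ} {b : ℝ → ℝ} {Z : Set R3} {f : ℝ → R3 → ℝ} {M E : ℝ≥0∞}

def NN (f : ℝ → R3 → ℝ) (n : ℝ) (q : ℕ) (t : ℝ) : ℝ≥0∞ := ∫⁻ v, ENNReal.ofReal (f t v) * ENNReal.ofReal (PP n q (1 + ‖v‖ ^ 2))

lemma measurable_PP (n : ℝ) (q : ℕ) : Measurable (PP n q) := by unfold PP; fun_prop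

lemma NN_II (C : Cl γ b Z f M E) {n : ℝ} (hn : 1 ≤ n) (q : ℕ) (t : ℝ) :
    NN f n q t ≠ ⊤ ∧ (NN f n q t).toReal = n ^ q * E.toReal - II f n q t := by
  have hm := (C.uf t).meas
  have hP := measurable_PP n q
  have e1 : ENNReal.ofReal (II f n q t) = ∫⁻ v, ENNReal.ofReal (f t v) * ENNReal.ofReal (chi n q v) := by
    unfold II
    rw [ofReal_integral_eq_lintegral_ofReal (fchi_int C hn q t) (Filter.Eventually.of_forall fun v => mul_nonneg ((C.uf t).nn v) (chi_nonneg hn q v))]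
    exact lintegral_congr fun v => ENNReal.ofReal_mul ((C.uf t).nn v)
  have e2 : ENNReal.ofReal (II f n q t) + NN f n q t = ENNReal.ofReal (n ^ q) * E := by
    rw [e1, NN, ← lintegral_add_left (by fun_prop), ← C.energy t, N2, ← lintegral_const_mul _ (by fun_prop)]
    apply lintegral_congr; intro v
    rw [← mul_add, ← ENNReal.ofReal_add (chi_nonneg hn q v) (PP_nonneg hn q (by positivity)), chi_PP, ENNReal.ofReal_mul (by positivity)]
    ring
  have hE := C.Efin
  have e3 : NN f n q t ≠ ⊤ := by
    refine ne_top_of_le_ne_top (b := ENNReal.ofReal (n ^ q) * E) (by finiteness) ?_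
    rw [← e2]; exact le_add_self
  refine ⟨e3, ?_⟩
  have hI : 0 ≤ II f n q t := integral_nonneg fun v => mul_nonneg ((C.uf t).nn v) (chi_nonneg hn q v)
  have := congrArg ENNReal.toReal e2
  rw [ENNReal.toReal_add (by finiteness) e3, ENNReal.toReal_ofReal hI, ENNReal.toReal_mul, ENNReal.toReal_ofReal (by positivity)] at this
  linarith

lemma dbl (C : Cl γ b Z f M E) {n : ℝ} (hn : 1 ≤ n) (q : ℕ) (t : ℝ) :
    ∫⁻ v, ∫⁻ w, ENNReal.ofReal (f t v) * ENNReal.ofReal (f t w) * ENNReal.ofReal (DD n q (1 + ‖v‖ ^ 2) (1 + ‖w‖ ^ 2)) * ENNReal.ofReal (‖w - v‖ ^ γ)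
      ≤ ENNReal.ofReal (8 * 2 ^ (q + 1)) * (2 * (E * NN f n q t)) := by
  have hm := (C.uf t).meas
  have hP := measurable_PP n q
  set k := ENNReal.ofReal (8 * 2 ^ (q + 1)) with hk
  set F : R3 → ℝ≥0∞ := fun v => ENNReal.ofReal (f t v) * ENNReal.ofReal (1 + ‖v‖ ^ 2) with hF
  set G : R3 → ℝ≥0∞ := fun v => ENNReal.ofReal (f t v) * ENNReal.ofReal (PP n q (1 + ‖v‖ ^ 2)) with hG
  have hFm : Measurable F := by fun_prop
  have hGm : Measurable G := by fun_prop
  have iF : ∫⁻ v, F v = E := C.energy t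
  have iG : ∫⁻ v, G v = NN f n q t := rfl
  calc _ ≤ ∫⁻ v, ∫⁻ w, (k * G v * F w + k * F v * G w) := by
        apply lintegral_mono; intro v
        apply lintegral_mono; intro w
        simp only
        have hx : 0 < 1 + ‖v‖ ^ 2 := by positivity
        have hy : 0 < 1 + ‖w‖ ^ 2 := by positivity
        have r0 : 0 ≤ ‖w - v‖ ^ γ := by positivity
        have r1 : ‖w - v‖ ^ γ ≤ 2 * ((1 + ‖v‖ ^ 2) + (1 + ‖w‖ ^ 2)) := by
          have h1 := rpow_le_sq C.h0 C.h2 (norm_nonneg (w - v))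
          have h2 := norm_sub_le w v
          have h3 : ‖w - v‖ ^ 2 ≤ (‖w‖ + ‖v‖) ^ 2 := by gcongr
          nlinarith [sq_nonneg (‖w‖ - ‖v‖)]
        have h := povz2 (n := n) (by linarith) q hx hy r0 r1
        calc _ = ENNReal.ofReal (f t v) * ENNReal.ofReal (f t w) * ENNReal.ofReal (DD n q (1 + ‖v‖ ^ 2) (1 + ‖w‖ ^ 2) * ‖w - v‖ ^ γ) := by
              rw [ENNReal.ofReal_mul (DD_nonneg hn q hx.le hy.le)]; ring
          _ ≤ ENNReal.ofReal (f t v) * ENNReal.ofReal (f t w) * ENNReal.ofReal (8 * 2 ^ (q + 1) * ((1 + ‖w‖ ^ 2) * PP n q (1 + ‖v‖ ^ 2) + (1 + ‖v‖ ^ 2) * PP n q (1 + ‖w‖ ^ 2))) := by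
              gcongr
          _ = _ := by
              have p1 := PP_nonneg hn q hx.le
              have p2 := PP_nonneg hn q hy.le
              rw [ENNReal.ofReal_mul (by positivity), ENNReal.ofReal_add (by positivity) (by positivity), ENNReal.ofReal_mul hy.le, ENNReal.ofReal_mul hx.le]
              simp only [hF, hG, hk]; ring
    _ = ∫⁻ v, (k * E * G v + k * NN f n q t * F v) := by
        apply lintegral_congr; intro v
        rw [lintegral_add_left (by fun_prop), lintegral_const_mul _ hFm, lintegral_const_mul _ hGm, iF, iG]; ring
    _ = _ := by
        rw [lintegral_add_left (by fun_prop), lintegral_const_mul _ hGm, lintegral_const_mul _ hFm, iF, iG]; ring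

lemma moment_trunc (C : Cl γ b Z f M E) (q : ℕ) {n : ℝ} (hn : 1 ≤ n) {t : ℝ} (ht : 0 ≤ t) :
    (NN f n q t).toReal ≤ (NN f n q 0).toReal * Real.exp ((Lb b (fun _ => 1) * ENNReal.ofReal (8 * 2 ^ (q + 1)) * E).toReal * t) := by
  have c1 := Lb_one_fin C.hb
  have hE := C.Efin
  set A : ℝ≥0∞ := Lb b (fun _ => 1) * ENNReal.ofReal (8 * 2 ^ (q + 1)) * E with hA
  have hAf : A ≠ ⊤ := by rw [hA]; finiteness
  set φ : ℝ → ℝ := fun t => (n ^ q * E.toReal - II f n q t) * Real.exp (-(A.toReal * t)) with hφ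
  have hφc : Continuous φ := by
    have := II_cont C hn q
    fun_prop
  have hd : ∀ s, 0 < s → deriv φ s ≤ 0 ∧ DifferentiableAt ℝ φ s := by
    intro s hs
    obtain ⟨T1, T2, f1, f2, e1, e2, hder⟩ := II_deriv C hn q hs
    have w := weak_form (γ := γ) C.h0 C.hb (C.uf s) (χ := fun v => ENNReal.ofReal (chi n q v)) (by fun_prop)
      (D := fun v w => ENNReal.ofReal (DD n q (1 + ‖v‖ ^ 2) (1 + ‖w‖ ^ 2))) (by unfold DD; fun_prop) (by
        intro v w σ
        have hx : 0 < 1 + ‖v‖ ^ 2 := by positivity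
        have hy : 0 < 1 + ‖w‖ ^ 2 := by positivity
        have hX : 0 < 1 + ‖vOut v w σ‖ ^ 2 := by positivity
        have hY : 0 < 1 + ‖vOutStar v w σ‖ ^ 2 := by positivity
        have he := vOut_energy v w σ
        have h := povz1 (n := n) (by linarith) q hx hy hX hY (by linarith)
        have d := DD_nonneg hn q hx.le hy.le
        rw [← ENNReal.ofReal_add (chi_nonneg hn q _) (chi_nonneg hn q _), ← ENNReal.ofReal_add (chi_nonneg hn q _) (chi_nonneg hn q _),
          ← ENNReal.ofReal_add (add_nonneg (chi_nonneg hn q _) (chi_nonneg hn q _)) d]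
        apply ENNReal.ofReal_le_ofReal
        have a1 := chi_PP n q v
        have a2 := chi_PP n q w
        have a3 := chi_PP n q (vOut v w σ)
        have a4 := chi_PP n q (vOutStar v w σ)
        have a5 : n ^ q * (1 + ‖v‖ ^ 2) + n ^ q * (1 + ‖w‖ ^ 2) = n ^ q * (1 + ‖vOut v w σ‖ ^ 2) + n ^ q * (1 + ‖vOutStar v w σ‖ ^ 2) := by
          linear_combination (-n ^ q) * he
        linarith)
    rw [← e1, ← e2] at w
    have w2 : 2 * T1 ≤ 2 * (T2 + A * NN f n q s) := by
      refine w.trans ?_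
      calc _ ≤ 2 * T2 + Lb b (fun _ => 1) * (ENNReal.ofReal (8 * 2 ^ (q + 1)) * (2 * (E * NN f n q s))) := by
            gcongr; exact dbl C hn q s
        _ = _ := by rw [hA]; ring
    have w3 : T1 ≤ T2 + A * NN f n q s := by
      rwa [ENNReal.mul_le_mul_iff_right (by norm_num) (by norm_num)] at w2
    obtain ⟨n1, n2⟩ := NN_II C hn q s
    have w4 := ENNReal.toReal_mono (by finiteness) w3
    rw [ENNReal.toReal_add f2 (by finiteness), ENNReal.toReal_mul, n2] at w4
    have h1 : HasDerivAt (fun t => Real.exp (-(A.toReal * t))) (Real.exp (-(A.toReal * s)) * (-(A.toReal * 1))) s :=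
      ((((hasDerivAt_id s).const_mul A.toReal)).neg).exp
    have h2 := (hder.const_sub (n ^ q * E.toReal)).mul h1
    have h3 : HasDerivAt φ _ s := h2
    refine ⟨?_, h3.differentiableAt⟩
    rw [h3.deriv]
    have := Real.exp_pos (-(A.toReal * s))
    nlinarith
  have anti : AntitoneOn φ (Ici 0) := by
    apply antitoneOn_of_deriv_nonpos (convex_Ici 0) hφc.continuousOn
    · intro s hs
      rw [interior_Ici] at hs
      exact (hd s hs).2.differentiableWithinAt
    · intro s hs
      rw [interior_Ici] at hs
      exact (hd s hs).1
  have h := anti (show (0:ℝ) ∈ Ici 0 by simp) (show t ∈ Ici 0 from ht) ht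
  simp only [hφ] at h
  rw [mul_zero, neg_zero, Real.exp_zero, mul_one, ← (NN_II C hn q t).2, ← (NN_II C hn q 0).2, Real.exp_neg] at h
  have := Real.exp_pos (A.toReal * t)
  rwa [mul_inv_le_iff₀ this] at h

/-- polynomial moment -/
def MO (F : R3 → ℝ≥0∞) (k : ℕ) : ℝ≥0∞ := ∫⁻ v, F v * ENNReal.ofReal ((1 + ‖v‖ ^ 2) ^ k)

lemma moments (C : Cl γ b Z f M E) (q : ℕ) (h : MO (fun v => ENNReal.ofReal (f 0 v)) (q + 1) ≠ ⊤) (T : ℝ) :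
    ∃ K : ℝ≥0∞, K ≠ ⊤ ∧ ∀ t, 0 ≤ t → t ≤ T → MO (fun v => ENNReal.ofReal (f t v)) (q + 1) ≤ K := by
  set A := (Lb b (fun _ => 1) * ENNReal.ofReal (8 * 2 ^ (q + 1)) * E).toReal with hA
  have hA0 : 0 ≤ A := ENNReal.toReal_nonneg
  refine ⟨ENNReal.ofReal ((MO (fun v => ENNReal.ofReal (f 0 v)) (q + 1)).toReal * Real.exp (A * T)), by finiteness, fun t ht hT => ?_⟩
  have hm := (C.uf t).meas
  have hPle : ∀ (n : ℝ) (v : R3), 1 ≤ n → PP n q (1 + ‖v‖ ^ 2) ≤ (1 + ‖(v:R3)‖ ^ 2) ^ (q + 1) := by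
    intro n v hn
    unfold PP
    rw [pow_succ' (1 + ‖v‖ ^ 2) q]
    have : 0 ≤ min (1 + ‖v‖ ^ 2) n := le_min (by positivity) (by linarith)
    gcongr
    exact min_le_left _ _
  have h1 : ∀ n : ℕ, NN f (n + 1) q t ≤ ENNReal.ofReal ((MO (fun v => ENNReal.ofReal (f 0 v)) (q + 1)).toReal * Real.exp (A * T)) := by
    intro n
    have hn : (1:ℝ) ≤ n + 1 := by linarith [Nat.cast_nonneg (α := ℝ) n]
    rw [← ENNReal.ofReal_toReal (NN_II C hn q t).1]
    apply ENNReal.ofReal_le_ofReal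
    refine (moment_trunc C q hn ht).trans ?_
    rw [← hA]
    have : NN f (n + 1) q 0 ≤ MO (fun v => ENNReal.ofReal (f 0 v)) (q + 1) := by
      apply lintegral_mono; intro v
      exact mul_le_mul_right (ENNReal.ofReal_le_ofReal (hPle _ v hn)) _
    have := ENNReal.toReal_mono h this
    exact mul_le_mul this (Real.exp_le_exp.2 (mul_le_mul_of_nonneg_left hT hA0)) (Real.exp_pos _).le ENNReal.toReal_nonneg
  have h2 : MO (fun v => ENNReal.ofReal (f t v)) (q + 1) ≤ Filter.liminf (fun n : ℕ => NN f (n + 1) q t) Filter.atTop := by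
    unfold MO NN
    have hP := fun n => measurable_PP n q
    refine le_trans ?_ (lintegral_liminf_le (fun n => by fun_prop))
    apply lintegral_mono; intro v
    simp only
    apply Filter.le_liminf_of_le
    · isBoundedDefault
    · obtain ⟨N, hN⟩ := exists_nat_ge (1 + ‖v‖ ^ 2)
      filter_upwards [Filter.eventually_ge_atTop N] with n hn
      have : (N:ℝ) ≤ n := by exact_mod_cast hn
      rw [PP, min_eq_left (by linarith), pow_succ' (1 + ‖v‖ ^ 2) q]
  refine h2.trans ?_
  exact Filter.liminf_le_of_le (by isBoundedDefault) (fun b hb => by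
    obtain ⟨n, hn⟩ := hb.exists
    exact hn.trans (h1 n))
end

lemma contract {ι : Type*} {u φ : ι → ℝ} {C K₀ : ℝ} (hK₀ : 0 ≤ K₀) (hC : 0 ≤ C)
    (H : ∀ K, 0 ≤ K → (∀ i, u i ≤ K * φ i) → ∀ i, u i ≤ (K / 2 + C) * φ i) (h0 : ∀ i, u i ≤ K₀ * φ i) :
    ∀ i, u i ≤ 2 * C * φ i := by
  have h2 : ∀ j : ℕ, ∀ i, u i ≤ (2 * C + (1/2) ^ j * K₀ - (1/2)^j * (2 * C)) * φ i := by
    intro j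
    induction j with
    | zero => intro i; simpa using h0 i
    | succ j ih =>
      have hj : (1/2:ℝ)^j ≤ 1 := pow_le_one₀ (by norm_num) (by norm_num)
      have hj0 : 0 ≤ (1/2:ℝ)^j * K₀ := by positivity
      have := H _ (by nlinarith) ih
      intro i
      refine (this i).trans (le_of_eq ?_)
      rw [pow_succ]; ring
  intro i
  have h3 : Filter.Tendsto (fun j : ℕ => (1/2:ℝ) ^ j) Filter.atTop (nhds 0) := tendsto_pow_atTop_nhds_zero_of_lt_one (by norm_num) (by norm_num)
  have h4 : Filter.Tendsto (fun j : ℕ => (2 * C + (1/2) ^ j * K₀ - (1/2)^j * (2 * C)) * φ i) Filter.atTop (nhds ((2 * C + 0 * K₀ - 0 * (2 * C)) * φ i)) :=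
    ((tendsto_const_nhds.add (h3.mul_const _)).sub (h3.mul_const _)).mul_const _
  have := ge_of_tendsto' h4 (fun j => h2 j i)
  simpa using this

/-- p = 1 + |v|^2 -/
def pr (v : R3) : ℝ := 1 + ‖v‖ ^ 2

lemma pr_one (v : R3) : 1 ≤ pr v := by unfold pr; nlinarith [sq_nonneg ‖v‖]
lemma pr_pos (v : R3) : 0 < pr v := by linarith [pr_one v]
@[fun_prop]
lemma measurable_pr : Measurable pr := by unfold pr; fun_prop

lemma pr_mul (v w : R3) (σ : S2) : pr v ≤ pr (vOut v w σ) * pr (vOutStar v w σ) := by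
  have := vOut_energy v w σ
  unfold pr
  nlinarith [sq_nonneg ‖w‖, mul_nonneg (sq_nonneg ‖vOut v w σ‖) (sq_nonneg ‖vOutStar v w σ‖)]

lemma pr_add (v w : R3) (σ : S2) : pr v ≤ pr (vOut v w σ) + pr (vOutStar v w σ) := by
  have := vOut_energy v w σ
  unfold pr
  nlinarith [sq_nonneg ‖w‖]

section
variable {γ : ℝ} {b : ℝ → ℝ} {Z : Set R3} {f : ℝ → R3 → ℝ} {M E : ℝ≥0∞}

lemma poly_pt (C : Cl γ b Z f M E) (hM : M ≠ 0) (k : ℕ) {C0 : ℝ} (hC0 : 0 ≤ C0) (hi : ∀ v, f 0 v ≤ C0 * (pr v ^ k)⁻¹) {T : ℝ} {Kt : ℝ≥0∞} (hKt : Kt ≠ ⊤)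
    (hmo : ∀ t, 0 ≤ t → t ≤ T → MO (fun v => ENNReal.ofReal (f t v)) (k + 1) ≤ Kt) :
    ∃ A, 0 ≤ A ∧ ∀ t, 0 ≤ t → t ≤ T → ∀ v, f t v ≤ A * (pr v ^ k)⁻¹ := by
  obtain ⟨c₁, R₀, hc₁, hR₀, hloss⟩ := loss_lower C hM
  have L1 := Lb_one_fin C.hb
  have hpos : (0:ℝ≥0∞) < ENNReal.ofReal (c₁ / 2) := ENNReal.ofReal_pos.2 (by linarith)
  obtain ⟨x, hx, hx'⟩ := enn_small_mul (c := 12 * Kt) (by finiteness) hpos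
  obtain ⟨ε, hε0, hε, hεx⟩ := Lb_graz_small C.hb hx
  have s1 : 12 * Kt * Lb b (graz ε) ≤ ENNReal.ofReal (c₁ / 2) := le_trans (by gcongr) hx'
  set Q : ℝ≥0∞ := 6 * ENNReal.ofReal (ε⁻¹ ^ 5) * Lb b (fun _ => 1) * ENNReal.ofReal (2 ^ k) * Kt with hQ
  have hQf : Q ≠ ⊤ := by rw [hQ]; finiteness
  set D := Q.toReal / c₁ + C0 + (1 + R₀ ^ 2) ^ k with hD
  have hq0 : 0 ≤ Q.toReal / c₁ := div_nonneg ENNReal.toReal_nonneg hc₁.le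
  have hr0 : 0 ≤ (1 + R₀ ^ 2) ^ k := by positivity
  have hD0 : 0 ≤ D := by rw [hD]; positivity
  refine ⟨2 * D, by positivity, ?_⟩
  have main : ∀ n : ℝ, 1 ≤ n → ∀ i : {t : ℝ // 0 ≤ t ∧ t ≤ T} × R3, f i.1 i.2 ≤ 2 * D * (min (pr i.2) n ^ k)⁻¹ := by
    intro n hn
    have hmin : ∀ v, 1 ≤ min (pr v) n := fun v => le_min (pr_one v) hn
    refine contract (K₀ := n ^ k) (by positivity) hD0 ?_ ?_
    · intro K hK hb i
      obtain ⟨⟨t, ht0, htT⟩, v⟩ := i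
      simp only
      have hf := C.uf t
      have hm := hf.meas
      have hφ : 0 < (min (pr v) n ^ k)⁻¹ := inv_pos.2 (pow_pos (by linarith [hmin v]) k)
      set φ := (min (pr v) n ^ k)⁻¹ with hφd
      have hpφ : (pr v ^ k)⁻¹ ≤ φ := by
        rw [hφd]
        have := hmin v
        gcongr
        exact min_le_left _ _
      rcases le_total ‖v‖ R₀ with hv | hv
      · have h1 : 1 ≤ (1 + R₀ ^ 2) ^ k * φ := by
          rw [hφd, ← div_eq_mul_inv, one_le_div (pow_pos (by linarith [hmin v]) k)]
          have := hmin v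
          have h5 : min (pr v) n ≤ 1 + R₀ ^ 2 := (min_le_left _ _).trans (by unfold pr; gcongr)
          gcongr
        refine (hf.le1 v).trans (h1.trans ?_)
        gcongr
        rw [hD]; linarith
      · have hG : ∀ s, 0 ≤ s → s ≤ T → GG γ b (f s) v ≤ ENNReal.ofReal (c₁ * ‖v‖ ^ γ * ((K / 2 + Q.toReal / c₁) * φ)) := by
          intro s hs0 hsT
          have hfs := C.uf s
          have hms := hfs.meas
          have hbs := fun x => hb (⟨s, hs0, hsT⟩, x)
          simp only at hbs
          have kk : ∀ x y, pr v ≤ pr x * pr y → f s x * f s y ≤ K * φ * (pr x ^ k * f s x) := by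
            intro x y hxy
            have h1 : (min (pr y) n ^ k)⁻¹ ≤ φ * pr x ^ k := by
              rw [hφd, inv_eq_one_div, div_le_iff₀ (pow_pos (by linarith [hmin y]) k), mul_assoc, ← mul_pow, ← div_eq_inv_mul, one_le_div (pow_pos (by linarith [hmin v]) k)]
              have := hmin v
              gcongr
              have hx1 := pr_one x
              rcases le_total (pr y) n with h | h
              · rw [min_eq_left h]; exact (min_le_left _ _).trans hxy
              · rw [min_eq_right h]; exact (min_le_right _ _).trans (by nlinarith)
            have h2 := hbs y
            calc f s x * f s y ≤ f s x * (K * (φ * pr x ^ k)) := by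
                  gcongr
                  · exact hfs.nn x
                  · exact h2.trans (by gcongr)
              _ = _ := by ring
          have j := JJ_two C.h0 C.h2 C.hb hε0 hε (v := v)
            (P := fun p => ENNReal.ofReal (f s (vOut v p.1 p.2)) * ENNReal.ofReal (f s (vOutStar v p.1 p.2)))
            (k := fun x => ENNReal.ofReal (K * φ) * (ENNReal.ofReal (f s x) * ENNReal.ofReal (pr x ^ k)))
            (h := fun x => ENNReal.ofReal (2 ^ k * φ) * (ENNReal.ofReal (f s x) * ENNReal.ofReal (pr x ^ k))) (by fun_prop) (by fun_prop)
            (by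
              rintro ⟨w, σ⟩
              simp only
              refine le_trans ?_ le_self_add
              have gen : ∀ x y, pr v ≤ 2 * pr x → ENNReal.ofReal (f s x) * ENNReal.ofReal (f s y) ≤ ENNReal.ofReal (2 ^ k * φ) * (ENNReal.ofReal (f s x) * ENNReal.ofReal (pr x ^ k)) := by
                intro x y hxy
                have := pr_pos x
                rw [← ENNReal.ofReal_mul (hfs.nn x), ← ENNReal.ofReal_mul (hfs.nn x), ← ENNReal.ofReal_mul (by positivity)]
                apply ENNReal.ofReal_le_ofReal
                have h1 : 1 ≤ 2 ^ k * φ * pr x ^ k := by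
                  calc (1:ℝ) ≤ (2 * pr x) ^ k * (pr v ^ k)⁻¹ := by
                        rw [← div_eq_mul_inv, one_le_div (pow_pos (pr_pos v) k)]
                        have := pr_pos v
                        gcongr
                    _ ≤ (2 * pr x) ^ k * φ := by gcongr
                    _ = _ := by rw [mul_pow]; ring
                calc f s x * f s y ≤ f s x * 1 := mul_le_mul_of_nonneg_left (hfs.le1 y) (hfs.nn x)
                  _ ≤ f s x * (2 ^ k * φ * pr x ^ k) := mul_le_mul_of_nonneg_left h1 (hfs.nn x)
                  _ = _ := by ring
              have hadd := pr_add v w σ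
              rcases le_total (pr (vOut v w σ)) (pr (vOutStar v w σ)) with h | h
              · refine le_trans ?_ le_add_self
                rw [mul_comm]
                exact gen _ _ (by linarith)
              · refine le_trans ?_ le_self_add
                exact gen _ _ (by linarith))
            (by
              rintro ⟨w, σ⟩
              simp only
              refine le_trans ?_ le_self_add
              have := pr_pos (vOut v w σ)
              rw [← ENNReal.ofReal_mul (hfs.nn _), ← ENNReal.ofReal_mul (hfs.nn _), ← ENNReal.ofReal_mul (by positivity)]
              apply ENNReal.ofReal_le_ofReal
              refine (kk _ _ (pr_mul v w σ)).trans (le_of_eq (by ring)))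
            (by
              rintro ⟨w, σ⟩
              simp only
              refine le_trans ?_ le_self_add
              have := pr_pos (vOutStar v w σ)
              rw [← ENNReal.ofReal_mul (hfs.nn _), ← ENNReal.ofReal_mul (hfs.nn _), ← ENNReal.ofReal_mul (by positivity)]
              apply ENNReal.ofReal_le_ofReal
              rw [mul_comm (f s (vOut v w σ))]
              refine (kk _ _ ((pr_mul v w σ).trans_eq (mul_comm _ _))).trans (le_of_eq (by ring)))
          have wi : WI γ v (fun x => ENNReal.ofReal (f s x) * ENNReal.ofReal (pr x ^ k)) ≤ ENNReal.ofReal (2 * ‖v‖ ^ γ) * Kt := by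
            refine (WI_big C.h0 C.h2 (hR₀.trans hv) (by fun_prop)).trans ?_
            gcongr
            refine le_trans (le_of_eq ?_) (hmo s hs0 hsT)
            unfold N2 MO
            apply lintegral_congr; intro x
            simp only [pr]
            rw [pow_succ (1 + ‖x‖ ^ 2) k, ENNReal.ofReal_mul (by positivity)]; ring
          have wc : ∀ c : ℝ≥0∞, WI γ v (fun x => c * (ENNReal.ofReal (f s x) * ENNReal.ofReal (pr x ^ k))) = c * WI γ v (fun x => ENNReal.ofReal (f s x) * ENNReal.ofReal (pr x ^ k)) := by
            intro c
            unfold WI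
            rw [← lintegral_const_mul _ (by fun_prop)]
            apply lintegral_congr; intro x; ring
          rw [wc, wc] at j
          unfold GG
          refine j.trans ?_
          have vγ : 0 ≤ ‖v‖ ^ γ := by positivity
          calc _ ≤ 6 * (Lb b (graz ε) * (ENNReal.ofReal (K * φ) * (ENNReal.ofReal (2 * ‖v‖ ^ γ) * Kt))) +
                3 * ENNReal.ofReal (ε⁻¹ ^ 5) * (Lb b (fun _ => 1) * (ENNReal.ofReal (2 ^ k * φ) * (ENNReal.ofReal (2 * ‖v‖ ^ γ) * Kt))) := by gcongr
            _ = (12 * Kt * Lb b (graz ε)) * ENNReal.ofReal (K * φ) * ENNReal.ofReal (‖v‖ ^ γ) + Q * ENNReal.ofReal φ * ENNReal.ofReal (‖v‖ ^ γ) := by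
                rw [ENNReal.ofReal_mul (p := 2) (by norm_num), ENNReal.ofReal_mul (p := 2 ^ k) (by positivity), hQ,
                  show ENNReal.ofReal 2 = 2 by simp]
                ring
            _ ≤ ENNReal.ofReal (c₁ / 2) * ENNReal.ofReal (K * φ) * ENNReal.ofReal (‖v‖ ^ γ) + ENNReal.ofReal (Q.toReal) * ENNReal.ofReal φ * ENNReal.ofReal (‖v‖ ^ γ) := by
                rw [ENNReal.ofReal_toReal hQf]; gcongr
            _ = ENNReal.ofReal (c₁ / 2 * (K * φ) * ‖v‖ ^ γ + Q.toReal * φ * ‖v‖ ^ γ) := by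
                have : 0 ≤ Q.toReal := ENNReal.toReal_nonneg
                rw [ENNReal.ofReal_add (by positivity) (by positivity), ENNReal.ofReal_mul (p := c₁ / 2 * (K * φ)) (by positivity), ENNReal.ofReal_mul (p := c₁ / 2) (by positivity),
                  ENNReal.ofReal_mul (p := Q.toReal * φ) (by positivity), ENNReal.ofReal_mul (p := Q.toReal) (by positivity)]
            _ = _ := by
                congr 1; field_simp
        have hbd := ode_bound C hc₁ (fun s => hloss s v hv) (m := (K / 2 + Q.toReal / c₁) * φ) (by positivity) hG ht0 htT
        refine hbd.trans (max_le ?_ ?_)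
        · refine (hi v).trans ?_
          calc C0 * (pr v ^ k)⁻¹ ≤ C0 * φ := by gcongr
            _ ≤ _ := by gcongr; rw [hD]; linarith
        · gcongr
          rw [hD]; linarith
    · rintro ⟨⟨t, ht⟩, v⟩
      refine ((C.uf t).le1 v).trans ?_
      simp only
      rw [← div_eq_mul_inv, one_le_div (pow_pos (by linarith [hmin v]) k)]
      have := hmin v
      gcongr
      exact min_le_right _ _
  intro t ht0 htT v
  have := main (pr v) (pr_one v) (⟨t, ht0, htT⟩, v)
  simpa using this
end

set_option maxHeartbeats 1000000 in
lemma geomX {v X Y w : R3} {s c r κ τ : ℝ} {j : ℕ} (hE : ‖X‖ ^ 2 + ‖Y‖ ^ 2 = ‖v‖ ^ 2 + ‖w‖ ^ 2) (hsum : X + Y = v + w)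
    (hX : ‖X - v‖ = s * r) (hY : ‖Y - v‖ = c * r) (hsc : s ^ 2 + c ^ 2 = 1) (hs : 0 ≤ s) (hc : 0 ≤ c) (hr : 0 ≤ r) (hV : 1 ≤ ‖v‖)
    (hκ0 : 0 < κ) (hκ : κ ≤ τ / 4) (hτ : τ ≤ 1 / 8) (hXs : ‖X‖ ≤ κ * ‖v‖) (hκk : 1 ≤ 2 * (1 - κ ^ 2) ^ (j + 3)) :
    (c ≤ 2 * τ ∧ (pr Y ^ (j + 3))⁻¹ ≤ 8 * (pr v ^ (j + 3))⁻¹ * s ^ 5) ∨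
      (pr Y ^ (j + 3))⁻¹ ≤ 4096 * ((1 + τ ^ 2 / 4) ^ j)⁻¹ * (pr v ^ (j + 3))⁻¹ * s ^ 5 := by
  have hτ0 : 0 < τ := by linarith
  have hs1 : s ≤ 1 := by nlinarith [sq_nonneg c]
  have hXV : (1 - κ) * ‖v‖ ≤ s * r := by
    rw [← hX]
    have := norm_sub_norm_le v X
    rw [norm_sub_rev] at this
    linarith
  have hκs : κ ≤ 1 / 32 := by linarith
  have hsr : ‖v‖ / 2 < s * r := by
    have := mul_le_mul_of_nonneg_right hκs (norm_nonneg v)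
    linarith
  have hs0 : 0 < s := by
    rcases hs.eq_or_lt with h | h
    · rw [← h] at hsr; linarith
    · exact h
  have hpY := pr_pos Y
  have hpv := pr_pos v
  have hYp : pr Y = pr v + ‖w‖ ^ 2 - ‖X‖ ^ 2 := by unfold pr; linarith
  have hX2 : ‖X‖ ^ 2 ≤ κ ^ 2 * ‖v‖ ^ 2 := by
    rw [← mul_pow]; gcongr
  have hκ2 : κ ^ 2 ≤ 1 / 2 := by
    have := pow_le_pow_left₀ hκ0.le hκs 2
    norm_num at this; linarith
  rcases le_total (c * r) (τ * ‖v‖) with h | h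
  · left
    have hcs : c ≤ 2 * τ * s := by
      have h1 : c * r ≤ 2 * τ * s * r := by
        have := mul_le_mul_of_nonneg_left hsr.le hτ0.le
        linarith
      have hr0 : 0 < r := by
        rcases hr.eq_or_lt with h | h
        · rw [← h] at hsr; linarith
        · exact h
      exact le_of_mul_le_mul_right h1 hr0
    have hc2 : c ≤ 2 * τ := hcs.trans (mul_le_of_le_one_right (by linarith) hs1)
    refine ⟨hc2, ?_⟩
    have hs9 : 9 / 10 ≤ s := by
      have := pow_le_pow_left₀ hc (hc2.trans (by linarith : 2 * τ ≤ 1 / 4)) 2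
      refine (sq_le_sq₀ (by norm_num) hs).1 ?_
      norm_num at this ⊢; linarith
    have hs5 : 1 ≤ 4 * s ^ 5 := by
      have : (9/10:ℝ) ^ 5 ≤ s ^ 5 := by gcongr
      norm_num at this ⊢
      linarith
    have hYv : pr v * (1 - κ ^ 2) ≤ pr Y := by
      rw [hYp]; unfold pr; linarith [sq_nonneg ‖w‖, sq_nonneg κ]
    have h1 : pr v ^ (j + 3) * (1 - κ ^ 2) ^ (j + 3) ≤ pr Y ^ (j + 3) := by
      rw [← mul_pow]
      have : 0 ≤ 1 - κ ^ 2 := by linarith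
      gcongr
    have hp : 0 < pr v ^ (j + 3) := by positivity
    have hq : 0 < pr Y ^ (j + 3) := by positivity
    have h2 : pr v ^ (j + 3) ≤ 2 * pr Y ^ (j + 3) := by
      calc pr v ^ (j + 3) ≤ pr v ^ (j + 3) * (2 * (1 - κ ^ 2) ^ (j + 3)) := le_mul_of_one_le_right hp.le hκk
        _ = 2 * (pr v ^ (j + 3) * (1 - κ ^ 2) ^ (j + 3)) := by ring
        _ ≤ _ := by gcongr
    generalize pr v ^ (j + 3) = A at *
    generalize pr Y ^ (j + 3) = B at *
    calc B⁻¹ = A * (A⁻¹ * B⁻¹) := by field_simp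
      _ ≤ 2 * B * (A⁻¹ * B⁻¹) := by gcongr
      _ = 2 * A⁻¹ * 1 := by field_simp
      _ ≤ 2 * A⁻¹ * (4 * s ^ 5) := by gcongr
      _ = _ := by ring
  · right
    have hκv := mul_le_mul_of_nonneg_right hκ (norm_nonneg v)
    have hw : 3 / 4 * (c * r) ≤ ‖w‖ := by
      have e : w = X + (Y - v) := by rw [← add_sub_assoc, hsum]; abel
      have h1 := norm_sub_norm_le (Y - v) (-X)
      rw [sub_neg_eq_add, add_comm (Y - v), ← e, norm_neg, hY] at h1
      linarith
    have hcr : 0 ≤ c * r := by positivity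
    have hw2 : 9 / 16 * (c * r) ^ 2 ≤ ‖w‖ ^ 2 := by
      have := pow_le_pow_left₀ (by positivity) hw 2
      linarith
    have hX3 : ‖X‖ ≤ c * r / 4 := by linarith
    have hX4 : ‖X‖ ^ 2 ≤ (c * r) ^ 2 / 16 := by
      have := pow_le_pow_left₀ (norm_nonneg X) hX3 2
      linarith
    set u := (c * r) ^ 2 / ‖v‖ ^ 2 with hu
    have hu0 : 0 ≤ u := by positivity
    have hV2 : 0 < ‖v‖ ^ 2 := by positivity
    have hue : (c * r) ^ 2 = u * ‖v‖ ^ 2 := by rw [hu]; field_simp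
    have huτ : τ ^ 2 ≤ u := by
      rw [hu, le_div_iff₀ hV2, ← mul_pow]; gcongr
    have hYv : pr v * (1 + u / 4) ≤ pr Y := by
      rw [hYp]; unfold pr
      have : u * 1 ≤ u * ‖v‖ ^ 2 := by gcongr; exact one_le_pow₀ hV
      rw [hue] at hw2 hX4
      linarith
    have hs2 : 1 ≤ 16 * (1 + u / 4) * s ^ 2 := by
      have h1 : c ^ 2 * ‖v‖ ^ 2 ≤ 4 * (s ^ 2 * (u * ‖v‖ ^ 2)) := by
        rw [← hue]
        have : ‖v‖ ^ 2 ≤ 4 * (s * r) ^ 2 := by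
          have := pow_le_pow_left₀ (by positivity) hsr.le 2
          linarith
        have h2 : c ^ 2 * ‖v‖ ^ 2 ≤ c ^ 2 * (4 * (s * r) ^ 2) := by gcongr
        exact h2.trans (le_of_eq (by ring))
      have h2 : c ^ 2 ≤ 4 * (s ^ 2 * u) := by
        have : c ^ 2 * ‖v‖ ^ 2 ≤ (4 * (s ^ 2 * u)) * ‖v‖ ^ 2 := by linarith
        exact le_of_mul_le_mul_right this hV2
      linarith [sq_nonneg s]
    have hs6 : 1 ≤ 4096 * (1 + u / 4) ^ 3 * s ^ 5 := by
      have h1 : 1 ≤ (16 * (1 + u / 4) * s ^ 2) ^ 3 := one_le_pow₀ hs2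
      have h2 : s ^ 6 ≤ s ^ 5 := pow_le_pow_of_le_one hs hs1 (by norm_num)
      calc (1:ℝ) ≤ (16 * (1 + u / 4) * s ^ 2) ^ 3 := h1
        _ = 4096 * (1 + u / 4) ^ 3 * s ^ 6 := by ring
        _ ≤ _ := by gcongr
    have hp : 0 < pr v ^ (j + 3) := by positivity
    have hq : 0 < pr Y ^ (j + 3) := by positivity
    have ht : 0 < (1 + τ ^ 2 / 4) ^ j := by positivity
    have h1 : pr v ^ (j + 3) * ((1 + τ ^ 2 / 4) ^ j * (1 + u / 4) ^ 3) ≤ pr Y ^ (j + 3) := by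
      calc _ ≤ pr v ^ (j + 3) * ((1 + u / 4) ^ j * (1 + u / 4) ^ 3) := by gcongr
        _ = (pr v * (1 + u / 4)) ^ (j + 3) := by rw [mul_pow, ← pow_add]
        _ ≤ _ := by gcongr
    have h3 : pr v ^ (j + 3) * (1 + τ ^ 2 / 4) ^ j ≤ 4096 * s ^ 5 * pr Y ^ (j + 3) := by
      calc pr v ^ (j + 3) * (1 + τ ^ 2 / 4) ^ j ≤ pr v ^ (j + 3) * (1 + τ ^ 2 / 4) ^ j * (4096 * (1 + u / 4) ^ 3 * s ^ 5) :=
            le_mul_of_one_le_right (by positivity) hs6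
        _ = 4096 * s ^ 5 * (pr v ^ (j + 3) * ((1 + τ ^ 2 / 4) ^ j * (1 + u / 4) ^ 3)) := by ring
        _ ≤ _ := by gcongr
    generalize pr v ^ (j + 3) = A at *
    generalize pr Y ^ (j + 3) = B at *
    generalize (1 + τ ^ 2 / 4) ^ j = D at *
    calc B⁻¹ = (A * D) * (A⁻¹ * D⁻¹ * B⁻¹) := by field_simp
      _ ≤ (4096 * s ^ 5 * B) * (A⁻¹ * D⁻¹ * B⁻¹) := by gcongr
      _ = _ := by field_simp

lemma far_pr {v X : R3} {κ : ℝ} (hκ0 : 0 < κ) (hκ : κ ≤ 1) (h : κ * ‖v‖ ≤ ‖X‖) (k : ℕ) :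
    (pr X ^ k)⁻¹ ≤ (κ ^ 2)⁻¹ ^ k * (pr v ^ k)⁻¹ := by
  rw [inv_pow, ← mul_inv, ← mul_pow]
  have := pr_pos v
  gcongr
  unfold pr
  have : κ ^ 2 * ‖v‖ ^ 2 ≤ ‖X‖ ^ 2 := by rw [← mul_pow]; gcongr
  nlinarith

lemma half_pow {s : ℝ} (h : 1 / 2 ≤ s) : 1 ≤ 32 * s ^ 5 := by
  have : (1/2:ℝ) ^ 5 ≤ s ^ 5 := by gcongr
  norm_num at this
  linarith

/-- one-sided majorant -/
def Hm (δ A κ : ℝ) (v : R3) (F : R3 → ℝ≥0∞) (gr s5 : ℝ≥0∞) (x : R3) : ℝ≥0∞ :=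
  8 * (gr * s5 * F x) + ENNReal.ofReal δ * (1 * s5 * F x) + ENNReal.ofReal A * (1 * s5 * (F x * tl κ v x))

lemma Hm_side {v X Y w : R3} {s c r κ τ K : ℝ} {j : ℕ} {g : R3 → ℝ} {gr : ℝ≥0∞} {A : ℝ}
    (hE : ‖X‖ ^ 2 + ‖Y‖ ^ 2 = ‖v‖ ^ 2 + ‖w‖ ^ 2) (hsum : X + Y = v + w)
    (hX : ‖X - v‖ = s * r) (hY : ‖Y - v‖ = c * r) (hsc : s ^ 2 + c ^ 2 = 1) (hs : 0 ≤ s) (hc : 0 ≤ c) (hr : 0 ≤ r) (hV : 1 ≤ ‖v‖)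
    (hκ0 : 0 < κ) (hκ : κ ≤ τ / 4) (hτ : τ ≤ 1 / 8) (hXs : ‖X‖ ≤ κ * ‖v‖) (hκk : 1 ≤ 2 * (1 - κ ^ 2) ^ (j + 3))
    (hg0 : ∀ x, 0 ≤ g x) (hK : 0 ≤ K) (hg : ∀ x, g x ≤ K * (pr x ^ (j + 3))⁻¹) (hgr : c ≤ 2 * τ → gr = 1) :
    ENNReal.ofReal (g X) * ENNReal.ofReal (g Y) ≤ ENNReal.ofReal (K * (pr v ^ (j + 3))⁻¹) *
      Hm (4096 * ((1 + τ ^ 2 / 4) ^ j)⁻¹) A κ v (fun x => ENNReal.ofReal (g x)) gr (ENNReal.ofReal (s ^ 5)) X := by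
  have hp := pr_pos v
  have hX0 := hg0 X
  have hKp : 0 ≤ K * (pr v ^ (j + 3))⁻¹ := by positivity
  rcases geomX hE hsum hX hY hsc hs hc hr hV hκ0 hκ hτ hXs hκk with ⟨h1, h2⟩ | h2
  · unfold Hm
    rw [hgr h1]
    refine le_trans ?_ (mul_le_mul_right (le_self_add.trans le_self_add) _)
    rw [one_mul, show (8:ℝ≥0∞) = ENNReal.ofReal 8 by simp, ← ENNReal.ofReal_mul (by positivity), ← ENNReal.ofReal_mul (by positivity),
      ← ENNReal.ofReal_mul (by positivity), ← ENNReal.ofReal_mul (by positivity)]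
    apply ENNReal.ofReal_le_ofReal
    calc g X * g Y ≤ g X * (K * (8 * (pr v ^ (j + 3))⁻¹ * s ^ 5)) := by
          gcongr
          exact (hg Y).trans (by gcongr)
      _ = _ := by ring
  · unfold Hm
    refine le_trans ?_ (mul_le_mul_right (le_add_self.trans le_self_add) _)
    rw [one_mul, ← ENNReal.ofReal_mul (by positivity), ← ENNReal.ofReal_mul (by positivity),
      ← ENNReal.ofReal_mul (by positivity), ← ENNReal.ofReal_mul (by positivity)]
    apply ENNReal.ofReal_le_ofReal
    calc g X * g Y ≤ g X * (K * (4096 * ((1 + τ ^ 2 / 4) ^ j)⁻¹ * (pr v ^ (j + 3))⁻¹ * s ^ 5)) := by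
          gcongr
          exact (hg Y).trans (by gcongr)
      _ = _ := by ring

lemma Hm_far {v X Y : R3} {s κ K δ : ℝ} {k : ℕ} {g : R3 → ℝ} {gr : ℝ≥0∞}
    (hs : 1 / 2 ≤ s) (hκ0 : 0 < κ) (hκ1 : κ ≤ 1) (hX : κ * ‖v‖ ≤ ‖X‖) (hY : κ * ‖v‖ ≤ ‖Y‖)
    (hg0 : ∀ x, 0 ≤ g x) (hK : 0 ≤ K) (hg : ∀ x, g x ≤ K * (pr x ^ k)⁻¹) :
    ENNReal.ofReal (g X) * ENNReal.ofReal (g Y) ≤ ENNReal.ofReal (K * (pr v ^ k)⁻¹) *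
      Hm δ (32 * (κ ^ 2)⁻¹ ^ k) κ v (fun x => ENNReal.ofReal (g x)) gr (ENNReal.ofReal (s ^ 5)) X := by
  have hp := pr_pos v
  have hX0 := hg0 X
  have hKp : 0 ≤ K * (pr v ^ k)⁻¹ := by positivity
  unfold Hm
  refine le_trans ?_ (mul_le_mul_right le_add_self _)
  have hs0 : 0 ≤ s := by linarith
  simp only [tl, if_pos hX, mul_one]
  rw [one_mul, ← ENNReal.ofReal_mul (by positivity), ← ENNReal.ofReal_mul (by positivity),
      ← ENNReal.ofReal_mul (by positivity), ← ENNReal.ofReal_mul (by positivity)]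
  apply ENNReal.ofReal_le_ofReal
  have h1 := half_pow hs
  calc g X * g Y ≤ g X * (K * ((κ ^ 2)⁻¹ ^ k * (pr v ^ k)⁻¹) * (32 * s ^ 5)) := by
        gcongr
        refine (hg Y).trans ?_
        refine le_trans (by gcongr; exact far_pr hκ0 hκ1 hY k) (le_mul_of_one_le_right (by positivity) h1)
    _ = _ := by ring

lemma Hm_pt (v w : R3) (σ : S2) {κ τ K : ℝ} {j : ℕ} {g : R3 → ℝ} (hV : 1 ≤ ‖v‖)
    (hκ0 : 0 < κ) (hκ : κ ≤ τ / 4) (hτ : τ ≤ 1 / 8) (hκk : 1 ≤ 2 * (1 - κ ^ 2) ^ (j + 3))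
    (hg0 : ∀ x, 0 ≤ g x) (hK : 0 ≤ K) (hg : ∀ x, g x ≤ K * (pr x ^ (j + 3))⁻¹) :
    ENNReal.ofReal (g (vOut v w σ)) * ENNReal.ofReal (g (vOutStar v w σ)) ≤ ENNReal.ofReal (K * (pr v ^ (j + 3))⁻¹) *
      (Hm (4096 * ((1 + τ ^ 2 / 4) ^ j)⁻¹) (32 * (κ ^ 2)⁻¹ ^ (j + 3)) κ v (fun x => ENNReal.ofReal (g x)) (graz (2 * τ) (cosAngle v w σ)) (ENNReal.ofReal (sh (cosAngle v w σ) ^ 5)) (vOut v w σ) +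
       Hm (4096 * ((1 + τ ^ 2 / 4) ^ j)⁻¹) (32 * (κ ^ 2)⁻¹ ^ (j + 3)) κ v (fun x => ENNReal.ofReal (g x)) (graz (2 * τ) (cosAngle v w σ)) (ENNReal.ofReal (ch (cosAngle v w σ) ^ 5)) (vOutStar v w σ)) := by
  have hsc := sh_ch_sq v w σ
  have hs := sh_nonneg (cosAngle v w σ)
  have hc := ch_nonneg (cosAngle v w σ)
  have hE := vOut_energy v w σ
  have hS := vOut_add v w σ
  have hX := vOut_sub v w σ
  have hY := vOutStar_sub v w σ
  have hr := norm_nonneg (v - w)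
  have hκ1 : κ ≤ 1 := by linarith
  rw [mul_add]
  rcases le_total ‖vOut v w σ‖ (κ * ‖v‖) with h | h
  · refine le_trans ?_ le_self_add
    refine Hm_side hE hS hX hY hsc hs hc hr hV hκ0 hκ hτ h hκk hg0 hK hg ?_
    intro h; simp [graz, h]
  · rcases le_total ‖vOutStar v w σ‖ (κ * ‖v‖) with h' | h'
    · refine le_trans ?_ le_add_self
      rw [mul_comm]
      refine Hm_side (by rw [← hE]; ring) (by rw [← hS]; abel) hY hX (by rw [← hsc]; ring) hc hs hr hV hκ0 hκ hτ h' hκk hg0 hK hg ?_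
      intro h; simp [graz, h]
    · rcases le_total (1/2) (sh (cosAngle v w σ)) with h2 | h2
      · exact le_trans (Hm_far h2 hκ0 hκ1 h h' hg0 hK hg) le_self_add
      · refine le_trans ?_ le_add_self
        rw [mul_comm]
        refine Hm_far ?_ hκ0 hκ1 h' h hg0 hK hg
        by_contra h3
        push Not at h3
        have a1 := pow_le_pow_left₀ hs h2 2
        have a2 := pow_le_pow_left₀ hc h3.le 2
        norm_num at a1 a2
        linarith

lemma Hm_JX {γ : ℝ} (h0 : 0 < γ) (h2 : γ ≤ 2) {b : ℝ → ℝ} (hb : GradCutoff b) {v : R3} (hV : 1 ≤ ‖v‖) {δ A κ ε : ℝ} (hκ : 0 < κ) {F : R3 → ℝ≥0∞} (hF : Measurable F) :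
    JJ γ b v (fun p => Hm δ A κ v F (graz ε (cosAngle v p.1 p.2)) (ENNReal.ofReal (sh (cosAngle v p.1 p.2) ^ 5)) (vOut v p.1 p.2)) ≤
     ENNReal.ofReal (‖v‖ ^ γ) * (N2 F * (16 * Lb b (graz ε) + 2 * ENNReal.ofReal δ * Lb b (fun _ => 1) + ENNReal.ofReal A * Lb b (fun _ => 1) * ENNReal.ofReal ((1 + κ⁻¹) ^ 2) * ENNReal.ofReal (1 / ‖v‖ ^ 2))) := by
  unfold Hm
  rw [JJ_add hb (by fun_prop), JJ_add hb (by fun_prop), JJ_const_mul hb (by fun_prop), JJ_const_mul hb (by fun_prop), JJ_const_mul hb (by fun_prop)]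
  have a1 := carlJX h0 h2 hb (measurable_graz ε) (graz_le ε) hF v
  have a2 := carlJX h0 h2 hb (χ := fun _ => 1) (by fun_prop) (fun _ => le_rfl) hF v
  have a3 := carlJX h0 h2 hb (χ := fun _ => 1) (by fun_prop) (fun _ => le_rfl) (F := fun x => F x * tl κ v x) (by fun_prop) v
  have w1 := WI_big h0 h2 hV hF
  have w2 := WI_tail h0 h2 hκ (v := v) (by linarith) hF
  calc _ ≤ 8 * (Lb b (graz ε) * (ENNReal.ofReal (2 * ‖v‖ ^ γ) * N2 F)) + ENNReal.ofReal δ * (Lb b (fun _ => 1) * (ENNReal.ofReal (2 * ‖v‖ ^ γ) * N2 F)) + ENNReal.ofReal A * (Lb b (fun _ => 1) * (ENNReal.ofReal (‖v‖ ^ γ * ((1 + κ⁻¹) ^ 2 / ‖v‖ ^ 2)) * N2 F)) := by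
        gcongr
        · exact a1.trans (mul_le_mul_right w1 _)
        · exact a2.trans (mul_le_mul_right w1 _)
        · exact a3.trans (mul_le_mul_right w2 _)
    _ = _ := by
        rw [ENNReal.ofReal_mul (p := 2) (by norm_num), ENNReal.ofReal_mul (p := ‖v‖ ^ γ) (by positivity), div_eq_mul_one_div ((1 + κ⁻¹) ^ 2),
          ENNReal.ofReal_mul (p := (1 + κ⁻¹) ^ 2) (by positivity), show ENNReal.ofReal 2 = 2 by simp]
        ring

lemma Hm_JY {γ : ℝ} (h0 : 0 < γ) (h2 : γ ≤ 2) {b : ℝ → ℝ} (hb : GradCutoff b) {v : R3} (hV : 1 ≤ ‖v‖) {δ A κ ε : ℝ} (hκ : 0 < κ) {F : R3 → ℝ≥0∞} (hF : Measurable F) :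
    JJ γ b v (fun p => Hm δ A κ v F (graz ε (cosAngle v p.1 p.2)) (ENNReal.ofReal (ch (cosAngle v p.1 p.2) ^ 5)) (vOutStar v p.1 p.2)) ≤
     ENNReal.ofReal (‖v‖ ^ γ) * (N2 F * (16 * Lb b (graz ε) + 2 * ENNReal.ofReal δ * Lb b (fun _ => 1) + ENNReal.ofReal A * Lb b (fun _ => 1) * ENNReal.ofReal ((1 + κ⁻¹) ^ 2) * ENNReal.ofReal (1 / ‖v‖ ^ 2))) := by
  unfold Hm
  rw [JJ_add hb (by fun_prop), JJ_add hb (by fun_prop), JJ_const_mul hb (by fun_prop), JJ_const_mul hb (by fun_prop), JJ_const_mul hb (by fun_prop)]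
  have a1 := carlJY h0 h2 hb (measurable_graz ε) (graz_le ε) hF v
  have a2 := carlJY h0 h2 hb (χ := fun _ => 1) (by fun_prop) (fun _ => le_rfl) hF v
  have a3 := carlJY h0 h2 hb (χ := fun _ => 1) (by fun_prop) (fun _ => le_rfl) (F := fun x => F x * tl κ v x) (by fun_prop) v
  have w1 := WI_big h0 h2 hV hF
  have w2 := WI_tail h0 h2 hκ (v := v) (by linarith) hF
  calc _ ≤ 8 * (Lb b (graz ε) * (ENNReal.ofReal (2 * ‖v‖ ^ γ) * N2 F)) + ENNReal.ofReal δ * (Lb b (fun _ => 1) * (ENNReal.ofReal (2 * ‖v‖ ^ γ) * N2 F)) + ENNReal.ofReal A * (Lb b (fun _ => 1) * (ENNReal.ofReal (‖v‖ ^ γ * ((1 + κ⁻¹) ^ 2 / ‖v‖ ^ 2)) * N2 F)) := by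
        gcongr
        · exact a1.trans (mul_le_mul_right w1 _)
        · exact a2.trans (mul_le_mul_right w1 _)
        · exact a3.trans (mul_le_mul_right w2 _)
    _ = _ := by
        rw [ENNReal.ofReal_mul (p := 2) (by norm_num), ENNReal.ofReal_mul (p := ‖v‖ ^ γ) (by positivity), div_eq_mul_one_div ((1 + κ⁻¹) ^ 2),
          ENNReal.ofReal_mul (p := (1 + κ⁻¹) ^ 2) (by positivity), show ENNReal.ofReal 2 = 2 by simp]
        ring

lemma gain_small {γ : ℝ} (h0 : 0 < γ) (h2 : γ ≤ 2) {b : ℝ → ℝ} (hb : GradCutoff b) {Es : ℝ≥0∞} (hEs : Es ≠ ⊤) {η : ℝ} (hη : 0 < η) :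
    ∃ j : ℕ, 2 ≤ j ∧ ∃ R : ℝ, 1 ≤ R ∧ ∀ g : R3 → ℝ, Measurable g → (∀ x, 0 ≤ g x) → ∀ K, 0 ≤ K → (∀ x, g x ≤ K * (pr x ^ (j + 3))⁻¹) →
      N2 (fun x => ENNReal.ofReal (g x)) ≤ Es → ∀ v : R3, R ≤ ‖v‖ → GG γ b g v ≤ ENNReal.ofReal (η * K * (pr v ^ (j + 3))⁻¹ * ‖v‖ ^ γ) := by
  have L1 := Lb_one_fin hb
  have hη3 : (0:ℝ≥0∞) < ENNReal.ofReal (η / 3) := ENNReal.ofReal_pos.2 (by linarith)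
  obtain ⟨x, hx, hx'⟩ := enn_small_mul (c := 32 * Es) (by finiteness) hη3
  obtain ⟨ε, hε0, hε, hεx⟩ := Lb_graz_small hb hx
  have s1 : 32 * Es * Lb b (graz ε) ≤ ENNReal.ofReal (η / 3) := le_trans (by gcongr) hx'
  obtain ⟨τ, hτd⟩ : ∃ τ, τ = ε / 2 := ⟨_, rfl⟩
  have hτ0 : 0 < τ := by linarith
  have hτ : τ ≤ 1 / 8 := by linarith
  have hε2 : ε = 2 * τ := by linarith
  obtain ⟨y, hy, hy'⟩ := enn_small_mul (c := 4 * Es * Lb b (fun _ => 1)) (by finiteness) hη3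
  obtain ⟨j, hj2, hj⟩ : ∃ j : ℕ, 2 ≤ j ∧ ENNReal.ofReal (4096 * ((1 + τ ^ 2 / 4) ^ j)⁻¹) ≤ y := by
    have t1 : Filter.Tendsto (fun j : ℕ => ENNReal.ofReal (4096 * ((1 + τ ^ 2 / 4) ^ j)⁻¹)) Filter.atTop (nhds (ENNReal.ofReal (4096 * 0))) := by
      refine ENNReal.tendsto_ofReal (Filter.Tendsto.const_mul _ ?_)
      simp_rw [← inv_pow]
      exact tendsto_pow_atTop_nhds_zero_of_lt_one (by positivity) (inv_lt_one_of_one_lt₀ (by have : 0 < τ ^ 2 := by positivity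
                                                                                             linarith))
    rw [mul_zero, ENNReal.ofReal_zero] at t1
    have := (t1.eventually (gt_mem_nhds hy)).and (Filter.eventually_ge_atTop 2)
    obtain ⟨j, h1, h2⟩ := this.exists
    exact ⟨j, h2, h1.le⟩
  obtain ⟨κ, hκ0, hκ, hκk⟩ : ∃ κ : ℝ, 0 < κ ∧ κ ≤ τ / 4 ∧ 1 ≤ 2 * (1 - κ ^ 2) ^ (j + 3) := by
    have t1 : Filter.Tendsto (fun κ : ℝ => 2 * (1 - κ ^ 2) ^ (j + 3)) (nhds 0) (nhds (2 * (1 - 0 ^ 2) ^ (j + 3))) :=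
      (by fun_prop : Continuous (fun κ : ℝ => 2 * (1 - κ ^ 2) ^ (j + 3))).tendsto 0
    have t2 := (t1.mono_left (nhdsWithin_le_nhds (s := Ioi 0))).eventually (lt_mem_nhds (a := 1) (by norm_num))
    have t3 : ∀ᶠ κ : ℝ in nhdsWithin 0 (Ioi 0), κ < τ / 4 := nhdsWithin_le_nhds (gt_mem_nhds (by linarith))
    obtain ⟨κ, ⟨h1, h2⟩, h3⟩ := ((t2.and t3).and self_mem_nhdsWithin).exists
    exact ⟨κ, h3, h2.le, h1.le⟩
  set A := 32 * (κ ^ 2)⁻¹ ^ (j + 3) with hA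
  set δ := 4096 * ((1 + τ ^ 2 / 4) ^ j)⁻¹ with hδ
  obtain ⟨R, hR, hR'⟩ := exists_big (C := 2 * Es * (ENNReal.ofReal A * Lb b (fun _ => 1) * ENNReal.ofReal ((1 + κ⁻¹) ^ 2))) (by finiteness) hη3
  refine ⟨j, hj2, R, hR, ?_⟩
  intro g hgm hg0 K hK hg hN v hv
  have hV : 1 ≤ ‖v‖ := hR.trans hv
  have hbm := hb.measurable
  unfold GG
  have hFm : Measurable (fun x => ENNReal.ofReal (g x)) := by fun_prop
  have m1 : Measurable (fun p : R3 × S2 => Hm δ A κ v (fun x => ENNReal.ofReal (g x)) (graz ε (cosAngle v p.1 p.2)) (ENNReal.ofReal (sh (cosAngle v p.1 p.2) ^ 5)) (vOut v p.1 p.2)) := by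
    unfold Hm; fun_prop
  have m2 : Measurable (fun p : R3 × S2 => Hm δ A κ v (fun x => ENNReal.ofReal (g x)) (graz ε (cosAngle v p.1 p.2)) (ENNReal.ofReal (ch (cosAngle v p.1 p.2) ^ 5)) (vOutStar v p.1 p.2)) := by
    unfold Hm; fun_prop
  have hp := pr_pos v
  refine (JJ_mono (fun p => Hm_pt v p.1 p.2 hV hκ0 hκ hτ hκk hg0 hK hg)).trans ?_
  rw [← hε2, ← hδ, ← hA, JJ_const_mul hb (by exact m1.add m2), JJ_add hb m1]
  have jx := Hm_JX h0 h2 hb hV (δ := δ) (A := A) (ε := ε) hκ0 hFm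
  have jy := Hm_JY h0 h2 hb hV (δ := δ) (A := A) (ε := ε) hκ0 hFm
  have hKp : 0 ≤ K * (pr v ^ (j + 3))⁻¹ := by positivity
  calc _ ≤ ENNReal.ofReal (K * (pr v ^ (j + 3))⁻¹) * (2 * (ENNReal.ofReal (‖v‖ ^ γ) * (Es * (16 * Lb b (graz ε) + 2 * y * Lb b (fun _ => 1) + ENNReal.ofReal A * Lb b (fun _ => 1) * ENNReal.ofReal ((1 + κ⁻¹) ^ 2) * ENNReal.ofReal (1 / ‖v‖ ^ 2))))) := by
        refine mul_le_mul_right ?_ _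
        rw [two_mul]
        refine (add_le_add jx jy).trans ?_
        gcongr
    _ = ENNReal.ofReal (K * (pr v ^ (j + 3))⁻¹) * (ENNReal.ofReal (‖v‖ ^ γ) * ((32 * Es * Lb b (graz ε)) + (4 * Es * Lb b (fun _ => 1) * y) +
          (2 * Es * (ENNReal.ofReal A * Lb b (fun _ => 1) * ENNReal.ofReal ((1 + κ⁻¹) ^ 2))) * ENNReal.ofReal (1 / ‖v‖ ^ 2))) := by ring
    _ ≤ ENNReal.ofReal (K * (pr v ^ (j + 3))⁻¹) * (ENNReal.ofReal (‖v‖ ^ γ) * (ENNReal.ofReal (η / 3) + ENNReal.ofReal (η / 3) + ENNReal.ofReal (η / 3))) := by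
        refine mul_le_mul_right (mul_le_mul_right (add_le_add (add_le_add s1 hy') (hR' _ hv)) _) _
    _ = _ := by
        rw [← ENNReal.ofReal_add (by positivity) (by positivity), ← ENNReal.ofReal_add (by positivity) (by positivity),
          ← ENNReal.ofReal_mul (by positivity), ← ENNReal.ofReal_mul (by positivity)]
        congr 1; ring

/-- truncated energy -/
def mm (N : ℝ) (v : R3) : ℝ := min (‖v‖ ^ 2) N

@[fun_prop]
lemma measurable_mm (N : ℝ) : Measurable (mm N) := by unfold mm; fun_prop

lemma mm_nonneg {N : ℝ} (hN : 0 ≤ N) (v : R3) : 0 ≤ mm N v := le_min (by positivity) hN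

lemma mm_sub {N : ℝ} (hN : 0 ≤ N) (v w : R3) (σ : S2) : mm N v ≤ mm N (vOut v w σ) + mm N (vOutStar v w σ) := by
  have h1 := vOut_energy v w σ
  have h2 := sq_nonneg ‖w‖
  have a1 := sq_nonneg ‖vOut v w σ‖
  have a2 := sq_nonneg ‖vOutStar v w σ‖
  unfold mm
  rcases le_total (‖vOut v w σ‖ ^ 2) N with h3 | h3
  · rcases le_total (‖vOutStar v w σ‖ ^ 2) N with h4 | h4
    · rw [min_eq_left h3, min_eq_left h4]
      exact (min_le_left _ _).trans (by linarith)
    · rw [min_eq_right h4]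
      exact (min_le_right _ _).trans (by linarith [le_min a1 hN])
  · rw [min_eq_right h3]
    exact (min_le_right _ _).trans (by linarith [le_min a2 hN])

lemma poly_exp (k : ℕ) {β : ℝ} (hβ : 0 < β) : ∃ B : ℝ, 0 ≤ B ∧ ∀ v : R3, Real.exp (-β * ‖v‖ ^ 2) ≤ B * (pr v ^ k)⁻¹ := by
  refine ⟨(k.factorial : ℝ) * (β ^ k)⁻¹ * Real.exp β, by positivity, fun v => ?_⟩
  have hp := pr_pos v
  have h := Real.pow_div_factorial_le_exp (β * pr v) (by positivity) k
  have hk : (0:ℝ) < (k.factorial : ℝ) := by positivity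
  rw [div_le_iff₀ hk, mul_pow] at h
  rw [← div_eq_mul_inv, le_div_iff₀ (by positivity)]
  have e : Real.exp β = Real.exp (β * pr v) * Real.exp (-β * ‖v‖ ^ 2) := by
    rw [← Real.exp_add]; congr 1; unfold pr; ring
  have hb : 0 < β ^ k := by positivity
  rw [e]
  have : pr v ^ k ≤ (k.factorial : ℝ) * (β ^ k)⁻¹ * Real.exp (β * pr v) := by
    rw [mul_assoc, mul_comm, mul_assoc, inv_mul_eq_div, le_div_iff₀ hb]; linarith
  calc _ ≤ Real.exp (-β * ‖v‖ ^ 2) * ((k.factorial : ℝ) * (β ^ k)⁻¹ * Real.exp (β * pr v)) := by gcongr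
    _ = _ := by ring

lemma I3_fin : ∫⁻ v : R3, ENNReal.ofReal ((pr v ^ 3)⁻¹) ≠ ⊤ := by
  have h := integrable_rpow_neg_one_add_norm_sq (E := R3) (μ := volume) (r := 6) (by simp [R3]; norm_num)
  have e : ∀ v : R3, (1 + ‖v‖ ^ 2) ^ (-6 / 2 : ℝ) = (pr v ^ 3)⁻¹ := by
    intro v
    rw [show (-6 / 2 : ℝ) = -((3:ℕ):ℝ) by norm_num, Real.rpow_neg (by positivity), Real.rpow_natCast]; rfl
  simp only [e] at h
  have := h.lintegral_lt_top
  exact this.ne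

section
variable {γ : ℝ} {b : ℝ → ℝ} {Z : Set R3} {f : ℝ → R3 → ℝ} {M E : ℝ≥0∞}

lemma stepA (C : Cl γ b Z f M E) {c₁ R : ℝ} (hc₁ : 0 < c₁) (hR1 : 1 ≤ R) (hloss : ∀ t v, R ≤ ‖v‖ → ENNReal.ofReal (c₁ * ‖v‖ ^ γ) ≤ LL γ b (f t) v)
    {k : ℕ} {Es : ℝ≥0∞} (gain : ∀ g : R3 → ℝ, Measurable g → (∀ x, 0 ≤ g x) → ∀ K, 0 ≤ K → (∀ x, g x ≤ K * (pr x ^ k)⁻¹) →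
      N2 (fun x => ENNReal.ofReal (g x)) ≤ Es → ∀ v : R3, R ≤ ‖v‖ → GG γ b g v ≤ ENNReal.ofReal (c₁ / 2 * K * (pr v ^ k)⁻¹ * ‖v‖ ^ γ))
    {a K₀ N T A : ℝ} (ha : 0 ≤ a) (haR : Real.exp (a * R ^ 2) ≤ 2) (hN : 0 ≤ N) (hK₀ : 0 ≤ K₀)
    (hi : ∀ v, f 0 v ≤ K₀ * ((pr v ^ k)⁻¹ * Real.exp (-a * ‖v‖ ^ 2))) (hA0 : 0 ≤ A)
    (hA : ∀ t, 0 ≤ t → t ≤ T → ∀ v, f t v ≤ A * (pr v ^ k)⁻¹)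
    (hEn : ∀ t, 0 ≤ t → t ≤ T → N2 (fun x => ENNReal.ofReal (f t x * Real.exp (a * mm N x))) ≤ Es) :
    ∀ t, 0 ≤ t → t ≤ T → ∀ v, f t v ≤ 2 * (K₀ + 2 * (1 + R ^ 2) ^ k) * ((pr v ^ k)⁻¹ * Real.exp (-a * mm N v)) := by
  have main := contract (ι := {t : ℝ // 0 ≤ t ∧ t ≤ T} × R3) (u := fun i => f i.1 i.2) (φ := fun i => (pr i.2 ^ k)⁻¹ * Real.exp (-a * mm N i.2))
    (C := K₀ + 2 * (1 + R ^ 2) ^ k) (K₀ := A * Real.exp (a * N)) (by positivity) (by positivity) ?_ ?_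
  · intro t h1 h2 v
    exact main (⟨t, h1, h2⟩, v)
  · intro K hK hb i
    obtain ⟨⟨t, ht0, htT⟩, v⟩ := i
    simp only
    have hf := C.uf t
    have hp := pr_pos v
    have hm0 := mm_nonneg hN v
    set φ := (pr v ^ k)⁻¹ * Real.exp (-a * mm N v) with hφ
    have hφ0 : 0 ≤ φ := by positivity
    rcases le_total ‖v‖ R with hv | hv
    · have h1 : 1 ≤ 2 * (1 + R ^ 2) ^ k * φ := by
        have e1 : 1 ≤ (1 + R ^ 2) ^ k * (pr v ^ k)⁻¹ := by
          rw [← div_eq_mul_inv, one_le_div (by positivity)]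
          unfold pr; gcongr
        have e2 : 1 ≤ 2 * Real.exp (-a * mm N v) := by
          have : Real.exp (a * mm N v) ≤ 2 := by
            refine le_trans (Real.exp_le_exp.2 ?_) haR
            gcongr
            exact (min_le_left _ _).trans (by gcongr)
          calc (1:ℝ) = Real.exp (a * mm N v) * Real.exp (-a * mm N v) := by rw [← Real.exp_add]; simp
            _ ≤ _ := by gcongr
        calc (1:ℝ) = 1 * 1 := by norm_num
          _ ≤ ((1 + R ^ 2) ^ k * (pr v ^ k)⁻¹) * (2 * Real.exp (-a * mm N v)) := by gcongr
          _ = _ := by rw [hφ]; ring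
      refine (hf.le1 v).trans (h1.trans ?_)
      gcongr
      linarith
    · have hG : ∀ s, 0 ≤ s → s ≤ T → GG γ b (f s) v ≤ ENNReal.ofReal (c₁ * ‖v‖ ^ γ * (K / 2 * φ)) := by
        intro s hs0 hsT
        have hfs := C.uf s
        have hms := hfs.meas
        have hbs := fun x => hb (⟨s, hs0, hsT⟩, x)
        simp only at hbs
        have g1 := gain (fun x => f s x * Real.exp (a * mm N x)) (by fun_prop) (fun x => mul_nonneg (hfs.nn x) (by positivity)) K hK
          (by
            intro x
            have hpx := pr_pos x
            calc f s x * Real.exp (a * mm N x) ≤ (K * ((pr x ^ k)⁻¹ * Real.exp (-a * mm N x))) * Real.exp (a * mm N x) := by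
                  gcongr; exact hbs x
              _ = K * (pr x ^ k)⁻¹ * (Real.exp (-a * mm N x) * Real.exp (a * mm N x)) := by ring
              _ = _ := by rw [← Real.exp_add]; simp) (hEn s hs0 hsT) v hv
        have g2 : GG γ b (f s) v ≤ ENNReal.ofReal (Real.exp (-a * mm N v)) * GG γ b (fun x => f s x * Real.exp (a * mm N x)) v := by
          unfold GG
          rw [← JJ_const_mul C.hb (by fun_prop)]
          apply JJ_mono
          rintro ⟨w, σ⟩
          simp only
          have n1 := hfs.nn (vOut v w σ)
          have n2 := hfs.nn (vOutStar v w σ)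
          rw [← ENNReal.ofReal_mul n1, ← ENNReal.ofReal_mul (by positivity), ← ENNReal.ofReal_mul (by positivity)]
          apply ENNReal.ofReal_le_ofReal
          have e1 : 1 ≤ Real.exp (-a * mm N v + (a * mm N (vOut v w σ) + a * mm N (vOutStar v w σ))) := by
            apply Real.one_le_exp
            have := mul_le_mul_of_nonneg_left (mm_sub hN v w σ) ha
            linarith
          rw [Real.exp_add, Real.exp_add] at e1
          calc _ ≤ f s (vOut v w σ) * f s (vOutStar v w σ) * _ := le_mul_of_one_le_right (mul_nonneg n1 n2) e1
            _ = _ := by ring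
        refine g2.trans ((mul_le_mul_right g1 _).trans (le_of_eq ?_))
        rw [← ENNReal.ofReal_mul (by positivity)]
        congr 1
        rw [hφ]; ring
      have hbd := ode_bound C hc₁ (fun s => hloss s v hv) (m := K / 2 * φ) (by positivity) hG ht0 htT
      have hR0 : 0 ≤ 2 * (1 + R ^ 2) ^ k := by positivity
      refine hbd.trans (max_le ?_ ?_)
      · refine (hi v).trans ?_
        calc K₀ * ((pr v ^ k)⁻¹ * Real.exp (-a * ‖v‖ ^ 2)) ≤ K₀ * φ := by
              rw [hφ]; gcongr K₀ * (_ * ?_)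
              apply Real.exp_le_exp.2
              have := mul_le_mul_of_nonneg_left (min_le_left (‖v‖ ^ 2) N) ha
              unfold mm; linarith
          _ ≤ _ := by gcongr; linarith
      · gcongr
        linarith
  · rintro ⟨⟨t, ht0, htT⟩, v⟩
    simp only
    have hp := pr_pos v
    refine (hA t ht0 htT v).trans ?_
    have : 1 ≤ Real.exp (a * N + -a * mm N v) := by
      apply Real.one_le_exp
      have := mul_le_mul_of_nonneg_left (min_le_right (‖v‖ ^ 2) N) ha
      unfold mm; linarith
    rw [Real.exp_add] at this
    calc A * (pr v ^ k)⁻¹ ≤ A * (pr v ^ k)⁻¹ * _ := le_mul_of_one_le_right (by positivity) this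
      _ = _ := by ring

lemma stepB {h : R3 → ℝ} (hm : Measurable h) (h0 : ∀ v, 0 ≤ h v) {k : ℕ} (hk : 5 ≤ k) {a S N D : ℝ} (ha : 0 ≤ a) (hN : 0 ≤ N) (hS : 1 ≤ S) (haS : Real.exp (a * S ^ 2) ≤ 2)
    (hD : 0 ≤ D) (hSD : (∫⁻ v : R3, ENNReal.ofReal ((pr v ^ 3)⁻¹)) * ENNReal.ofReal D * ENNReal.ofReal (1 / S ^ 2) ≤ 1)
    (hb : ∀ v, h v ≤ D * ((pr v ^ k)⁻¹ * Real.exp (-a * mm N v))) :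
    N2 (fun x => ENNReal.ofReal (h x * Real.exp (a * mm N x))) ≤ 2 * N2 (fun x => ENNReal.ofReal (h x)) + 1 := by
  have key : ∀ v, ENNReal.ofReal (h v * Real.exp (a * mm N v)) * ENNReal.ofReal (1 + ‖v‖ ^ 2) ≤
      ENNReal.ofReal 2 * (ENNReal.ofReal (h v) * ENNReal.ofReal (1 + ‖v‖ ^ 2)) + ENNReal.ofReal ((pr v ^ 3)⁻¹) * (ENNReal.ofReal D * ENNReal.ofReal (1 / S ^ 2)) := by
    intro v
    have hp := pr_pos v
    have hp1 := pr_one v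
    have hv := h0 v
    rw [← ENNReal.ofReal_mul (by positivity), ← ENNReal.ofReal_mul hv, ← ENNReal.ofReal_mul (by positivity),
      ← ENNReal.ofReal_mul (by positivity), ← ENNReal.ofReal_mul (by positivity), ← ENNReal.ofReal_add (by positivity) (by positivity)]
    apply ENNReal.ofReal_le_ofReal
    rcases le_total ‖v‖ S with hvS | hvS
    · have : Real.exp (a * mm N v) ≤ 2 := by
        refine le_trans (Real.exp_le_exp.2 ?_) haS
        gcongr
        exact (min_le_left _ _).trans (by gcongr)
      have h3 : 0 ≤ (pr v ^ 3)⁻¹ * (D * (1 / S ^ 2)) := by positivity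
      have h4 : h v * Real.exp (a * mm N v) * (1 + ‖v‖ ^ 2) ≤ h v * 2 * (1 + ‖v‖ ^ 2) := by gcongr
      linarith
    · have h3 : 0 ≤ 2 * (h v * (1 + ‖v‖ ^ 2)) := by positivity
      have h4 : h v * Real.exp (a * mm N v) * (1 + ‖v‖ ^ 2) ≤ (pr v ^ 3)⁻¹ * (D * (1 / S ^ 2)) := by
        calc h v * Real.exp (a * mm N v) * (1 + ‖v‖ ^ 2) ≤ (D * ((pr v ^ k)⁻¹ * Real.exp (-a * mm N v))) * Real.exp (a * mm N v) * pr v := by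
              unfold pr; gcongr; exact hb v
          _ = D * (pr v ^ k)⁻¹ * pr v * (Real.exp (-a * mm N v) * Real.exp (a * mm N v)) := by ring
          _ = D * ((pr v ^ k)⁻¹ * pr v) := by rw [← Real.exp_add]; simp; ring
          _ ≤ D * ((pr v ^ 5)⁻¹ * pr v) := by gcongr
          _ = D * ((pr v ^ 3)⁻¹ * (pr v)⁻¹) := by congr 1; field_simp
          _ ≤ D * ((pr v ^ 3)⁻¹ * (S ^ 2)⁻¹) := by
              gcongr
              unfold pr
              have : S ^ 2 ≤ ‖v‖ ^ 2 := by gcongr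
              linarith
          _ = _ := by rw [one_div]; ring
      linarith
  unfold N2
  refine (lintegral_mono key).trans ?_
  have hpm : Measurable (fun v : R3 => ENNReal.ofReal ((pr v ^ 3)⁻¹)) := by fun_prop
  rw [lintegral_add_left (by fun_prop), lintegral_const_mul _ (by fun_prop), lintegral_mul_const _ hpm, ← mul_assoc (∫⁻ v : R3, ENNReal.ofReal ((pr v ^ 3)⁻¹))]
  rw [show ENNReal.ofReal 2 = 2 by simp]
  exact add_le_add_right hSD _
end

section
variable {γ : ℝ} {b : ℝ → ℝ} {Z : Set R3} {f : ℝ → R3 → ℝ} {M E : ℝ≥0∞}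

lemma gauss_clean (C : Cl γ b Z f M E) (hM : M ≠ 0) {a₀ K : ℝ} (ha₀ : 0 < a₀) (hK : 0 ≤ K) (hi : ∀ v, f 0 v ≤ K * Real.exp (-a₀ * ‖v‖ ^ 2)) :
    ∃ a D : ℝ, 0 < a ∧ a < a₀ ∧ 0 < D ∧ ∀ t, 0 ≤ t → ∀ v, f t v ≤ D * Real.exp (-a * ‖v‖ ^ 2) := by
  obtain ⟨c₁, R₀, hc₁, hR₀, hloss⟩ := loss_lower C hM
  have hEf := C.Efin
  obtain ⟨j, hj, R₂, hR₂, gain⟩ := gain_small C.h0 C.h2 C.hb (Es := 2 * E + 1) (by finiteness) (η := c₁ / 2) (by linarith)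
  obtain ⟨k, hkd⟩ : ∃ k, k = j + 3 := ⟨_, rfl⟩
  have hk : 5 ≤ k := by omega
  rw [← hkd] at gain
  obtain ⟨R, hRd⟩ : ∃ R, R = max R₀ R₂ := ⟨_, rfl⟩
  have hR0' : R₀ ≤ R := by rw [hRd]; exact le_max_left _ _
  have hR2' : R₂ ≤ R := by rw [hRd]; exact le_max_right _ _
  have hR : 1 ≤ R := hR₀.trans hR0'
  obtain ⟨B, hB0, hB⟩ := poly_exp k (β := a₀ / 2) (by linarith)
  have hi2 : ∀ a, a ≤ a₀ / 2 → ∀ v, f 0 v ≤ (K * B) * ((pr v ^ k)⁻¹ * Real.exp (-a * ‖v‖ ^ 2)) := by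
    intro a ha v
    have hp := pr_pos v
    refine (hi v).trans ?_
    have e : -a₀ * ‖v‖ ^ 2 = -(a₀ / 2) * ‖v‖ ^ 2 + -(a₀ / 2) * ‖v‖ ^ 2 := by ring
    rw [e, Real.exp_add]
    calc _ ≤ K * ((B * (pr v ^ k)⁻¹) * Real.exp (-a * ‖v‖ ^ 2)) := by
          gcongr
          exact hB v
      _ = _ := by ring
  -- initial moments
  have hmo0 : MO (fun v => ENNReal.ofReal (f 0 v)) (k + 1) ≠ ⊤ := by
    obtain ⟨B', hB0', hB'⟩ := poly_exp (k + 4) ha₀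
    have hm := (C.uf 0).meas
    refine ne_top_of_le_ne_top (b := ENNReal.ofReal (K * B') * ∫⁻ v : R3, ENNReal.ofReal ((pr v ^ 3)⁻¹)) (ENNReal.mul_ne_top (by finiteness) I3_fin) ?_
    unfold MO
    rw [← lintegral_const_mul _ (by fun_prop)]
    apply lintegral_mono; intro v
    simp only
    have hp := pr_pos v
    rw [← ENNReal.ofReal_mul ((C.uf 0).nn v), ← ENNReal.ofReal_mul (by positivity)]
    apply ENNReal.ofReal_le_ofReal
    change f 0 v * pr v ^ (k + 1) ≤ _
    calc f 0 v * pr v ^ (k + 1) ≤ K * (B' * (pr v ^ (k + 4))⁻¹) * pr v ^ (k + 1) := by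
          gcongr
          exact (hi v).trans (by gcongr; exact hB' v)
      _ = _ := by
          rw [show k + 4 = (k + 1) + 3 by ring, pow_add (pr v) (k + 1) 3]
          have : 0 < pr v ^ (k + 1) := by positivity
          field_simp
  obtain ⟨D, hDd⟩ : ∃ D, D = 2 * (K * B + 2 * (1 + R ^ 2) ^ k) := ⟨_, rfl⟩
  have hD0 : 0 < D := by rw [hDd]; positivity
  have I3 := I3_fin
  obtain ⟨S, hS, hS'⟩ := exists_big (C := (∫⁻ v : R3, ENNReal.ofReal ((pr v ^ 3)⁻¹)) * ENNReal.ofReal (2 * D)) (ENNReal.mul_ne_top I3 (by finiteness)) one_pos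
  have hS'' := hS' S le_rfl
  have hl2 : 0 < Real.log 2 := Real.log_pos (by norm_num)
  have hRS : 0 < R ^ 2 + S ^ 2 := by positivity
  obtain ⟨as, has⟩ : ∃ a, a = min (a₀ / 2) (Real.log 2 / (R ^ 2 + S ^ 2)) := ⟨_, rfl⟩
  have has0 : 0 < as := by rw [has]; exact lt_min (by linarith) (by positivity)
  have has1 : as ≤ a₀ / 2 := by rw [has]; exact min_le_left _ _
  have has2 : as * (R ^ 2 + S ^ 2) ≤ Real.log 2 := by
    rw [← le_div_iff₀ hRS, has]; exact min_le_right _ _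
  have hex : ∀ a x, 0 ≤ a → a ≤ as → 0 ≤ x → x ≤ R ^ 2 + S ^ 2 → Real.exp (a * x) ≤ 2 := by
    intro a x h1 h2 h3 h4
    rw [← Real.exp_log (x := 2) (by norm_num)]
    apply Real.exp_le_exp.2
    refine le_trans ?_ has2
    gcongr
  have hR2 : R ^ 2 ≤ R ^ 2 + S ^ 2 := by linarith [sq_nonneg S]
  have hS2 : S ^ 2 ≤ R ^ 2 + S ^ 2 := by linarith [sq_nonneg R]
  refine ⟨as, D, has0, by linarith, hD0, ?_⟩
  intro T hT v₀
  obtain ⟨Kt, hKt, hmo⟩ := moments C k hmo0 T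
  obtain ⟨A, hA0, hA⟩ := poly_pt C hM k (C0 := K * B) (by positivity) (fun v => by
    have := hi2 0 (by linarith) v
    simpa using this) hKt hmo
  obtain ⟨N, hNd⟩ : ∃ N, N = ‖v₀‖ ^ 2 := ⟨_, rfl⟩
  have hN : 0 ≤ N := by rw [hNd]; positivity
  have step : ∀ a, 0 ≤ a → a ≤ as → (∀ t, 0 ≤ t → t ≤ T → N2 (fun x => ENNReal.ofReal (f t x * Real.exp (a * mm N x))) ≤ 2 * E + 1) →
      ∀ t, 0 ≤ t → t ≤ T → ∀ v, f t v ≤ D * ((pr v ^ k)⁻¹ * Real.exp (-a * mm N v)) := by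
    intro a h1 h2 h3
    rw [hDd]
    exact stepA C hc₁ hR (fun t v hv => hloss t v (hR0'.trans hv)) (fun g hg h0 K' hK' hgb hgN v hv => gain g hg h0 K' hK' hgb hgN v (hR2'.trans hv))
      h1 (hex a _ h1 h2 (by positivity) hR2) hN (by positivity) (hi2 a (h2.trans has1)) hA0 hA h3
  obtain ⟨n, hn⟩ := exists_nat_gt (as * N / Real.log 2)
  have hnpos : (0:ℝ) < n := lt_of_le_of_lt (by positivity) hn
  have hh : Real.exp (as / n * N) ≤ 2 := by
    rw [← Real.exp_log (x := 2) (by norm_num)]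
    apply Real.exp_le_exp.2
    rw [div_lt_iff₀ hl2] at hn
    rw [div_mul_eq_mul_div, div_le_iff₀ hnpos]; linarith
  have ind : ∀ i : ℕ, i ≤ n → ∀ t, 0 ≤ t → t ≤ T → ∀ v, f t v ≤ D * ((pr v ^ k)⁻¹ * Real.exp (-(as / n * i) * mm N v)) := by
    intro i
    induction i with
    | zero =>
      intro _
      refine step _ (by positivity) (by simpa using has0.le) ?_
      intro t _ _
      simp only [Nat.cast_zero, mul_zero, zero_mul, Real.exp_zero, mul_one]
      rw [C.energy t, two_mul]
      exact le_self_add.trans le_self_add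
    | succ i ih =>
      intro hin
      have ih' := ih (by omega)
      have hal : as / n * ((i + 1 : ℕ) : ℝ) ≤ as := by
        rw [div_mul_eq_mul_div, div_le_iff₀ hnpos]
        have : ((i + 1 : ℕ) : ℝ) ≤ n := by exact_mod_cast hin
        gcongr
      have ha0 : 0 ≤ as / n * ((i + 1 : ℕ) : ℝ) := by positivity
      refine step _ ha0 hal ?_
      intro t ht0 htT
      have hfm := (C.uf t).meas
      rw [← C.energy t]
      refine stepB hfm (C.uf t).nn hk (D := 2 * D) ha0 hN hS (hex _ _ ha0 hal (by positivity) hS2) (by positivity) hS'' ?_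
      intro v
      have hp := pr_pos v
      refine (ih' t ht0 htT v).trans ?_
      have e1 : Real.exp (-(as / n * i) * mm N v) ≤ 2 * Real.exp (-(as / n * ((i + 1 : ℕ) : ℝ)) * mm N v) := by
        have : -(as / n * i) * mm N v = as / n * mm N v + -(as / n * ((i + 1 : ℕ) : ℝ)) * mm N v := by push_cast; ring
        rw [this, Real.exp_add]
        gcongr
        refine le_trans (Real.exp_le_exp.2 ?_) hh
        gcongr
        exact min_le_right _ _
      calc _ ≤ D * ((pr v ^ k)⁻¹ * (2 * Real.exp (-(as / n * ((i + 1 : ℕ) : ℝ)) * mm N v))) := by gcongr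
        _ = _ := by ring
  have fin := ind n le_rfl T hT le_rfl v₀
  rw [div_mul_cancel₀ _ hnpos.ne'] at fin
  have hmv : mm N v₀ = ‖v₀‖ ^ 2 := by rw [hNd]; simp [mm]
  rw [hmv] at fin
  refine fin.trans ?_
  have h1 := pr_one v₀
  gcongr
  refine mul_le_of_le_one_left (by positivity) ?_
  exact inv_le_one_of_one_le₀ (one_le_pow₀ h1)
end

end Proof

/-- Propagation of an `L^∞` Gaussian upper bound for the
Boltzmann–Fermi–Dirac equation under (H3). -/
theorem gaussian_upper_bound_BFD
    (γ : ℝ) (hγ₀ : 0 < γ) (hγ₂ : γ ≤ 2) (b : ℝ → ℝ) (hb : GradCutoff b)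
    (α C : ℝ) (hα : α < 2) (hC : 0 < C)
    (hH3 : ∀ θ ∈ Ioo (0:ℝ) π, b (Real.cos θ) * Real.sin θ ^ α ≤ C)
    (f₀ : R3 → ℝ) (hf₀meas : Measurable f₀)
    (hf₀bd : ∀ᵐ v : R3 ∂volume, 0 ≤ f₀ v ∧ f₀ v ≤ 1) (hf₀L12 : MemL1s 2 f₀)
    (f : ℝ → R3 → ℝ) (hf : IsFDSolution γ b f₀ f)
    (a₀ c₀ : ℝ) (ha₀ : 0 < a₀)
    (hinit : ∀ᵐ v : R3 ∂volume, f₀ v ≤ Real.exp (-a₀ * ‖v‖ ^ 2 + c₀)) :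
    ∃ a : ℝ, 0 < a ∧ a < a₀ ∧ ∃ c : ℝ, ∀ t : ℝ, 0 ≤ t →
      ∀ᵐ v : R3 ∂volume, f t v ≤ Real.exp (-a * ‖v‖ ^ 2 + c) := by
  obtain ⟨Z, g, M, E, hCl, hgf, hg0, hgN⟩ := clean_exists hγ₀ hγ₂ hb hf (ae_iff.1 hinit)
  have hae : ∀ᵐ v : R3 ∂volume, v ∉ Z := measure_eq_zero_iff_ae_notMem.1 hCl.Z0
  by_cases hM : M = 0
  · refine ⟨a₀ / 2, by linarith, by linarith, 0, fun t ht => ?_⟩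
    have hm := (hCl.uf t).meas
    have h1 := hCl.mass t
    rw [hM, lintegral_eq_zero_iff (by fun_prop)] at h1
    filter_upwards [h1, hae] with v h2 hv
    rw [← hgf t ht v hv]
    have h3 : g t v ≤ 0 := ENNReal.ofReal_eq_zero.1 h2
    exact h3.trans (Real.exp_pos _).le
  · obtain ⟨a, D, ha, haa, hD, hb'⟩ := gauss_clean hCl hM ha₀ (K := Real.exp c₀) (Real.exp_pos _).le (by
      intro v
      by_cases hv : v ∈ Z
      · rw [hCl.zero 0 v hv]; positivity
      · rw [hg0 v hv, ← Real.exp_add, add_comm]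
        have := hgN v hv
        simpa using this)
    refine ⟨a, ha, haa, Real.log D, fun t ht => ?_⟩
    filter_upwards [hae] with v hv
    rw [← hgf t ht v hv, Real.exp_add, Real.exp_log hD, mul_comm]
    exact hb' t ht v
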